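/- arXiv:2205.00330 — 15 statements merged into one kernel-verified Lean document; each statement's English description precedes it below -/
import Mathlib

section
/- For all Borel sets A, B ⊆ X^n it holds that ∫_B P(x,A) P_n(dx) = ∫_A P(x,B) P_n(dx); that is, the single-tournament selection kernel P satisfies the detailed balance equation with respect to P_n, so in particular P_n is a reversible stationary measure for P. -/
open MeasureTheory Filter Topology ProbabilityTheory

/-- **Detailed balance for the single tournament selection kernel.**
`μ` is an exchangeable probability measure on `X^(n+1)` (the law of `(ξ₁,…,ξ_{n+1})`),
`μn` its marginal on the first `n` coordinates, `κ` the conditional distribution of the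
`(n+1)`-st coordinate given the first `n`, `w` a bounded continuous strictly positive
fitness function, `Pn` the measure with density `∏ⱼ w(xⱼ)` (normalized) w.r.t. `μn`, and
`P` the single-tournament selection kernel.  Then for all Borel `A, B ⊆ X^n`,
`∫_B P(x,A) Pn(dx) = ∫_A P(x,B) Pn(dx)`. -/
theorem stmt_0
    {X : Type*} [MeasurableSpace X] [TopologicalSpace X] [PolishSpace X] [BorelSpace X]
    (n : ℕ) (hn : 1 ≤ n)
    (μ : Measure (Fin (n + 1) → X)) [IsProbabilityMeasure μ]
    (hexch : ∀ σ : Equiv.Perm (Fin (n + 1)), Measure.map (fun x => x ∘ σ) μ = μ)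
    (μn : Measure (Fin n → X))
    (hμn : μn = Measure.map (fun (x : Fin (n + 1) → X) (i : Fin n) => x i.castSucc) μ)
    (κ : Kernel (Fin n → X) X) [IsMarkovKernel κ]
    (hκ : ∀ (A : Set (Fin n → X)) (B : Set X), MeasurableSet A → MeasurableSet B →
      μ {x | (fun i : Fin n => x i.castSucc) ∈ A ∧ x (Fin.last n) ∈ B} = ∫⁻ y in A, κ y B ∂μn)
    (w : X → ℝ) (hw_pos : ∀ x, 0 < w x) (hw_cont : Continuous w)
    (hw_bdd : ∃ M : ℝ, ∀ x, w x ≤ M)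
    (Zn : ℝ) (hZn : Zn = ∫ x, ∏ j : Fin n, w (x j) ∂μn)
    (Pn : Measure (Fin n → X)) [IsProbabilityMeasure Pn]
    (hPn : ∀ A : Set (Fin n → X), MeasurableSet A →
      (Pn A).toReal = Zn⁻¹ * ∫ x in A, ∏ j : Fin n, w (x j) ∂μn)
    (b : Fin n → (Fin n → X) → ℝ)
    (hb : ∀ k x, b k x = ∫ y, w (x k) / (w y + w (x k)) ∂(κ x))
    (Pk : Fin n → (Fin n → X) → Set (Fin n → X) → ℝ)
    (hPk : ∀ k x A, Pk k x A =
      (∫ y in {y : X | Function.update x k y ∈ A}, w y / (w y + w (x k)) ∂(κ x))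
        + b k x * Set.indicator A (fun _ => (1 : ℝ)) x)
    (P : (Fin n → X) → Set (Fin n → X) → ℝ)
    (hP : ∀ x A, P x A = (1 / (n : ℝ)) * ∑ k : Fin n, Pk k x A) :
    ∀ A B : Set (Fin n → X), MeasurableSet A → MeasurableSet B →
      ∫ x in B, P x A ∂Pn = ∫ x in A, P x B ∂Pn := by
  classical
  intro A B hA hB
  obtain ⟨M, hM⟩ := hw_bdd
  have hwm : Measurable w := hw_cont.measurable
  set F : (Fin n → X) → ℝ := fun x => ∏ j : Fin n, w (x j) with hF
  have hFm : Measurable F := by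
    rw [hF]
    exact Finset.measurable_prod _ (fun j _ => hwm.comp (measurable_pi_apply j))
  have hF0 : ∀ x, 0 ≤ F x := fun x => Finset.prod_nonneg (fun j _ => (hw_pos _).le)
  have hFM : ∀ x, F x ≤ M ^ n := by
    intro x
    calc F x ≤ ∏ j : Fin n, M :=
          Finset.prod_le_prod (fun j _ => (hw_pos _).le) (fun j _ => hM _)
      _ = M ^ n := by simp
  have hinit : Measurable (fun (x : Fin (n + 1) → X) (i : Fin n) => x i.castSucc) :=
    measurable_pi_lambda _ (fun i => measurable_pi_apply _)
  have hμnp : IsProbabilityMeasure μn := by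
    rw [hμn]; exact Measure.isProbabilityMeasure_map hinit.aemeasurable
  have hZ0 : 0 ≤ Zn := by
    rw [hZn]; exact integral_nonneg hF0
  -- Pn as a density
  have hFint : Integrable F μn := by
    refine Integrable.of_bound hFm.aestronglyMeasurable (M ^ n) (ae_of_all _ fun x => ?_)
    rw [Real.norm_of_nonneg (hF0 x)]; exact hFM x
  have hD : Pn = μn.withDensity (fun x => ENNReal.ofReal (Zn⁻¹ * F x)) := by
    ext S hS
    rw [withDensity_apply _ hS, ← ofReal_integral_eq_lintegral_ofReal
      ((hFint.const_mul _).integrableOn)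
      (ae_of_all _ fun x => mul_nonneg (inv_nonneg.2 hZ0) (hF0 x)),
      integral_const_mul, ← hPn S hS, ENNReal.ofReal_toReal (measure_ne_top _ _)]
  -- the joint law
  set Φ : (Fin (n + 1) → X) → (Fin n → X) × X :=
    fun x => (fun i => x i.castSucc, x (Fin.last n)) with hΦ
  have hΦm : Measurable Φ := hinit.prodMk (measurable_pi_apply _)
  have hJ : μn ⊗ₘ κ = μ.map Φ := by
    have : IsProbabilityMeasure (μ.map Φ) := Measure.isProbabilityMeasure_map hΦm.aemeasurable
    refine Measure.ext_prod (fun {S T} hS hT => ?_)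
    rw [Measure.compProd_apply_prod hS hT, Measure.map_apply hΦm (hS.prod hT), ← hκ S T hS hT]
    rfl
  set ρ := μn ⊗ₘ κ with hρ
  have hup : ∀ k : Fin n, Measurable (fun p : (Fin n → X) × X => Function.update p.1 k p.2) := by
    intro k
    refine measurable_pi_lambda _ (fun i => ?_)
    by_cases h : i = k
    · subst h; simpa using measurable_snd
    · simp only [Function.update_of_ne h]
      exact (measurable_pi_apply i).comp measurable_fst
  have hk : ∀ k : Fin n, Measurable (fun p : (Fin n → X) × X => p.1 k) :=
    fun k => (measurable_pi_apply k).comp measurable_fst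
  have hT : ∀ k : Fin n, MeasurePreserving
      (fun p : (Fin n → X) × X => (Function.update p.1 k p.2, p.1 k)) ρ ρ := by
    intro k
    have hm : Measurable (fun p : (Fin n → X) × X => (Function.update p.1 k p.2, p.1 k)) :=
      (hup k).prodMk (hk k)
    refine ⟨hm, ?_⟩
    have hσ : Measurable (fun x : Fin (n + 1) → X =>
        x ∘ (Equiv.swap k.castSucc (Fin.last n))) :=
      measurable_pi_lambda _ (fun i => measurable_pi_apply _)
    rw [hJ, Measure.map_map hm hΦm]
    conv_rhs => rw [← hexch (Equiv.swap k.castSucc (Fin.last n)), Measure.map_map hΦm hσ]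
    congr 1
    funext x
    simp only [hΦ, Function.comp]
    refine Prod.ext ?_ ?_
    · funext i
      by_cases h : i = k
      · subst h; simp
      · simp only [Function.update_of_ne h]
        rw [Equiv.swap_apply_of_ne_of_ne]
        · exact fun hh => h (Fin.castSucc_injective _ hh)
        · exact (Fin.castSucc_lt_last i).ne
    · simp
  -- the integrands
  let G : Fin n → Set (Fin n → X) → Set (Fin n → X) → (Fin n → X) × X → ℝ :=
    fun k A B p => B.indicator (fun _ => (1 : ℝ)) p.1 * F p.1 * (w p.2 / (w p.2 + w (p.1 k))) *
      A.indicator (fun _ => (1 : ℝ)) (Function.update p.1 k p.2)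
  let S : Fin n → Set (Fin n → X) → Set (Fin n → X) → (Fin n → X) × X → ℝ :=
    fun k A B p => B.indicator (fun _ => (1 : ℝ)) p.1 * F p.1 *
      (w (p.1 k) / (w p.2 + w (p.1 k))) * A.indicator (fun _ => (1 : ℝ)) p.1
  have hone : ∀ C : Set (Fin n → X), MeasurableSet C →
      Measurable (C.indicator (fun _ => (1 : ℝ))) := fun C hC => measurable_const.indicator hC
  have hind0 : ∀ (C : Set (Fin n → X)) x, 0 ≤ C.indicator (fun _ => (1 : ℝ)) x :=
    fun C x => Set.indicator_nonneg (fun _ _ => zero_le_one) x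
  have hind1 : ∀ (C : Set (Fin n → X)) x, C.indicator (fun _ => (1 : ℝ)) x ≤ 1 :=
    fun C x => Set.indicator_le_self' (fun _ _ => zero_le_one) x
  have hbd : ∀ a f r c : ℝ, 0 ≤ a → a ≤ 1 → 0 ≤ f → f ≤ M ^ n → 0 ≤ r → r ≤ 1 → 0 ≤ c → c ≤ 1 →
      ‖a * f * r * c‖ ≤ M ^ n := by
    intro a f r c ha ha1 hf hf1 hr hr1 hc hc1
    rw [Real.norm_of_nonneg (by positivity)]
    have h1 : a * f ≤ f := mul_le_of_le_one_left hf ha1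
    have h2 : a * f * r ≤ a * f := mul_le_of_le_one_right (by positivity) hr1
    have h3 : a * f * r * c ≤ a * f * r := mul_le_of_le_one_right (by positivity) hc1
    linarith
  have hr0 : ∀ x y, 0 ≤ w x / (w y + w x) := fun x y =>
    div_nonneg (hw_pos _).le (add_pos (hw_pos _) (hw_pos _)).le
  have hr1 : ∀ x y, w x / (w y + w x) ≤ 1 := fun x y => by
    rw [div_le_one (add_pos (hw_pos _) (hw_pos _))]; linarith [hw_pos y]
  have hr0' : ∀ x y, 0 ≤ w x / (w x + w y) := fun x y => by rw [add_comm]; exact hr0 x y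
  have hr1' : ∀ x y, w x / (w x + w y) ≤ 1 := fun x y => by rw [add_comm]; exact hr1 x y
  have hfst : Measurable (fun p : (Fin n → X) × X => p.1) := measurable_fst
  have hsnd : Measurable (fun p : (Fin n → X) × X => p.2) := measurable_snd
  have hGi : ∀ k A B, MeasurableSet A → MeasurableSet B → Integrable (G k A B) ρ := by
    intro k A B hA hB
    refine Integrable.of_bound (Measurable.aestronglyMeasurable ?_) (M ^ n)
      (ae_of_all _ fun p => ?_)
    · have h1 := (hone B hB).comp hfst
      have h2 := (hone A hA).comp (hup k)
      have h3 := hFm.comp hfst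
      have h4 := hwm.comp hsnd
      have h5 := hwm.comp (hk k)
      exact ((h1.mul h3).mul (h4.div (h4.add h5))).mul h2
    · exact hbd _ _ _ _ (hind0 _ _) (hind1 _ _) (hF0 _) (hFM _) (hr0' _ _) (hr1' _ _)
        (hind0 _ _) (hind1 _ _)
  have hSi : ∀ k A B, MeasurableSet A → MeasurableSet B → Integrable (S k A B) ρ := by
    intro k A B hA hB
    refine Integrable.of_bound (Measurable.aestronglyMeasurable ?_) (M ^ n)
      (ae_of_all _ fun p => ?_)
    · have h1 := (hone B hB).comp hfst
      have h2 := (hone A hA).comp hfst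
      have h3 := hFm.comp hfst
      have h4 := hwm.comp hsnd
      have h5 := hwm.comp (hk k)
      exact ((h1.mul h3).mul (h5.div (h4.add h5))).mul h2
    · exact hbd _ _ _ _ (hind0 _ _) (hind1 _ _) (hF0 _) (hFM _) (hr0 _ _) (hr1 _ _)
        (hind0 _ _) (hind1 _ _)
  have hSs : ∀ k A B, S k A B = S k B A := by
    intro k A B; funext p; simp only [S]; ring
  have hGT : ∀ k A B p, G k A B (Function.update p.1 k p.2, p.1 k) = G k B A p := by
    rintro k A B ⟨x, y⟩
    have hFu : F (Function.update x k y) * w (x k) = F x * w y := by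
      simp only [hF]
      rw [← Finset.mul_prod_erase Finset.univ _ (Finset.mem_univ k),
        ← Finset.mul_prod_erase Finset.univ (fun j => w (x j)) (Finset.mem_univ k)]
      have : ∏ j ∈ Finset.univ.erase k, w (Function.update x k y j) =
          ∏ j ∈ Finset.univ.erase k, w (x j) :=
        Finset.prod_congr rfl fun j hj => by
          rw [Function.update_of_ne (Finset.ne_of_mem_erase hj)]
      rw [this, Function.update_self]; ring
    simp only [G, Function.update_self, Function.update_idem, Function.update_eq_self]
    rw [add_comm (w (x k))]
    calc _ = B.indicator (fun _ => (1 : ℝ)) (Function.update x k y) *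
          (F (Function.update x k y) * w (x k)) / (w y + w (x k)) *
          A.indicator (fun _ => (1 : ℝ)) x := by ring
      _ = _ := by rw [hFu]; ring
  have hGs : ∀ k A B, MeasurableSet A → MeasurableSet B →
      ∫ p, G k A B p ∂ρ = ∫ p, G k B A p ∂ρ := by
    intro k A B hA hB
    have h := integral_map (μ := ρ) (hT k).measurable.aemeasurable (f := G k A B)
      (by rw [(hT k).map_eq]; exact (hGi k A B hA hB).aestronglyMeasurable)
    rw [(hT k).map_eq] at h
    rw [h]
    exact integral_congr_ae (ae_of_all _ fun p => hGT k A B p)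
  -- main formula
  have key : ∀ A B : Set (Fin n → X), MeasurableSet A → MeasurableSet B →
      ∫ x in B, P x A ∂Pn =
        Zn⁻¹ * (1 / (n : ℝ)) * ∑ k, (∫ p, G k A B p ∂ρ + ∫ p, S k A B p ∂ρ) := by
    intro A B hA hB
    have hmeas : Measurable (fun x => ENNReal.ofReal (Zn⁻¹ * F x)) :=
      (hFm.const_mul _).ennreal_ofReal
    rw [← integral_indicator hB, hD, integral_withDensity_eq_integral_toReal_smul hmeas
      (ae_of_all _ fun x => ENNReal.ofReal_lt_top)]
    have hpt : ∀ x, (ENNReal.ofReal (Zn⁻¹ * F x)).toReal • B.indicator (fun x => P x A) x =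
        Zn⁻¹ * (1 / (n : ℝ)) * ∑ k, (∫ y, G k A B (x, y) ∂(κ x) + ∫ y, S k A B (x, y) ∂(κ x)) := by
      intro x
      rw [ENNReal.toReal_ofReal (mul_nonneg (inv_nonneg.2 hZ0) (hF0 x)), smul_eq_mul]
      have hBi : B.indicator (fun x => P x A) x = B.indicator (fun _ => (1 : ℝ)) x * P x A := by
        by_cases h : x ∈ B <;> simp [h]
      have hG : ∀ k, ∫ y, G k A B (x, y) ∂(κ x) + ∫ y, S k A B (x, y) ∂(κ x) =
          B.indicator (fun _ => (1 : ℝ)) x * F x * Pk k x A := by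
        intro k
        have hset : MeasurableSet {y : X | Function.update x k y ∈ A} :=
          ((hup k).comp (measurable_const.prodMk measurable_id)) hA
        rw [hPk, hb, mul_add, ← integral_indicator hset, ← integral_const_mul,
          ← integral_mul_const, ← integral_const_mul]
        congr 1
        · refine integral_congr_ae (ae_of_all _ fun y => ?_)
          by_cases h : Function.update x k y ∈ A <;> simp [G, h]
        · refine integral_congr_ae (ae_of_all _ fun y => ?_)
          simp only [S]; ring
      simp_rw [hG, ← Finset.mul_sum]
      rw [hBi, hP]; ring
    simp_rw [hpt]
    rw [integral_const_mul]
    congr 1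
    have iG : ∀ k, Integrable (fun x => ∫ y, G k A B (x, y) ∂(κ x)) μn := fun k => by
      simpa using MeasureTheory.Integrable.integral_compProd (κ := Kernel.const Unit μn)
        (η := Kernel.prodMkLeft Unit κ) (a := ()) (hGi k A B hA hB)
    have iS : ∀ k, Integrable (fun x => ∫ y, S k A B (x, y) ∂(κ x)) μn := fun k => by
      simpa using MeasureTheory.Integrable.integral_compProd (κ := Kernel.const Unit μn)
        (η := Kernel.prodMkLeft Unit κ) (a := ()) (hSi k A B hA hB)
    rw [integral_finsetSum]
    swap
    · exact fun k _ => (iG k).add (iS k)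
    refine Finset.sum_congr rfl fun k _ => ?_
    rw [integral_add (iG k) (iS k), Measure.integral_compProd (hGi k A B hA hB),
      Measure.integral_compProd (hSi k A B hA hB)]
  rw [key A B hA hB, key B A hB hA]
  congr 1
  refine Finset.sum_congr rfl fun k _ => ?_
  rw [hGs k A B hA hB, hSs k A B]
end

section
/- For all Borel sets A, B ⊆ X^n it holds that ∫_B P̃(x,A) P_n(dx) = ∫_A P̃(x,B) P_n(dx); that is, the inverse-fitness selection kernel P̃ satisfies the detailed balance equation with respect to P_n, so in particular P_n is a reversible stationary measure for P̃. -/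
open MeasureTheory Filter Topology ProbabilityTheory

theorem aux_int {Y X : Type*} [MeasurableSpace Y] [MeasurableSpace X]
    {ν : Measure Y} [IsProbabilityMeasure ν] {κ : Kernel Y X} [IsMarkovKernel κ]
    {f : Y × X → ℝ} (hf : Integrable f (ν ⊗ₘ κ)) :
    Integrable (fun x => ∫ y, f (x, y) ∂(κ x)) ν := by
  rw [Measure.compProd] at hf
  simpa using hf.integral_compProd

theorem aux_marg {X : Type*} [MeasurableSpace X] (n : ℕ)
    (μ : Measure (Fin (n + 1) → X)) [IsProbabilityMeasure μ]
    (hexch : ∀ σ : Equiv.Perm (Fin (n + 1)), Measure.map (fun x => x ∘ σ) μ = μ)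
    (μn : Measure (Fin n → X)) [IsProbabilityMeasure μn]
    (κ : Kernel (Fin n → X) X) [IsMarkovKernel κ]
    (hκ : ∀ (A : Set (Fin n → X)) (B : Set X), MeasurableSet A → MeasurableSet B →
      μ {x | (fun i : Fin n => x i.castSucc) ∈ A ∧ x (Fin.last n) ∈ B} = ∫⁻ y in A, κ y B ∂μn)
    (k : Fin n) :
    MeasurePreserving (fun z : (Fin n → X) × X => (Function.update z.1 k z.2, z.1 k))
      (μn ⊗ₘ κ) (μn ⊗ₘ κ) := by
  have hφ : Measurable (fun x : Fin (n + 1) → X =>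
      ((fun i : Fin n => x i.castSucc), x (Fin.last n))) := by fun_prop
  have hT : Measurable (fun z : (Fin n → X) × X => (Function.update z.1 k z.2, z.1 k)) := by
    refine Measurable.prodMk ?_ (by fun_prop)
    exact measurable_update'
  have hν : μn ⊗ₘ κ = Measure.map (fun x : Fin (n + 1) → X =>
      ((fun i : Fin n => x i.castSucc), x (Fin.last n))) μ := by
    refine Measure.ext_prod fun {A B} hA hB => ?_
    rw [Measure.compProd_apply_prod hA hB, ← hκ A B hA hB, Measure.map_apply hφ (hA.prod hB)]
    rfl
  refine ⟨hT, ?_⟩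
  have hσ : Measurable (fun x : Fin (n + 1) → X =>
      x ∘ (Equiv.swap k.castSucc (Fin.last n))) := by
    rw [measurable_pi_iff]; intro a; exact measurable_pi_apply _
  conv_lhs => rw [hν]
  rw [Measure.map_map hT hφ, hν]
  conv_rhs => rw [← hexch (Equiv.swap k.castSucc (Fin.last n))]
  rw [Measure.map_map hφ hσ]
  congr 1
  funext x
  simp only [Function.comp_apply, Equiv.swap_apply_right, Prod.mk.injEq, and_true]
  funext i
  by_cases h : i = k
  · subst h; simp
  · rw [Function.update_of_ne h, Equiv.swap_apply_of_ne_of_ne]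
    · simpa using h
    · exact (Fin.castSucc_lt_last i).ne

theorem aux_alg {X : Type*} (n : ℕ) (w : X → ℝ) (hw_pos : ∀ x, 0 < w x) (k : Fin n)
    (x : Fin n → X) (y : X) :
    (∏ j, w (x j)) * (∑ j : Fin n, w (x k) / w (x j) + w (x k) / w y)⁻¹ =
    (∏ j ∈ Finset.univ.erase k, w (x j)) *
      (∑ j ∈ Finset.univ.erase k, (w (x j))⁻¹ + ((w (x k))⁻¹ + (w y)⁻¹))⁻¹ := by
  have h0 := (hw_pos (x k)).ne'
  have h1 : ∑ j : Fin n, w (x k) / w (x j) + w (x k) / w y =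
      w (x k) * (∑ j ∈ Finset.univ.erase k, (w (x j))⁻¹ + ((w (x k))⁻¹ + (w y)⁻¹)) := by
    rw [← add_assoc, Finset.sum_erase_add _ _ (Finset.mem_univ k), mul_add, Finset.mul_sum]
    simp only [div_eq_mul_inv]
  rw [h1, ← Finset.prod_erase_mul _ _ (Finset.mem_univ k), mul_inv, mul_assoc,
    mul_inv_cancel_left₀ h0]

theorem aux_alg_swap {X : Type*} (n : ℕ) (w : X → ℝ) (hw_pos : ∀ x, 0 < w x) (k : Fin n)
    (x : Fin n → X) (y : X) :
    (∏ j, w (Function.update x k y j)) *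
      (∑ j : Fin n, w (Function.update x k y k) / w (Function.update x k y j)
        + w (Function.update x k y k) / w (x k))⁻¹ =
    (∏ j, w (x j)) * (∑ j : Fin n, w (x k) / w (x j) + w (x k) / w y)⁻¹ := by
  rw [aux_alg n w hw_pos, aux_alg n w hw_pos]
  have h : ∀ j ∈ Finset.univ.erase k, Function.update x k y j = x j := fun j hj =>
    Function.update_of_ne (Finset.ne_of_mem_erase hj) _ _
  rw [Finset.prod_congr rfl (fun j hj => by rw [h j hj]),
    Finset.sum_congr rfl (fun j hj => by rw [h j hj]), Function.update_self,
    add_comm (w y)⁻¹]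

/-- **Detailed balance for the inverse fitness selection kernel.**
`μ` is an exchangeable probability measure on `X^(n+1)`, `μn` its marginal on the first
`n` coordinates, `κ` the conditional distribution of the `(n+1)`-st coordinate given the
first `n`, `w` a bounded continuous strictly positive fitness function, `Pn` the measure
with density `∏ⱼ w(xⱼ)` (normalized) w.r.t. `μn`, and `P̃` the inverse-fitness selection
kernel.  Then for all Borel `A, B ⊆ X^n`, `∫_B P̃(x,A) Pn(dx) = ∫_A P̃(x,B) Pn(dx)`. -/
theorem stmt_1
    {X : Type*} [MeasurableSpace X] [TopologicalSpace X] [PolishSpace X] [BorelSpace X]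
    (n : ℕ) (hn : 1 ≤ n)
    (μ : Measure (Fin (n + 1) → X)) [IsProbabilityMeasure μ]
    (hexch : ∀ σ : Equiv.Perm (Fin (n + 1)), Measure.map (fun x => x ∘ σ) μ = μ)
    (μn : Measure (Fin n → X))
    (hμn : μn = Measure.map (fun (x : Fin (n + 1) → X) (i : Fin n) => x i.castSucc) μ)
    (κ : Kernel (Fin n → X) X) [IsMarkovKernel κ]
    (hκ : ∀ (A : Set (Fin n → X)) (B : Set X), MeasurableSet A → MeasurableSet B →
      μ {x | (fun i : Fin n => x i.castSucc) ∈ A ∧ x (Fin.last n) ∈ B} = ∫⁻ y in A, κ y B ∂μn)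
    (w : X → ℝ) (hw_pos : ∀ x, 0 < w x) (hw_cont : Continuous w)
    (hw_bdd : ∃ M : ℝ, ∀ x, w x ≤ M)
    (Zn : ℝ) (hZn : Zn = ∫ x, ∏ j : Fin n, w (x j) ∂μn)
    (Pn : Measure (Fin n → X)) [IsProbabilityMeasure Pn]
    (hPn : ∀ A : Set (Fin n → X), MeasurableSet A →
      (Pn A).toReal = Zn⁻¹ * ∫ x in A, ∏ j : Fin n, w (x j) ∂μn)
    (c : (Fin n → X) → ℝ)
    (hc : ∀ x, c x = ∫ y, (∑ j : Fin n, w y / w (x j) + 1)⁻¹ ∂(κ x))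
    (Pk : Fin n → (Fin n → X) → Set (Fin n → X) → ℝ)
    (hPk : ∀ k x A, Pk k x A =
      ∫ y in {y : X | Function.update x k y ∈ A},
        (∑ j : Fin n, w (x k) / w (x j) + w (x k) / w y)⁻¹ ∂(κ x))
    (P : (Fin n → X) → Set (Fin n → X) → ℝ)
    (hP : ∀ x A, P x A = (∑ k : Fin n, Pk k x A) + c x * Set.indicator A (fun _ => (1 : ℝ)) x) :
    ∀ A B : Set (Fin n → X), MeasurableSet A → MeasurableSet B →
      ∫ x in B, P x A ∂Pn = ∫ x in A, P x B ∂Pn := by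
  intro A B hA hB
  obtain ⟨M, hM⟩ := hw_bdd
  have hw : Measurable w := hw_cont.measurable
  have : IsProbabilityMeasure μn := by
    rw [hμn]; exact Measure.isProbabilityMeasure_map
      (Measurable.aemeasurable (measurable_pi_iff.2 fun i => measurable_pi_apply _))
  have hprod0 : ∀ x : Fin n → X, 0 ≤ ∏ j, w (x j) := fun x =>
    Finset.prod_nonneg fun j _ => (hw_pos _).le
  have hZ0 : 0 ≤ Zn⁻¹ := by
    rw [hZn]; exact inv_nonneg.2 (integral_nonneg hprod0)
  have hprodm : Measurable fun x : Fin n → X => ∏ j, w (x j) := by fun_prop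
  have hprodi : Integrable (fun x : Fin n → X => ∏ j, w (x j)) μn := by
    refine Integrable.of_bound hprodm.aestronglyMeasurable (∏ j : Fin n, M) (.of_forall fun x => ?_)
    rw [Real.norm_of_nonneg (hprod0 x)]
    exact Finset.prod_le_prod (fun j _ => (hw_pos _).le) (fun j _ => hM _)
  set d : (Fin n → X) → ℝ := fun x => Zn⁻¹ * ∏ j, w (x j) with hd
  have hd0 : ∀ x, 0 ≤ d x := fun x => mul_nonneg hZ0 (hprod0 x)
  have hdm : Measurable d := by fun_prop
  have hPn' : Pn = μn.withDensity (fun x => ENNReal.ofReal (d x)) := by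
    refine Measure.ext fun S hS => ?_
    rw [withDensity_apply _ hS, ← ofReal_integral_eq_lintegral_ofReal
      (hprodi.const_mul _).integrableOn (.of_forall hd0), integral_const_mul, ← hPn S hS,
      ENNReal.ofReal_toReal (measure_ne_top _ _)]
  -- integrands
  set f : Fin n → (Fin n → X) × X → ℝ := fun k z =>
    (∑ j : Fin n, w (z.1 k) / w (z.1 j) + w (z.1 k) / w z.2)⁻¹ with hf
  have hfm : ∀ k, Measurable (f k) := fun k => by fun_prop
  have hf1 : ∀ k z, ‖f k z‖ ≤ 1 := by
    intro k z
    have h1 : 1 ≤ ∑ j : Fin n, w (z.1 k) / w (z.1 j) := by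
      rw [← div_self (hw_pos (z.1 k)).ne']
      exact Finset.single_le_sum (f := fun j => w (z.1 k) / w (z.1 j))
        (fun j _ => (div_pos (hw_pos _) (hw_pos _)).le) (Finset.mem_univ k)
    have h2 := div_pos (hw_pos (z.1 k)) (hw_pos z.2)
    rw [hf, norm_inv, Real.norm_of_nonneg (by linarith)]
    exact inv_le_one_of_one_le₀ (by linarith)
  set T : Fin n → (Fin n → X) × X → (Fin n → X) × X := fun k z =>
    (Function.update z.1 k z.2, z.1 k) with hT
  have hTp : ∀ k, MeasurePreserving (T k) (μn ⊗ₘ κ) (μn ⊗ₘ κ) := fun k =>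
    aux_marg n μ hexch μn κ hκ k
  have hup : ∀ (k : Fin n) (S : Set (Fin n → X)), MeasurableSet S →
      MeasurableSet {z : (Fin n → X) × X | Function.update z.1 k z.2 ∈ S} := fun k S hS =>
    (measurable_fst.comp (hTp k).measurable) hS
  have hPkF : ∀ k x S, MeasurableSet S → Pk k x S =
      ∫ y, {z : (Fin n → X) × X | Function.update z.1 k z.2 ∈ S}.indicator (f k) (x, y) ∂(κ x) := by
    intro k x S hS
    have hm : MeasurableSet {y : X | Function.update x k y ∈ S} :=
      measurable_prodMk_left (x := x) (hup k S hS)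
    rw [hPk, ← integral_indicator hm]
    rfl
  have hFi : ∀ k S, MeasurableSet S → Integrable
      ({z : (Fin n → X) × X | Function.update z.1 k z.2 ∈ S}.indicator (f k)) (Pn ⊗ₘ κ) := by
    intro k S hS
    exact (Integrable.of_bound (hfm k).aestronglyMeasurable 1
      (.of_forall (hf1 k))).indicator (hup k S hS)
  have hPki : ∀ k S, MeasurableSet S → Integrable (fun x => Pk k x S) Pn := by
    intro k S hS
    simp only [fun x => hPkF k x S hS]
    exact aux_int (hFi k S hS)
  have hci : Integrable c Pn := by
    have : Integrable (fun z : (Fin n → X) × X =>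
        (∑ j : Fin n, w z.2 / w (z.1 j) + 1)⁻¹) (Pn ⊗ₘ κ) := by
      refine Integrable.of_bound (Measurable.aestronglyMeasurable (by fun_prop)) 1
        (.of_forall fun z => ?_)
      have h1 : 0 ≤ ∑ j : Fin n, w z.2 / w (z.1 j) :=
        Finset.sum_nonneg fun j _ => (div_pos (hw_pos _) (hw_pos _)).le
      rw [norm_inv, Real.norm_of_nonneg (by linarith)]
      exact inv_le_one_of_one_le₀ (by linarith)
    have h2 := aux_int this
    simpa only [← hc] using h2
  have hcS : ∀ S, (fun x => c x * Set.indicator S (fun _ => (1 : ℝ)) x) = S.indicator c := by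
    intro S; funext x; by_cases h : x ∈ S <;> simp [h]
  have hsplit : ∀ S R, MeasurableSet S → MeasurableSet R → ∫ x in R, P x S ∂Pn =
      ∑ k, ∫ x in R, Pk k x S ∂Pn + ∫ x in R ∩ S, c x ∂Pn := by
    intro S R hS hR
    simp only [hP]
    rw [integral_add (integrable_finsetSum _ fun k _ => (hPki k S hS).integrableOn)
      (by rw [hcS]; exact (hci.indicator hS).integrableOn),
      integral_finsetSum _ (fun k _ => (hPki k S hS).integrableOn), hcS, setIntegral_indicator hS]
  have hmain : ∀ k S R, MeasurableSet S → MeasurableSet R → ∫ x in R, Pk k x S ∂Pn =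
      ∫ z, {z : (Fin n → X) × X | z.1 ∈ R ∧ Function.update z.1 k z.2 ∈ S}.indicator
        (fun z => d z.1 * f k z) z ∂(μn ⊗ₘ κ) := by
    intro k S R hS hR
    have hFm : Measurable
        ({z : (Fin n → X) × X | Function.update z.1 k z.2 ∈ S}.indicator (f k)) :=
      (hfm k).indicator (hup k S hS)
    have hi : Integrable ({z : (Fin n → X) × X | z.1 ∈ R ∧
        Function.update z.1 k z.2 ∈ S}.indicator (fun z => d z.1 * f k z)) (μn ⊗ₘ κ) := by
      refine Integrable.indicator ?_ ((measurable_fst hR).inter (hup k S hS))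
      refine Integrable.of_bound
        ((hdm.comp measurable_fst).mul (hfm k)).aestronglyMeasurable (Zn⁻¹ * ∏ j : Fin n, M)
        (.of_forall fun z => ?_)
      rw [norm_mul, Real.norm_of_nonneg (hd0 _)]
      refine (mul_le_of_le_one_right (hd0 _) (hf1 k z)).trans ?_
      exact mul_le_mul_of_nonneg_left
        (Finset.prod_le_prod (fun j _ => (hw_pos _).le) (fun j _ => hM _)) hZ0
    rw [Measure.integral_compProd hi, ← integral_indicator hR, hPn',
      integral_withDensity_eq_integral_toReal_smul (by fun_prop)
        (.of_forall fun _ => ENNReal.ofReal_lt_top)]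
    refine integral_congr_ae (.of_forall fun x => ?_)
    simp only [ENNReal.toReal_ofReal (hd0 x), smul_eq_mul]
    by_cases hx : x ∈ R
    · rw [Set.indicator_of_mem hx, hPkF k x S hS, ← integral_const_mul]
      refine integral_congr_ae (.of_forall fun y => ?_)
      by_cases hy : Function.update x k y ∈ S <;> simp [Set.indicator, hx, hy]
    · simp [Set.indicator, hx]
  rw [hsplit A B hA hB, hsplit B A hB hA, Set.inter_comm B A]
  congr 1
  refine Finset.sum_congr rfl fun k _ => ?_
  rw [hmain k A B hA hB, hmain k B A hB hA]
  have hGm : Measurable ({z : (Fin n → X) × X | z.1 ∈ B ∧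
      Function.update z.1 k z.2 ∈ A}.indicator (fun z => d z.1 * f k z)) :=
    ((hdm.comp measurable_fst).mul (hfm k)).indicator ((measurable_fst hB).inter (hup k A hA))
  conv_lhs => rw [← (hTp k).map_eq]
  rw [integral_map (hTp k).measurable.aemeasurable hGm.aestronglyMeasurable]
  refine integral_congr_ae (.of_forall fun z => ?_)
  have hdf : d (T k z).1 * f k (T k z) = d z.1 * f k z := by
    simp only [hd, hf, hT, mul_assoc]
    rw [aux_alg_swap n w hw_pos k z.1 z.2]
  have hiff : ((T k z).1 ∈ B ∧ Function.update (T k z).1 k (T k z).2 ∈ A) ↔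
      (z.1 ∈ A ∧ Function.update z.1 k z.2 ∈ B) := by
    simp [hT, and_comm]
  simp only [Set.indicator, Set.mem_ofPred_eq, hdf]
  by_cases h : z.1 ∈ A ∧ Function.update z.1 k z.2 ∈ B
  · rw [if_pos h, if_pos (hiff.2 h)]
  · rw [if_neg h, if_neg (fun h' => h (hiff.1 h'))]
end

section
/- Suppose π̄_n converges weakly to π̄ on 𝒫(X); suppose that for each q ∈ 𝒫(X) and n ∈ ℕ, r_{q,n} and r_q are Borel probability measures on X such that q ↦ r_{q,n}(A) is Borel measurable for every Borel A ⊆ X, sup_{q ∈ 𝒫(X)} |r_{q,n}(A) − r_q(A)| → 0 as n → ∞ for every Borel A ⊆ X, and q ↦ r_q is continuous for the weak topology. Then for every m ≥ 1 the probability measures μ_n^{(m)} on X^m defined by μ_n^{(m)}(A) := ∫_{𝒫(X)} r_{q,n}^{⊗m}(A) π̄_n(dq) converge weakly to the measure μ^{(m)}(A) := ∫_{𝒫(X)} r_q^{⊗m}(A) π̄(dq); in particular the finite-dimensional distributions of the triangular array converge to those of the infinitely exchangeable process with prior π̄ and directing measures r_q. -/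
open MeasureTheory Filter Topology ProbabilityTheory

/-- Telescoping bound for products of numbers in `[0, 1]`. -/
lemma aux_abs_prod_sub_prod {ι : Type*} (s : Finset ι) (a b : ι → ℝ)
    (ha0 : ∀ i, 0 ≤ a i) (ha1 : ∀ i, a i ≤ 1) (hb0 : ∀ i, 0 ≤ b i) (hb1 : ∀ i, b i ≤ 1) :
    |∏ i ∈ s, a i - ∏ i ∈ s, b i| ≤ ∑ i ∈ s, |a i - b i| := by
  classical
  induction s using Finset.induction_on with
  | empty => simp
  | insert j s hj ih =>
    rw [Finset.prod_insert hj, Finset.prod_insert hj, Finset.sum_insert hj]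
    have h1 : a j * ∏ i ∈ s, a i - b j * ∏ i ∈ s, b i
        = (a j - b j) * ∏ i ∈ s, a i + b j * (∏ i ∈ s, a i - ∏ i ∈ s, b i) := by ring
    have hA0 : 0 ≤ ∏ i ∈ s, a i := Finset.prod_nonneg fun i _ => ha0 i
    have hA1 : ∏ i ∈ s, a i ≤ 1 := Finset.prod_le_one (fun i _ => ha0 i) fun i _ => ha1 i
    rw [h1]
    refine (abs_add_le _ _).trans (add_le_add ?_ ?_)
    · rw [abs_mul, abs_of_nonneg hA0]
      exact mul_le_of_le_one_right (abs_nonneg _) hA1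
    · rw [abs_mul, abs_of_nonneg (hb0 j)]
      exact (mul_le_of_le_one_left (abs_nonneg _) (hb1 j)).trans ih

/-- The frontier of a box is contained in the union of the cylinders over the frontiers. -/
lemma aux_frontier_pi_subset {ι : Type*} [Finite ι] {X : Type*} [TopologicalSpace X]
    (s : ι → Set X) :
    frontier (Set.univ.pi s) ⊆ ⋃ i, (fun x : ι → X => x i) ⁻¹' frontier (s i) := by
  intro x hx
  rw [frontier, closure_pi_set, interior_pi_set Set.finite_univ] at hx
  obtain ⟨h1, h2⟩ := hx
  simp only [Set.mem_pi, Set.mem_univ, true_implies, not_forall] at h1 h2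
  obtain ⟨i, hi⟩ := h2
  exact Set.mem_iUnion.2 ⟨i, h1 i, hi⟩

/-- A mixture over a weakly continuous kernel depends continuously on the mixing measure. -/
lemma aux_mixture_tendsto {Q Y : Type*} [MeasurableSpace Q] [TopologicalSpace Q] [BorelSpace Q]
    [MeasurableSpace Y] [TopologicalSpace Y] [OpensMeasurableSpace Y]
    (p : ℕ → ProbabilityMeasure Q) (p0 : ProbabilityMeasure Q) (hp : Tendsto p atTop (𝓝 p0))
    (k : Q → ProbabilityMeasure Y) (hk : Continuous k)
    (hkm : Measurable fun q => (k q : Measure Y))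
    (ν : ℕ → ProbabilityMeasure Y) (hν : ∀ n, (ν n : Measure Y)
      = (p n : Measure Q).bind fun q => (k q : Measure Y))
    (ν0 : ProbabilityMeasure Y) (hν0 : (ν0 : Measure Y)
      = (p0 : Measure Q).bind fun q => (k q : Measure Y)) :
    Tendsto ν atTop (𝓝 ν0) := by
  rw [ProbabilityMeasure.tendsto_iff_forall_lintegral_tendsto] at hp ⊢
  intro f
  have hfm : Measurable fun y => (f y : ENNReal) :=
    (f.continuous.measurable).coe_nnreal_ennreal
  let F : Q → NNReal := fun q => (k q).toFiniteMeasure.testAgainstNN f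
  have hFc : Continuous F := (ProbabilityMeasure.continuous_testAgainstNN_eval f).comp hk
  have hFb : ∀ q, F q ≤ nndist f 0 := by
    intro q
    have := (k q).toFiniteMeasure.testAgainstNN_lipschitz_estimate f 0
    simpa [F] using this
  let Fb : BoundedContinuousFunction Q NNReal :=
    BoundedContinuousFunction.mkOfBound ⟨F, hFc⟩ (nndist f 0) (by
      intro x y
      rw [NNReal.dist_eq, abs_le]
      have h1 : (F x : ℝ) ≤ nndist f 0 := by exact_mod_cast hFb x
      have h2 : (F y : ℝ) ≤ nndist f 0 := by exact_mod_cast hFb y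
      have h3 : (0 : ℝ) ≤ F x := (F x).2
      have h4 : (0 : ℝ) ≤ F y := (F y).2
      simp only [ContinuousMap.coe_mk]
      constructor <;> linarith)
  have key : ∀ q, ∫⁻ y, (f y : ENNReal) ∂(k q : Measure Y) = (Fb q : ENNReal) := by
    intro q
    exact (FiniteMeasure.testAgainstNN_coe_eq (μ := (k q).toFiniteMeasure) (f := f)).symm
  have e0 : ∫⁻ y, (f y : ENNReal) ∂(ν0 : Measure Y) = ∫⁻ q, (Fb q : ENNReal) ∂(p0 : Measure Q) := by
    rw [hν0, Measure.lintegral_bind hkm.aemeasurable hfm.aemeasurable]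
    simp_rw [key]
  have en : ∀ n, ∫⁻ y, (f y : ENNReal) ∂(ν n : Measure Y)
      = ∫⁻ q, (Fb q : ENNReal) ∂(p n : Measure Q) := by
    intro n
    rw [hν n, Measure.lintegral_bind hkm.aemeasurable hfm.aemeasurable]
    simp_rw [key]
  simp_rw [e0, en]
  exact hp Fb

/-- Uniformly close integrands have close integrals (no measurability needed). -/
lemma aux_lintegral_close {Q : Type*} [MeasurableSpace Q] (p : Measure Q) [IsProbabilityMeasure p]
    (f g : Q → ENNReal) (hf : ∀ q, f q ≠ ⊤) (hg : ∀ q, g q ≠ ⊤)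
    (hfi : ∫⁻ q, f q ∂p ≠ ⊤) (hgi : ∫⁻ q, g q ∂p ≠ ⊤) (ε : ℝ) (hε : 0 ≤ ε)
    (h : ∀ q, |(f q).toReal - (g q).toReal| ≤ ε) :
    |(∫⁻ q, f q ∂p).toReal - (∫⁻ q, g q ∂p).toReal| ≤ ε := by
  have main : ∀ f g : Q → ENNReal, (∀ q, f q ≠ ⊤) → (∀ q, g q ≠ ⊤) →
      ∫⁻ q, g q ∂p ≠ ⊤ → (∀ q, |(f q).toReal - (g q).toReal| ≤ ε) →
      (∫⁻ q, f q ∂p).toReal ≤ (∫⁻ q, g q ∂p).toReal + ε := by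
    intro f g hf hg hgi h
    have h1 : ∀ q, f q ≤ g q + ENNReal.ofReal ε := by
      intro q
      rw [← ENNReal.ofReal_toReal (hf q), ← ENNReal.ofReal_toReal (hg q),
        ← ENNReal.ofReal_add ENNReal.toReal_nonneg hε]
      apply ENNReal.ofReal_le_ofReal
      have := (abs_le.1 (h q)).2
      linarith
    have h2 : ∫⁻ q, f q ∂p ≤ ∫⁻ q, g q ∂p + ENNReal.ofReal ε := by
      refine (lintegral_mono h1).trans ?_
      rw [lintegral_add_right _ measurable_const]
      simp
    have h3 := ENNReal.toReal_mono (by finiteness) h2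
    rwa [ENNReal.toReal_add hgi (by finiteness), ENNReal.toReal_ofReal hε] at h3
  have a := main f g hf hg hgi h
  have b := main g f hg hf hfi (fun q => by rw [abs_sub_comm]; exact h q)
  rw [abs_le]
  constructor <;> linarith

/-- **Existence of the limit process (Theorem `thmP`).**
If the priors `π̄ₙ` converge weakly to `π̄` on `𝒫(X)`, the directing measures `r_{q,n}`
converge to `r_q` uniformly in `q` on every Borel set, and `q ↦ r_q` is continuous, then
for every `m ≥ 1` the `m`-dimensional marginals `μₙ^{(m)}(A) = ∫ r_{q,n}^{⊗m}(A) π̄ₙ(dq)`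
converge weakly to `μ^{(m)}(A) = ∫ r_q^{⊗m}(A) π̄(dq)`. -/
theorem stmt_2
    {X : Type*} [MeasurableSpace X] [TopologicalSpace X] [PolishSpace X] [BorelSpace X]
    [MeasurableSpace (ProbabilityMeasure X)] [BorelSpace (ProbabilityMeasure X)]
    (πbarseq : ℕ → ProbabilityMeasure (ProbabilityMeasure X))
    (πbar : ProbabilityMeasure (ProbabilityMeasure X))
    (hπconv : Tendsto πbarseq atTop (𝓝 πbar))
    (r : ℕ → ProbabilityMeasure X → ProbabilityMeasure X)
    (rlim : ProbabilityMeasure X → ProbabilityMeasure X)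
    (hrmeas : ∀ (n : ℕ) (A : Set X), MeasurableSet A →
      Measurable fun q : ProbabilityMeasure X => (r n q : Measure X) A)
    (hrunif : ∀ A : Set X, MeasurableSet A →
      TendstoUniformly (fun (n : ℕ) (q : ProbabilityMeasure X) => ((r n q : Measure X) A).toReal)
        (fun q : ProbabilityMeasure X => ((rlim q : Measure X) A).toReal) atTop)
    (hrcont : Continuous rlim)
    (μseq : (m : ℕ) → ℕ → ProbabilityMeasure (Fin m → X))
    (hμseq : ∀ (m n : ℕ) (A : Set (Fin m → X)), MeasurableSet A →
      (μseq m n : Measure (Fin m → X)) A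
        = ∫⁻ q, Measure.pi (fun _ : Fin m => (r n q : Measure X)) A
            ∂(πbarseq n : Measure (ProbabilityMeasure X)))
    (μlim : (m : ℕ) → ProbabilityMeasure (Fin m → X))
    (hμlim : ∀ (m : ℕ) (A : Set (Fin m → X)), MeasurableSet A →
      (μlim m : Measure (Fin m → X)) A
        = ∫⁻ q, Measure.pi (fun _ : Fin m => (rlim q : Measure X)) A
            ∂(πbar : Measure (ProbabilityMeasure X))) :
    ∀ m : ℕ, 1 ≤ m → Tendsto (fun n => μseq m n) atTop (𝓝 (μlim m)) := by
  intro m _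
  -- the limiting directing measures are measurable in `q`
  have hlimmeas : ∀ A : Set X, MeasurableSet A →
      Measurable fun q : ProbabilityMeasure X => (rlim q : Measure X) A := by
    intro A hA
    have h1 : Measurable fun q : ProbabilityMeasure X => ((rlim q : Measure X) A).toReal := by
      refine measurable_of_tendsto_metrizable
        (f := fun n q => ((r n q : Measure X) A).toReal)
        (fun n => (hrmeas n A hA).ennreal_toReal) ?_
      rw [tendsto_pi_nhds]
      exact fun q => (hrunif A hA).tendsto_at q
    have h2 := h1.ennreal_ofReal
    convert h2 using 2 with q
    exact (ENNReal.ofReal_toReal (measure_ne_top _ _)).symm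
  let k : ProbabilityMeasure X → ProbabilityMeasure (Fin m → X) :=
    fun q => ProbabilityMeasure.pi fun _ : Fin m => rlim q
  have hkc : Continuous k :=
    ProbabilityMeasure.continuous_pi.comp (continuous_pi fun _ => hrcont)
  have hkm : Measurable fun q => (k q : Measure (Fin m → X)) := by
    refine Measurable.measure_of_isPiSystem_of_isProbabilityMeasure
      generateFrom_pi.symm isPiSystem_pi ?_
    rintro _ ⟨s, hs, rfl⟩
    simp only [k, ProbabilityMeasure.toMeasure_pi, Measure.pi_pi]
    exact Finset.measurable_prod _ fun i _ => hlimmeas (s i) (hs i (Set.mem_univ i))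
  let ν : ℕ → ProbabilityMeasure (Fin m → X) := fun n =>
    ⟨(πbarseq n : Measure (ProbabilityMeasure X)).bind fun q => (k q : Measure (Fin m → X)),
      isProbabilityMeasure_bind hkm.aemeasurable (Eventually.of_forall fun q => inferInstance)⟩
  have hν0 : (μlim m : Measure (Fin m → X))
      = (πbar : Measure (ProbabilityMeasure X)).bind fun q => (k q : Measure (Fin m → X)) := by
    ext A hA
    rw [hμlim m A hA, Measure.bind_apply hA hkm.aemeasurable]
    rfl
  have hνconv : Tendsto ν atTop (𝓝 (μlim m)) :=
    aux_mixture_tendsto πbarseq πbar hπconv k hkc hkm ν (fun n => rfl) (μlim m) hν0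
  let S : Set (Set (Fin m → X)) := {t | ∃ s : Fin m → Set X, t = Set.univ.pi s ∧
    (∀ i, MeasurableSet (s i)) ∧
    ∀ i, ((μlim m : Measure (Fin m → X)).map fun x => x i) (frontier (s i)) = 0}
  have hS : IsPiSystem S := by
    rintro - ⟨s, rfl, smeas, hs⟩ - ⟨s', rfl, s'meas, hs'⟩ -
    exact ⟨fun i => s i ∩ s' i, Set.pi_inter_distrib.symm,
      fun i => (smeas i).inter (s'meas i), fun i => null_frontier_inter (hs i) (hs' i)⟩
  apply hS.tendsto_probabilityMeasure_of_tendsto_of_mem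
  · rintro - ⟨s, rfl, smeas, hs⟩
    exact MeasurableSet.univ_pi smeas
  · let : PseudoMetricSpace X := TopologicalSpace.pseudoMetrizableSpacePseudoMetric X
    intro u u_open x xu
    obtain ⟨ε, εpos, hε⟩ : ∃ ε > 0, Metric.ball x ε ⊆ u := Metric.isOpen_iff.1 u_open x xu
    have A (i : Fin m) : ∃ ρ ∈ Set.Ioo 0 ε, ((μlim m : Measure (Fin m → X)).map fun x => x i)
        (frontier (Metric.thickening ρ {x i})) = 0 :=
      exists_null_frontier_thickening _ _ εpos
    choose ρ ρpos hρ using A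
    refine ⟨Set.univ.pi (fun i => Metric.ball (x i) (ρ i)), ⟨fun i => Metric.ball (x i) (ρ i), rfl,
      fun i => measurableSet_ball, fun i => by simpa using hρ i⟩, ?_, ?_⟩
    · apply IsOpen.mem_nhds
      · exact isOpen_set_pi Set.finite_univ (by simp)
      · simpa using fun i => (ρpos i).1
    · calc Set.univ.pi (fun i => Metric.ball (x i) (ρ i))
        _ ⊆ Set.univ.pi fun i => Metric.ball (x i) ε := by
          gcongr with i hi; exact (ρpos i).2.le
        _ ⊆ u := by rwa [← ball_pi _ εpos]
  · rintro - ⟨s, rfl, smeas, hs⟩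
    have hbox : MeasurableSet (Set.univ.pi s) := MeasurableSet.univ_pi smeas
    have hfr : (μlim m : Measure (Fin m → X)) (frontier (Set.univ.pi s)) = 0 := by
      refine measure_mono_null (aux_frontier_pi_subset s) (measure_iUnion_null fun i => ?_)
      rw [← Measure.map_apply (measurable_pi_apply i) isClosed_frontier.measurableSet]
      exact hs i
    have hνbox := ProbabilityMeasure.tendsto_measure_of_null_frontier_of_tendsto' hνconv hfr
    have hνbox' : Tendsto (fun n => ((ν n : Measure (Fin m → X)) (Set.univ.pi s)).toReal) atTop
        (𝓝 ((μlim m : Measure (Fin m → X)) (Set.univ.pi s)).toReal) :=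
      (ENNReal.tendsto_toReal (measure_ne_top _ _)).comp hνbox
    -- the two mixtures are asymptotically equal on the box
    have hdiff : Tendsto (fun n => ((μseq m n : Measure (Fin m → X)) (Set.univ.pi s)).toReal
        - ((ν n : Measure (Fin m → X)) (Set.univ.pi s)).toReal) atTop (𝓝 0) := by
      rw [Metric.tendsto_nhds]
      intro ε hε
      have hδ : 0 < ε / (m + 1) := by positivity
      have hall : ∀ᶠ n in atTop, ∀ i : Fin m, ∀ q,
          dist ((rlim q : Measure X) (s i)).toReal ((r n q : Measure X) (s i)).toReal
            < ε / (m + 1) :=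
        eventually_all.2 fun i => Metric.tendstoUniformly_iff.1 (hrunif (s i) (smeas i)) _ hδ
      filter_upwards [hall] with n hn
      have e1 := hμseq m n _ hbox
      have e2 : (ν n : Measure (Fin m → X)) (Set.univ.pi s)
          = ∫⁻ q, Measure.pi (fun _ : Fin m => (rlim q : Measure X)) (Set.univ.pi s)
            ∂(πbarseq n : Measure (ProbabilityMeasure X)) := by
        change ((πbarseq n : Measure (ProbabilityMeasure X)).bind
          fun q => (k q : Measure (Fin m → X))) _ = _
        rw [Measure.bind_apply hbox hkm.aemeasurable]
        rfl
      have hle : ∀ (p : ProbabilityMeasure X) (A : Set X), ((p : Measure X) A).toReal ≤ 1 :=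
        fun p A => by
          have := ENNReal.toReal_mono ENNReal.one_ne_top (prob_le_one (μ := (p : Measure X)) (s := A))
          simpa using this
      have hb : |((μseq m n : Measure (Fin m → X)) (Set.univ.pi s)).toReal
          - ((ν n : Measure (Fin m → X)) (Set.univ.pi s)).toReal| ≤ m * (ε / (m + 1)) := by
        have f1 : (μseq m n : Measure (Fin m → X)) (Set.univ.pi s) ≠ ⊤ := measure_ne_top _ _
        have f2 : (ν n : Measure (Fin m → X)) (Set.univ.pi s) ≠ ⊤ := measure_ne_top _ _
        rw [e1] at f1 ⊢
        rw [e2] at f2 ⊢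
        refine aux_lintegral_close _ _ _ (fun q => measure_ne_top _ _) (fun q => measure_ne_top _ _)
          f1 f2 _ (by positivity) fun q => ?_
        simp only [Measure.pi_pi, ENNReal.toReal_prod]
        refine (aux_abs_prod_sub_prod _ _ _ (fun i => ENNReal.toReal_nonneg) (fun i => hle _ _)
          (fun i => ENNReal.toReal_nonneg) (fun i => hle _ _)).trans ?_
        refine (Finset.sum_le_card_nsmul _ _ (ε / (m + 1)) fun i _ => ?_).trans (by simp)
        have := (hn i q).le
        rwa [dist_comm, Real.dist_eq] at this
      rw [Real.dist_eq, sub_zero]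
      refine hb.trans_lt ?_
      rw [← mul_div_assoc, div_lt_iff₀ (by positivity)]
      nlinarith
    have hsum := hdiff.add hνbox'
    simp only [sub_add_cancel, zero_add] at hsum
    rw [← NNReal.tendsto_coe]
    exact hsum
end

section
/- Let w_n(x) := exp(−φ(x)/n^λ) and, for q ∈ 𝒫(X), let r_{q,n}(A) := (∫_A w_n dq)/(∫_X w_n dq) for Borel A ⊆ X. If λ > 0 set r_q := q; if λ = 0 set r_q(A) := (∫_A e^{−φ} dq)/(∫_X e^{−φ} dq). Then: (1) for every Borel A ⊆ X, sup_{q ∈ 𝒫(X)} |r_{q,n}(A) − r_q(A)| → 0 as n → ∞; (2) the map q ↦ r_q from 𝒫(X) to 𝒫(X) is continuous for the weak topology. -/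
open MeasureTheory Filter Topology ProbabilityTheory

/-- **Corollary `cor1` (1) and (2).**
With the fitness functions `wₙ(x) = exp(−φ(x)/n^λ)` and the re-weighted measures
`r_{q,n}(A) = (∫_A wₙ dq)/(∫ wₙ dq)`, setting `r_q = q` when `λ > 0` and
`r_q ∝ e^{−φ} dq` when `λ = 0` (encoded by the weight `wl`), we have:
(1) `sup_q |r_{q,n}(A) − r_q(A)| → 0` for every Borel `A`, and
(2) `q ↦ r_q` is continuous on `𝒫(X)` for the weak topology. -/
theorem stmt_3
    {X : Type*} [MeasurableSpace X] [TopologicalSpace X] [PolishSpace X] [BorelSpace X]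
    (φ : X → ℝ) (hφ0 : ∀ x, 0 ≤ φ x) (hφcont : Continuous φ) (hφbdd : ∃ M : ℝ, ∀ x, φ x ≤ M)
    (lam : ℝ) (hlam : 0 ≤ lam)
    (wn : ℕ → X → ℝ) (hwn : ∀ (n : ℕ) (x : X), wn n x = Real.exp (-(φ x) / (n : ℝ) ^ lam))
    (wl : X → ℝ)
    (hwl : wl = if lam = 0 then fun x => Real.exp (-(φ x)) else fun _ => (1 : ℝ))
    (rmap : ProbabilityMeasure X → ProbabilityMeasure X)
    (hrmap : ∀ (q : ProbabilityMeasure X) (A : Set X), MeasurableSet A →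
      ((rmap q : Measure X) A).toReal
        = (∫ x in A, wl x ∂(q : Measure X)) / ∫ x, wl x ∂(q : Measure X)) :
    (∀ A : Set X, MeasurableSet A →
      Tendsto (fun n : ℕ => ⨆ q : ProbabilityMeasure X,
          |(∫ x in A, wn n x ∂(q : Measure X)) / (∫ x, wn n x ∂(q : Measure X))
            - (∫ x in A, wl x ∂(q : Measure X)) / (∫ x, wl x ∂(q : Measure X))|)
        atTop (𝓝 0))
    ∧ Continuous rmap := by
  obtain ⟨M, hM⟩ := hφbdd
  have hwlc : Continuous wl := by
    rw [hwl]; split_ifs <;> fun_prop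
  have hwlpos : ∀ x, 0 < wl x := by
    intro x; rw [hwl]; split_ifs
    · exact Real.exp_pos _
    · exact one_pos
  have hwlle : ∀ x, wl x ≤ 1 := by
    intro x; rw [hwl]; split_ifs
    · exact Real.exp_le_one_iff.mpr (by linarith [hφ0 x])
    · exact le_rfl
  have hint : ∀ (g : X → ℝ), Continuous g → (∀ x, 0 < g x) → (∀ x, g x ≤ 1) →
      ∀ q : ProbabilityMeasure X, Integrable g (q : Measure X) := by
    intro g hg h0 h1 q
    refine Integrable.of_bound hg.aestronglyMeasurable 1 (ae_of_all _ fun x => ?_)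
    rw [Real.norm_eq_abs, abs_of_pos (h0 x)]; exact h1 x
  refine ⟨?_, ?_⟩
  · intro A hA
    by_cases hl : lam = 0
    · have : ∀ n, wn n = wl := by
        intro n; ext x; rw [hwn, hwl]; simp [hl]
      simp [this]
    · have hlpos : 0 < lam := lt_of_le_of_ne hlam (Ne.symm hl)
      have hwl1 : wl = fun _ => (1 : ℝ) := by rw [hwl, if_neg hl]
      set c : ℕ → ℝ := fun n => max M 0 / (n : ℝ) ^ lam with hc
      have hc0 : ∀ n, 0 ≤ c n := fun n => by simp only [hc]; positivity
      have hct : Tendsto c atTop (𝓝 0) :=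
        ((tendsto_rpow_atTop hlpos).comp tendsto_natCast_atTop_atTop).const_div_atTop _
      have hbt : Tendsto (fun n => Real.exp (c n) - 1) atTop (𝓝 0) := by
        have := (Real.continuous_exp.tendsto 0).comp hct
        simpa using this.sub_const 1
      refine squeeze_zero (fun n => Real.iSup_nonneg fun q => abs_nonneg _) (fun n => ?_) hbt
      have hexp1 : 1 ≤ Real.exp (c n) := Real.one_le_exp (hc0 n)
      refine Real.iSup_le (fun q => ?_) (by linarith)
      have hwc : Continuous (wn n) := by
        have : wn n = fun x => Real.exp (-(φ x) / (n : ℝ) ^ lam) := funext (hwn n)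
        rw [this]; fun_prop
      have hw0 : ∀ x, 0 < wn n x := fun x => by rw [hwn]; exact Real.exp_pos _
      have hnn : 0 ≤ (n : ℝ) ^ lam := by positivity
      have hw1 : ∀ x, wn n x ≤ 1 := fun x => by
        rw [hwn]
        exact Real.exp_le_one_iff.mpr (div_nonpos_of_nonpos_of_nonneg (by linarith [hφ0 x]) hnn)
      have hwlow : ∀ x, Real.exp (-(c n)) ≤ wn n x := fun x => by
        rw [hwn, Real.exp_le_exp, neg_div, neg_le_neg_iff]
        exact div_le_div_of_nonneg_right ((hM x).trans (le_max_left _ _)) hnn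
      have hi := hint _ hwc hw0 hw1 q
      have key : ∀ B : Set X, Real.exp (-(c n)) * (q : Measure X).real B ≤ ∫ x in B, wn n x ∂(q : Measure X)
          ∧ ∫ x in B, wn n x ∂(q : Measure X) ≤ (q : Measure X).real B := by
        intro B
        constructor
        · have := integral_mono (μ := (q : Measure X).restrict B) (integrable_const _)
            hi.integrableOn hwlow
          simpa [mul_comm] using this
        · have := integral_mono (μ := (q : Measure X).restrict B) hi.integrableOn
            (integrable_const _) hw1
          simpa using this
      obtain ⟨a1, a2⟩ := key A
      obtain ⟨b1, b2⟩ := key Set.univ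
      simp only [Measure.restrict_univ, probReal_univ, mul_one] at b1 b2
      have hp0 : 0 ≤ (q : Measure X).real A := measureReal_nonneg
      have hp1 : (q : Measure X).real A ≤ 1 := measureReal_le_one
      simp only [hwl1, integral_const, smul_eq_mul, mul_one, measureReal_restrict_apply_univ,
        probReal_univ, div_one]
      generalize (∫ x in A, wn n x ∂(q : Measure X)) = a at *
      generalize (∫ x, wn n x ∂(q : Measure X)) = b at *
      generalize (q : Measure X).real A = p at *
      have he : 0 < Real.exp (-(c n)) := Real.exp_pos _
      have hee : Real.exp (c n) * Real.exp (-(c n)) = 1 := by rw [← Real.exp_add]; simp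
      generalize Real.exp (-(c n)) = e at *
      generalize Real.exp (c n) = E at *
      have hb : 0 < b := by linarith
      have ha : 0 ≤ a := le_trans (by positivity) a1
      have h1 : a / b ≤ p * E := by
        rw [div_le_iff₀ hb]
        have : p * E * e ≤ p * E * b := by gcongr
        nlinarith
      have h2 : e * p ≤ a / b := by
        rw [le_div_iff₀ hb]
        nlinarith [mul_nonneg he.le hp0]
      have he2 : 1 - e ≤ E - 1 := by nlinarith [sq_nonneg (E - 1)]
      have he1 : e ≤ 1 := by nlinarith
      rw [abs_le]
      constructor <;> nlinarith
  · have hZ : ∀ q : ProbabilityMeasure X, 0 < ∫ x, wl x ∂(q : Measure X) := by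
      intro q
      rw [integral_pos_iff_support_of_nonneg (fun x => (hwlpos x).le) (hint _ hwlc hwlpos hwlle q)]
      have : Function.support wl = Set.univ := by
        ext x; simp [(hwlpos x).ne']
      simp [this]
    have hmeas : ∀ q : ProbabilityMeasure X, (rmap q : Measure X) =
        (q : Measure X).withDensity
          (fun x => ENNReal.ofReal (wl x / ∫ x, wl x ∂(q : Measure X))) := by
      intro q
      ext A hA
      rw [withDensity_apply _ hA, ← ofReal_integral_eq_lintegral_ofReal
        ((hint _ hwlc hwlpos hwlle q).div_const _).integrableOn
        (ae_of_all _ fun x => (div_pos (hwlpos x) (hZ q)).le), integral_div, ← hrmap q A hA,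
        ENNReal.ofReal_toReal (measure_ne_top _ _)]
    have hfint : ∀ (q : ProbabilityMeasure X) (f : X → ℝ), ∫ x, f x ∂(rmap q : Measure X) =
        (∫ x, wl x * f x ∂(q : Measure X)) / ∫ x, wl x ∂(q : Measure X) := by
      intro q f
      rw [hmeas q, integral_withDensity_eq_integral_toReal_smul
        (by have := hwlc.measurable; fun_prop) (ae_of_all _ fun x => ENNReal.ofReal_lt_top),
        ← integral_div]
      congr 1; ext x
      rw [ENNReal.toReal_ofReal (div_pos (hwlpos x) (hZ q)).le, smul_eq_mul]
      ring
    let W : BoundedContinuousFunction X ℝ := BoundedContinuousFunction.ofNormedAddCommGroup wl hwlc 1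
      (fun x => by rw [Real.norm_eq_abs, abs_of_pos (hwlpos x)]; exact hwlle x)
    rw [continuous_iff_continuousAt]
    intro q
    rw [ContinuousAt, ProbabilityMeasure.tendsto_iff_forall_integral_tendsto]
    intro f
    simp only [hfint]
    have hid := ProbabilityMeasure.tendsto_iff_forall_integral_tendsto.mp (tendsto_id (x := 𝓝 q))
    exact (hid (W * f)).div (hid W) (hZ q).ne'
end

section
/- Suppose X is compact, π̄_n converges weakly to π̄ on 𝒫(X), and for each q ∈ 𝒫(X) and n ∈ ℕ the probability measures r_{q,n}, r_q on X satisfy: q ↦ r_{q,n}(A) is Borel measurable for every Borel A, sup_{q ∈ 𝒫(X)} |r_{q,n}(A) − r_q(A)| → 0 for every Borel A ⊆ X, and q ↦ r_q is continuous. Define P_n on X^n by P_n(A) := ∫_{𝒫(X)} r_{q,n}^{⊗n}(A) π̄_n(dq), let g_n: X^n → 𝒫(X) be the empirical-measure map g_n(x_1,…,x_n) := (1/n)(δ_{x_1} + ⋯ + δ_{x_n}), let Q_n := P_n ∘ g_n^{-1} be the pushforward of P_n under g_n, and let Q be the pushforward of π̄ under the map q ↦ r_q. Then Q_n converges weakly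 to Q as Borel probability measures on 𝒫(X). -/
open MeasureTheory Filter Topology ProbabilityTheory
open scoped ENNReal NNReal BoundedContinuousFunction

lemma auxA {X : Type*} [MeasurableSpace X] [MetricSpace X] [CompactSpace X] [BorelSpace X]
    (F : ProbabilityMeasure X →ᵇ ℝ) {ε : ℝ} (hε : 0 < ε) :
    ∃ (s : Finset (X →ᵇ ℝ)) (C : ℝ), 0 ≤ C ∧ ∀ p q : ProbabilityMeasure X,
      |F p - F q| ≤ ε + C * ∑ f ∈ s, (∫ x, f x ∂(p : Measure X) - ∫ x, f x ∂(q : Measure X)) ^ 2 := by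
  let D : (X →ᵇ ℝ) → ProbabilityMeasure X × ProbabilityMeasure X → ℝ := fun f z =>
    ∫ x, f x ∂(z.1 : Measure X) - ∫ x, f x ∂(z.2 : Measure X)
  have hD : ∀ f, Continuous (D f) := fun f =>
    ((ProbabilityMeasure.continuous_integral_boundedContinuousFunction f).comp continuous_fst).sub
      ((ProbabilityMeasure.continuous_integral_boundedContinuousFunction f).comp continuous_snd)
  let K : Set (ProbabilityMeasure X × ProbabilityMeasure X) := {z | ε ≤ |F z.1 - F z.2|}
  have hK : IsCompact K := by
    apply IsClosed.isCompact
    exact isClosed_le continuous_const (by fun_prop)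
  obtain ⟨s, hs⟩ := hK.elim_finite_subcover (fun f => {z | D f z ≠ 0})
    (fun f => isOpen_ne_fun (hD f) continuous_const) (by
      intro z hz
      by_contra hcon
      simp only [Set.mem_iUnion, Set.mem_ofPred_eq, not_exists, not_not] at hcon
      have : z.1 = z.2 := by
        apply Subtype.ext
        change (z.1 : Measure X) = (z.2 : Measure X)
        apply ext_of_forall_integral_eq_of_IsFiniteMeasure
        intro f
        exact sub_eq_zero.1 (hcon f)
      have h2 : ε ≤ |F z.1 - F z.2| := hz
      rw [this] at h2
      simp at h2
      linarith)
  have hScont : Continuous (fun z => ∑ f ∈ s, (D f z) ^ 2) :=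
    continuous_finsetSum _ fun f _ => (hD f).pow 2
  have hpos : ∀ z ∈ K, 0 < ∑ f ∈ s, (D f z) ^ 2 := by
    intro z hz
    have := hs hz
    simp only [Set.mem_iUnion, Set.mem_ofPred_eq] at this
    obtain ⟨f, hf, hne⟩ := this
    exact Finset.sum_pos' (fun _ _ => sq_nonneg _) ⟨f, hf, by positivity⟩
  obtain ⟨δ, hδ, hδK⟩ : ∃ δ > 0, ∀ z ∈ K, δ ≤ ∑ f ∈ s, (D f z) ^ 2 := by
    rcases K.eq_empty_or_nonempty with h | h
    · exact ⟨1, one_pos, by simp [h]⟩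
    · obtain ⟨z, hz, hmin⟩ := hK.exists_isMinOn h hScont.continuousOn
      exact ⟨_, hpos z hz, fun w hw => hmin hw⟩
  refine ⟨s, 2 * ‖F‖ / δ, by positivity, fun p q => ?_⟩
  have hnn : 0 ≤ ∑ f ∈ s, (D f (p, q)) ^ 2 := Finset.sum_nonneg fun _ _ => sq_nonneg _
  change _ ≤ ε + 2 * ‖F‖ / δ * ∑ f ∈ s, (D f (p, q)) ^ 2
  by_cases h : (p, q) ∈ K
  · have h1 : |F p - F q| ≤ 2 * ‖F‖ := by
      have := F.dist_le_two_norm p q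
      rwa [Real.dist_eq] at this
    have h2 : 2 * ‖F‖ ≤ 2 * ‖F‖ / δ * ∑ f ∈ s, (D f (p, q)) ^ 2 := by
      rw [div_mul_eq_mul_div, le_div_iff₀ hδ]
      exact mul_le_mul_of_nonneg_left (hδK _ h) (by positivity)
    linarith
  · have h1 : |F p - F q| < ε := not_le.1 h
    have : 0 ≤ 2 * ‖F‖ / δ * ∑ f ∈ s, (D f (p, q)) ^ 2 := by positivity
    linarith

lemma auxB {X Y : Type*} [MeasurableSpace X] [TopologicalSpace X] [BorelSpace X]
    (r : ℕ → Y → ProbabilityMeasure X)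
    (rlim : Y → ProbabilityMeasure X)
    (hrunif : ∀ A : Set X, MeasurableSet A →
      TendstoUniformly (fun (n : ℕ) q => ((r n q : Measure X) A).toReal)
        (fun q => ((rlim q : Measure X) A).toReal) atTop)
    (f : X →ᵇ ℝ) {ε : ℝ} (hε : 0 < ε) :
    ∀ᶠ n in atTop, ∀ q, |∫ x, f x ∂(r n q : Measure X) - ∫ x, f x ∂(rlim q : Measure X)| ≤ ε := by
  obtain ⟨η, hη, hη3⟩ : ∃ η > 0, 3 * η = ε := ⟨ε / 3, by positivity, by ring⟩
  let A : ℤ → Set X := fun k => {x | ⌊f x / η⌋ = k}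
  have hA : ∀ k, MeasurableSet (A k) := fun k =>
    (Int.measurable_floor.comp (f.continuous.measurable.div_const η)) (measurableSet_singleton k)
  obtain ⟨N, hN⟩ := exists_nat_gt (‖f‖ / η + 1)
  let I : Finset ℤ := Finset.Icc (-N : ℤ) N
  have hmem : ∀ x, ⌊f x / η⌋ ∈ I := by
    intro x
    have h1 := abs_le.1 (f.norm_coe_le_norm x)
    have h2 : f x / η ≤ ‖f‖ / η := by gcongr; exact h1.2
    have h3 : - (‖f‖ / η) ≤ f x / η := by rw [← neg_div]; gcongr; exact h1.1
    rw [Finset.mem_Icc]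
    constructor
    · rw [Int.le_floor]; push_cast; linarith
    · have := Int.floor_le (f x / η)
      have h4 : ((⌊f x / η⌋ : ℤ) : ℝ) ≤ ((N : ℤ) : ℝ) := by push_cast; linarith
      exact_mod_cast h4
  let s : X → ℝ := fun x => ∑ k ∈ I, (A k).indicator (fun _ => (k : ℝ) * η) x
  have hs : ∀ x, s x = ⌊f x / η⌋ * η := by
    intro x
    have := Finset.sum_eq_single_of_mem (f := fun k : ℤ => (A k).indicator (fun _ => (k : ℝ) * η) x)
      _ (hmem x) (by
        intro b _ hb
        apply Set.indicator_of_notMem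
        exact fun h => hb h.symm)
    refine this.trans ?_
    exact Set.indicator_of_mem (by rfl) _
  have hsf : ∀ x, ‖f x - s x‖ ≤ η := by
    intro x
    rw [hs, Real.norm_eq_abs]
    have h1 := Int.floor_le (f x / η)
    have h2 := Int.lt_floor_add_one (f x / η)
    rw [le_div_iff₀ hη] at h1
    rw [div_lt_iff₀ hη] at h2
    rw [abs_le]; constructor <;> linarith
  have hind : ∀ (μ : Measure X) [IsProbabilityMeasure μ], ∀ k ∈ I,
      Integrable ((A k).indicator (fun _ => (k : ℝ) * η)) μ := fun μ _ k _ =>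
    (integrable_const _).indicator (hA k)
  have hsint : ∀ (μ : Measure X) [IsProbabilityMeasure μ], Integrable s μ := fun μ _ =>
    integrable_finsetSum _ (hind μ)
  have hval : ∀ (μ : Measure X) [IsProbabilityMeasure μ],
      ∫ x, s x ∂μ = ∑ k ∈ I, (μ (A k)).toReal * (k * η) := by
    intro μ _
    rw [integral_finsetSum _ (hind μ)]
    refine Finset.sum_congr rfl fun k _ => ?_
    rw [integral_indicator_const _ (hA k)]
    rfl
  have hclose : ∀ (μ : Measure X) [IsProbabilityMeasure μ],
      |∫ x, f x ∂μ - ∫ x, s x ∂μ| ≤ η := by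
    intro μ _
    rw [← integral_sub (f.integrable μ) (hsint μ)]
    have := norm_integral_le_of_norm_le_const (μ := μ) (Eventually.of_forall hsf)
    simpa using this
  let M : ℝ := ∑ k ∈ I, |(k : ℝ) * η|
  have hM : 0 ≤ M := Finset.sum_nonneg fun _ _ => abs_nonneg _
  have hev : ∀ᶠ n in atTop, ∀ k ∈ I, ∀ q,
      |((r n q : Measure X) (A k)).toReal - ((rlim q : Measure X) (A k)).toReal| ≤ η / (M + 1) := by
    rw [Finset.eventually_all]
    intro k _
    have := Metric.tendstoUniformly_iff.1 (hrunif (A k) (hA k)) (η / (M + 1)) (by positivity)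
    filter_upwards [this] with n hn q
    have := (hn q).le
    rwa [dist_comm, Real.dist_eq] at this
  filter_upwards [hev] with n hn q
  have h1 := abs_le.1 (hclose (r n q : Measure X))
  have h2 := abs_le.1 (hclose (rlim q : Measure X))
  have h3 : |∫ x, s x ∂(r n q : Measure X) - ∫ x, s x ∂(rlim q : Measure X)| ≤ η := by
    rw [hval, hval, ← Finset.sum_sub_distrib]
    calc _ ≤ ∑ k ∈ I, |((r n q : Measure X) (A k)).toReal * (k * η) -
            ((rlim q : Measure X) (A k)).toReal * (k * η)| := Finset.abs_sum_le_sum_abs _ _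
      _ ≤ ∑ k ∈ I, η / (M + 1) * |(k : ℝ) * η| := by
          refine Finset.sum_le_sum fun k hk => ?_
          rw [← sub_mul, abs_mul]
          exact mul_le_mul_of_nonneg_right (hn k hk q) (abs_nonneg _)
      _ = η / (M + 1) * M := by rw [Finset.mul_sum]
      _ ≤ η := by
          rw [div_mul_eq_mul_div, div_le_iff₀ (by positivity)]
          nlinarith
  have h3 := abs_le.1 h3
  rw [abs_le]; constructor <;> linarith [h1.1, h1.2, h2.1, h2.2, h3.1, h3.2]

lemma auxC {X : Type*} [MeasurableSpace X] [TopologicalSpace X] [BorelSpace X]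
    (μ : Measure X) [IsProbabilityMeasure μ] (f : X →ᵇ ℝ) (n : ℕ) (hn : 1 ≤ n) (a : ℝ) :
    ∫ x : Fin n → X, ((n : ℝ)⁻¹ * ∑ i, f (x i) - a) ^ 2 ∂(Measure.pi fun _ => μ) ≤
      ‖f‖ ^ 2 / n + (∫ x, f x ∂μ - a) ^ 2 := by
  have hn0 : (n : ℝ) ≠ 0 := by positivity
  have hfm : MemLp f 2 μ := memLp_of_bounded (a := -‖f‖) (b := ‖f‖)
    (Eventually.of_forall fun x => abs_le.1 (f.norm_coe_le_norm x))
    f.continuous.measurable.aestronglyMeasurable 2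
  have hev : ∀ i : Fin n, MemLp (fun x : Fin n → X => f (x i)) 2 (Measure.pi fun _ => μ) :=
    fun i => hfm.comp_measurePreserving (measurePreserving_eval (fun _ : Fin n => μ) i)
  have hsum : MemLp (fun x : Fin n → X => ∑ i, f (x i)) 2 (Measure.pi fun _ => μ) :=
    memLp_finsetSum _ fun i _ => hev i
  have hY : MemLp (fun x : Fin n → X => (n : ℝ)⁻¹ * ∑ i, f (x i)) 2 (Measure.pi fun _ => μ) :=
    hsum.const_mul _
  have hYa : MemLp (fun x : Fin n → X => (n : ℝ)⁻¹ * ∑ i, f (x i) - a) 2 (Measure.pi fun _ => μ) :=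
    hY.sub (memLp_const a)
  have hmean : ∫ x : Fin n → X, ((n : ℝ)⁻¹ * ∑ i, f (x i) - a) ∂(Measure.pi fun _ => μ)
      = ∫ x, f x ∂μ - a := by
    rw [integral_sub (hY.integrable (by norm_num)) (integrable_const _), integral_const_mul,
      integral_finsetSum _ (fun i _ => (hev i).integrable (by norm_num))]
    have : ∀ i : Fin n, ∫ x : Fin n → X, f (x i) ∂(Measure.pi fun _ => μ) = ∫ x, f x ∂μ := fun i =>
      integral_comp_eval (μ := fun _ : Fin n => μ) (i := i) hfm.aestronglyMeasurable
    simp [this, hn0]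
  have hvar : Var[fun x : Fin n → X => (n : ℝ)⁻¹ * ∑ i, f (x i) - a; Measure.pi fun _ => μ]
      ≤ ‖f‖ ^ 2 / n := by
    rw [variance_sub_const hY.aestronglyMeasurable, variance_const_mul]
    have h1 := variance_sum_pi (μ := fun _ : Fin n => μ) (X := fun _ => (f : X → ℝ)) (fun _ => hfm)
    have h2 : (∑ i : Fin n, fun ω : Fin n → X => f (ω i)) = fun x => ∑ i, f (x i) := by
      ext x; simp
    rw [h2] at h1
    rw [h1]
    have h3 : Var[f; μ] ≤ ‖f‖ ^ 2 := by
      have := variance_le_sq_of_bounded (μ := μ) (a := -‖f‖) (b := ‖f‖) (X := f)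
        (Eventually.of_forall fun x => abs_le.1 (f.norm_coe_le_norm x)) hfm.aemeasurable
      convert this using 2; ring
    simp only [Finset.sum_const, Finset.card_univ, Fintype.card_fin, nsmul_eq_mul]
    calc _ = Var[f; μ] / n := by field_simp
      _ ≤ _ := by gcongr
  rw [variance_eq_sub hYa, hmean] at hvar
  have : ∫ x : Fin n → X, ((n : ℝ)⁻¹ * ∑ i, f (x i) - a) ^ 2 ∂(Measure.pi fun _ => μ)
    = ∫ x : Fin n → X, ((fun x : Fin n → X => (n : ℝ)⁻¹ * ∑ i, f (x i) - a) ^ 2) x ∂(Measure.pi fun _ => μ) := rfl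
  linarith

lemma auxD {X Y : Type*} [MeasurableSpace X] [MeasurableSpace Y] (n : ℕ)
    (r : Y → ProbabilityMeasure X)
    (hr : ∀ A : Set X, MeasurableSet A → Measurable fun q => (r q : Measure X) A) :
    Measurable (fun q => Measure.pi (fun _ : Fin n => (r q : Measure X))) := by
  refine Measurable.measure_of_isPiSystem_of_isProbabilityMeasure generateFrom_pi.symm
    isPiSystem_pi ?_
  rintro _ ⟨t, ht, rfl⟩
  simp only [Measure.pi_pi]
  exact Finset.measurable_prod _ fun i _ => hr _ (ht i (Set.mem_univ i))

lemma auxE {X Y : Type*} [MeasurableSpace X] [MeasurableSpace Y] (π : Measure Y)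
    [IsProbabilityMeasure π] (κ : Y → Measure X) (hκ : Measurable κ)
    (P : Measure X) [IsProbabilityMeasure P]
    (hP : ∀ A, MeasurableSet A → P A = ∫⁻ q, κ q A ∂π) (f : X → ℝ) (hf : Integrable f P) :
    Integrable (fun q => ∫ x, f x ∂κ q) π ∧ ∫ x, f x ∂P = ∫ q, ∫ x, f x ∂κ q ∂π := by
  let η : Kernel Y X := ⟨κ, hκ⟩
  have hPe : P = (η ∘ₖ Kernel.const Unit π) () := by
    ext A hA
    rw [hP A hA, Kernel.comp_apply' _ _ _ hA]
    simp [η]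
  rw [hPe] at hf ⊢
  have h1 := hf.integral_comp
  have h2 := Kernel.integral_comp hf
  rw [Kernel.const_apply] at h1 h2
  exact ⟨h1, h2⟩

/-- **Weak convergence of the empirical measures `Qₙ` (Theorem `thmQ`).**
`X` is compact, `π̄ₙ ⇒ π̄` on `𝒫(X)`, the directing measures `r_{q,n}` converge to `r_q`
uniformly in `q` on every Borel set, and `q ↦ r_q` is continuous.  With
`Pₙ(A) = ∫ r_{q,n}^{⊗n}(A) π̄ₙ(dq)`, `gₙ` the empirical-measure map and
`Qₙ = Pₙ ∘ gₙ⁻¹`, `Q = π̄ ∘ (q ↦ r_q)⁻¹`, we have `Qₙ ⇒ Q`. -/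
theorem stmt_4
    {X : Type*} [MeasurableSpace X] [MetricSpace X] [CompactSpace X] [BorelSpace X]
    [MeasurableSpace (ProbabilityMeasure X)] [BorelSpace (ProbabilityMeasure X)]
    (πbarseq : ℕ → ProbabilityMeasure (ProbabilityMeasure X))
    (πbar : ProbabilityMeasure (ProbabilityMeasure X))
    (hπconv : Tendsto πbarseq atTop (𝓝 πbar))
    (r : ℕ → ProbabilityMeasure X → ProbabilityMeasure X)
    (rlim : ProbabilityMeasure X → ProbabilityMeasure X)
    (hrmeas : ∀ (n : ℕ) (A : Set X), MeasurableSet A →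
      Measurable fun q : ProbabilityMeasure X => (r n q : Measure X) A)
    (hrunif : ∀ A : Set X, MeasurableSet A →
      TendstoUniformly (fun (n : ℕ) (q : ProbabilityMeasure X) => ((r n q : Measure X) A).toReal)
        (fun q : ProbabilityMeasure X => ((rlim q : Measure X) A).toReal) atTop)
    (hrcont : Continuous rlim)
    (Pn : (n : ℕ) → ProbabilityMeasure (Fin n → X))
    (hPn : ∀ (n : ℕ) (A : Set (Fin n → X)), MeasurableSet A →
      (Pn n : Measure (Fin n → X)) A
        = ∫⁻ q, Measure.pi (fun _ : Fin n => (r n q : Measure X)) A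
            ∂(πbarseq n : Measure (ProbabilityMeasure X)))
    (gn : (n : ℕ) → (Fin n → X) → ProbabilityMeasure X)
    (hgn : ∀ n : ℕ, 1 ≤ n → ∀ x : Fin n → X,
      (gn n x : Measure X) = ((n : ℝ≥0∞))⁻¹ • ∑ i : Fin n, Measure.dirac (x i))
    (hgnmeas : ∀ n : ℕ, Measurable (gn n))
    (Qn : ℕ → ProbabilityMeasure (ProbabilityMeasure X))
    (hQn : ∀ (n : ℕ) (E : Set (ProbabilityMeasure X)), MeasurableSet E →
      (Qn n : Measure (ProbabilityMeasure X)) E = (Pn n : Measure (Fin n → X)) (gn n ⁻¹' E))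
    (Q : ProbabilityMeasure (ProbabilityMeasure X))
    (hQ : ∀ E : Set (ProbabilityMeasure X), MeasurableSet E →
      (Q : Measure (ProbabilityMeasure X)) E
        = (πbar : Measure (ProbabilityMeasure X)) (rlim ⁻¹' E)) :
    Tendsto Qn atTop (𝓝 Q) := by
  rw [ProbabilityMeasure.tendsto_iff_forall_integral_tendsto] at hπconv ⊢
  intro F
  have hFm : Measurable F := F.continuous.measurable
  have hQmap : (Q : Measure (ProbabilityMeasure X))
      = (πbar : Measure (ProbabilityMeasure X)).map rlim := by
    ext E hE
    rw [hQ E hE, Measure.map_apply hrcont.measurable hE]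
  have hQnmap : ∀ n, (Qn n : Measure (ProbabilityMeasure X))
      = (Pn n : Measure (Fin n → X)).map (gn n) := by
    intro n
    ext E hE
    rw [hQn n E hE, Measure.map_apply (hgnmeas n) hE]
  have hQint : ∫ p, F p ∂(Q : Measure (ProbabilityMeasure X))
      = ∫ q, F (rlim q) ∂(πbar : Measure (ProbabilityMeasure X)) := by
    rw [hQmap, integral_map hrcont.measurable.aemeasurable hFm.aestronglyMeasurable]
  have hFg : ∀ n (μ : Measure (Fin n → X)) [IsProbabilityMeasure μ],
      Integrable (fun x => F (gn n x)) μ := fun n μ _ =>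
    Integrable.of_bound (hFm.comp (hgnmeas n)).aestronglyMeasurable ‖F‖
      (Eventually.of_forall fun x => F.norm_coe_le_norm _)
  have hkey : ∀ n, Integrable (fun q => ∫ x, F (gn n x) ∂(Measure.pi fun _ => (r n q : Measure X)))
        (πbarseq n : Measure (ProbabilityMeasure X)) ∧
      ∫ p, F p ∂(Qn n : Measure (ProbabilityMeasure X))
      = ∫ q, ∫ x, F (gn n x) ∂(Measure.pi fun _ => (r n q : Measure X))
        ∂(πbarseq n : Measure (ProbabilityMeasure X)) := by
    intro n
    rw [hQnmap, integral_map (hgnmeas n).aemeasurable hFm.aestronglyMeasurable]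
    exact auxE _ _ (auxD n (r n) (hrmeas n)) _ (hPn n) _ (hFg n _)
  have hlim : Tendsto (fun n => ∫ q, F (rlim q) ∂(πbarseq n : Measure (ProbabilityMeasure X))) atTop
      (𝓝 (∫ q, F (rlim q) ∂(πbar : Measure (ProbabilityMeasure X)))) :=
    hπconv (F.compContinuous ⟨rlim, hrcont⟩)
  have hFr : ∀ n, Integrable (fun q => F (rlim q)) (πbarseq n : Measure (ProbabilityMeasure X)) :=
    fun n => (F.compContinuous ⟨rlim, hrcont⟩).integrable _
  rw [hQint]
  refine tendsto_of_tendsto_of_dist hlim ?_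
  rw [Metric.tendsto_atTop']
  simp only [Real.dist_0_eq_abs, abs_dist]
  intro ε hε
  obtain ⟨s, C, hC, hs⟩ := auxA F (half_pos (half_pos hε))
  -- second moment bound, uniformly in `q`
  have hlimS : Tendsto (fun δ : ℝ × ℕ => C * ∑ f ∈ s, (‖f‖ ^ 2 / (δ.2 : ℝ) + δ.1 ^ 2))
      (𝓝 0 ×ˢ atTop) (𝓝 (C * ∑ f ∈ s, (0 + 0 ^ 2))) := by
    refine Tendsto.const_mul _ (tendsto_finsetSum _ fun f _ => Tendsto.add ?_ ?_)
    · exact (tendsto_const_div_atTop_nhds_zero_nat (‖f‖ ^ 2)).comp tendsto_snd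
    · exact (tendsto_fst (f := 𝓝 (0 : ℝ)) (g := (atTop : Filter ℕ))).pow 2
  have hlt : C * ∑ f ∈ s, ((0 : ℝ) + 0 ^ 2) < ε / 2 / 2 := by
    simp only [ne_eq, OfNat.ofNat_ne_zero, not_false_eq_true, zero_pow, add_zero,
      Finset.sum_const_zero, mul_zero]
    positivity
  have hev0 := hlimS.eventually_lt_const hlt
  obtain ⟨δ, hδ, hδev⟩ : ∃ δ : ℝ, 0 < δ ∧ ∀ᶠ n : ℕ in atTop,
      C * ∑ f ∈ s, (‖f‖ ^ 2 / (n : ℝ) + δ ^ 2) < ε / 2 / 2 := by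
    have h1 := hev0.curry
    have h2 : ∀ᶠ δ in 𝓝[>] (0 : ℝ), ∀ᶠ n : ℕ in atTop,
      C * ∑ f ∈ s, (‖f‖ ^ 2 / (n : ℝ) + δ ^ 2) < ε / 2 / 2 := h1.filter_mono nhdsWithin_le_nhds
    obtain ⟨δ, hδ, h⟩ := ((eventually_mem_nhdsWithin (a := (0 : ℝ)) (s := Set.Ioi 0)).and h2).exists
    exact ⟨δ, hδ, h⟩
  have hB : ∀ᶠ n in atTop, ∀ f ∈ s, ∀ q,
      |∫ x, f x ∂(r n q : Measure X) - ∫ x, f x ∂(rlim q : Measure X)| ≤ δ := by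
    rw [Finset.eventually_all]
    exact fun f _ => auxB r rlim hrunif f hδ
  have hfin : ∀ᶠ n in atTop,
      dist (∫ q, F (rlim q) ∂(πbarseq n : Measure (ProbabilityMeasure X)))
        (∫ p, F p ∂(Qn n : Measure (ProbabilityMeasure X))) < ε := by
    filter_upwards [hδev, hB, eventually_ge_atTop 1] with n hn1 hn2 hn
    rw [dist_comm, Real.dist_eq, (hkey n).2, ← integral_sub (hkey n).1 (hFr n)]
    have hbound : ∀ q, ‖∫ x, F (gn n x) ∂(Measure.pi fun _ => (r n q : Measure X)) - F (rlim q)‖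
        ≤ ε / 2 := by
      intro q
      have hg : ∀ (x : Fin n → X) (f : X →ᵇ ℝ),
          ∫ y, f y ∂(gn n x : Measure X) = (n : ℝ)⁻¹ * ∑ i, f (x i) := by
        intro x f
        rw [hgn n hn x, integral_smul_measure, integral_finsetSum_measure
          (fun i _ => f.integrable _)]
        simp [integral_dirac' _ _ f.continuous.measurable.stronglyMeasurable]
      have hFc : F (rlim q)
          = ∫ x : Fin n → X, F (rlim q) ∂(Measure.pi fun _ => (r n q : Measure X)) := by simp
      have hI : ∀ f ∈ s, Integrable (fun x : Fin n → X =>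
          ((n : ℝ)⁻¹ * ∑ i, f (x i) - ∫ y, f y ∂(rlim q : Measure X)) ^ 2)
          (Measure.pi fun _ => (r n q : Measure X)) := by
        intro f _
        have hev : ∀ i : Fin n, Measurable (fun x : Fin n → X => f (x i)) := fun i =>
          f.continuous.measurable.comp (measurable_pi_apply i)
        refine Integrable.of_bound (C := (‖f‖ + ‖f‖) ^ 2) ?_ ?_
        · exact ((((Finset.measurable_sum _ fun i _ => hev i).const_mul _).sub_const _).pow_const
            2).aestronglyMeasurable
        · refine Eventually.of_forall fun x => ?_
          rw [norm_pow]
          gcongr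
          refine (norm_sub_le _ _).trans (add_le_add ?_ (f.norm_integral_le_norm _))
          rw [← hg]
          exact f.norm_integral_le_norm _
      rw [hFc, ← integral_sub (hFg n _) (integrable_const _)]
      refine (norm_integral_le_of_norm_le (g := fun x : Fin n → X => ε / 2 / 2 + C * ∑ f ∈ s,
        ((n : ℝ)⁻¹ * ∑ i, f (x i) - ∫ y, f y ∂(rlim q : Measure X)) ^ 2) ?_ ?_).trans ?_
      · exact (integrable_const _).add ((integrable_finsetSum _ hI).const_mul C)
      · refine Eventually.of_forall fun x => ?_
        have := hs (gn n x) (rlim q)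
        simpa only [hg, Real.norm_eq_abs] using this
      · rw [integral_add (integrable_const _) ((integrable_finsetSum _ hI).const_mul C),
          integral_const_mul, integral_finsetSum _ hI]
        have h1 : ∑ f ∈ s, ∫ x : Fin n → X,
            ((n : ℝ)⁻¹ * ∑ i, f (x i) - ∫ y, f y ∂(rlim q : Measure X)) ^ 2
              ∂(Measure.pi fun _ => (r n q : Measure X))
            ≤ ∑ f ∈ s, (‖f‖ ^ 2 / (n : ℝ) + δ ^ 2) := by
          refine Finset.sum_le_sum fun f hf => (auxC _ f n hn _).trans ?_
          refine add_le_add le_rfl ?_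
          exact sq_le_sq' (abs_le.1 (hn2 f hf q)).1 (abs_le.1 (hn2 f hf q)).2
        have h2 := mul_le_mul_of_nonneg_left h1 hC
        simp only [integral_const, probReal_univ, one_smul]
        linarith
    have := norm_integral_le_of_norm_le_const
      (μ := (πbarseq n : Measure (ProbabilityMeasure X))) (Eventually.of_forall hbound)
    simp only [probReal_univ, mul_one, Real.norm_eq_abs] at this
    linarith
  obtain ⟨N, hN⟩ := eventually_atTop.1 hfin
  exact ⟨N, fun n hn => hN n hn.le⟩
end

section
/- Let q be a Borel probability measure on X and φ: X → [0,∞) a measurable function that is q-integrable. Then (∫_X exp(−φ(x)/m) q(dx))^m → exp(−∫_X φ dq) as m → ∞. Moreover, if φ is bounded and measurable, then the convergence is uniform over q: sup_{q ∈ 𝒫(X)} | (∫_X exp(−φ/m) dq)^m − exp(−∫_X φ dq) | → 0 as m → ∞. -/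
open MeasureTheory Filter Topology


noncomputable def gPee (m : ℕ) (t : ℝ) : ℝ := (m : ℝ) * (Real.exp (-t / (m : ℝ)) - 1 + t / (m : ℝ))

lemma gPee_nonneg (m : ℕ) (t : ℝ) : 0 ≤ gPee m t := by
  unfold gPee
  have h := Real.add_one_le_exp (-t / (m : ℝ))
  have : -t / (m : ℝ) = - (t / m) := by ring
  apply mul_nonneg (by positivity)
  linarith

lemma gPee_le_self (m : ℕ) (hm : 1 ≤ m) (t : ℝ) (ht : 0 ≤ t) : gPee m t ≤ t := by
  unfold gPee
  have hm' : (0 : ℝ) < m := by exact_mod_cast hm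
  have h : Real.exp (-t / (m : ℝ)) ≤ 1 := by
    apply Real.exp_le_one_iff.2
    rw [neg_div]
    have : 0 ≤ t / (m : ℝ) := by positivity
    linarith
  calc (m : ℝ) * (Real.exp (-t / (m : ℝ)) - 1 + t / (m : ℝ)) ≤ m * (t / m) := by
        gcongr
        linarith
    _ = t := by field_simp

lemma gPee_le_sq (m : ℕ) (hm : 1 ≤ m) (t : ℝ) (ht : 0 ≤ t) : gPee m t ≤ t ^ 2 / m := by
  unfold gPee
  have hm' : (0 : ℝ) < m := by exact_mod_cast hm
  have key : ∀ s : ℝ, 0 ≤ s → Real.exp (-s) - 1 + s ≤ s ^ 2 := by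
    intro s hs
    have h1 := Real.add_one_le_exp s
    have h2 : Real.exp (-s) * Real.exp s = 1 := by rw [← Real.exp_add]; simp
    have h3 := Real.exp_pos (-s)
    have h4 : Real.exp (-s) * (s + 1) ≤ 1 := by nlinarith
    have h5 : Real.exp (-s) * (s + 1) ≤ (1 - s + s ^ 2) * (s + 1) := by
      have : 0 ≤ s ^ 3 := by positivity
      nlinarith
    have := le_of_mul_le_mul_right h5 (by linarith)
    linarith
  have := key (t / m) (by positivity)
  rw [neg_div]
  calc (m : ℝ) * (Real.exp (-(t / (m : ℝ))) - 1 + t / (m : ℝ)) ≤ m * (t / m) ^ 2 := by gcongr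
    _ = t ^ 2 / m := by field_simp

lemma pee_exp_le_one (m : ℕ) (t : ℝ) (ht : 0 ≤ t) : Real.exp (-t / (m : ℝ)) ≤ 1 := by
  apply Real.exp_le_one_iff.2
  rw [neg_div]
  have : 0 ≤ t / (m : ℝ) := by positivity
  linarith

lemma pee_bound {X : Type*} [MeasurableSpace X] (φ : X → ℝ) (hφmeas : Measurable φ)
    (hφ0 : ∀ x, 0 ≤ φ x) (q : Measure X) [IsProbabilityMeasure q] (hint : Integrable φ q)
    (m : ℕ) (hm : 1 ≤ m) :
    |(∫ x, Real.exp (-(φ x) / (m : ℝ)) ∂q) ^ m - Real.exp (-∫ x, φ x ∂q)|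
      ≤ (∫ x, gPee m (φ x) ∂q) + gPee m (∫ x, φ x ∂q) := by
  have hm' : (0 : ℝ) < m := by exact_mod_cast hm
  have hI : 0 ≤ ∫ x, φ x ∂q := integral_nonneg hφ0
  have hexpint : Integrable (fun x => Real.exp (-(φ x) / (m : ℝ))) q := by
    refine Integrable.of_bound (C := 1) ?_ ?_
    · exact (by fun_prop : Measurable fun x => Real.exp (-(φ x) / (m : ℝ))).aestronglyMeasurable
    · refine Eventually.of_forall fun x => ?_
      rw [Real.norm_eq_abs, abs_of_pos (Real.exp_pos _)]
      exact pee_exp_le_one m _ (hφ0 x)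
  have hg : ∫ x, gPee m (φ x) ∂q
      = m * ((∫ x, Real.exp (-(φ x) / (m : ℝ)) ∂q) - 1 + (∫ x, φ x ∂q) / m) := by
    unfold gPee
    have hs : Integrable (fun x => Real.exp (-(φ x) / (m : ℝ)) - 1) q :=
      hexpint.sub (integrable_const _)
    rw [integral_const_mul, integral_add hs (hint.div_const _),
      integral_sub hexpint (integrable_const _), integral_div]
    simp
  have hg0 : 0 ≤ ∫ x, gPee m (φ x) ∂q := integral_nonneg fun x => gPee_nonneg m _
  have hg1 := gPee_nonneg m (∫ x, φ x ∂q)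
  have ha0 : 0 ≤ ∫ x, Real.exp (-(φ x) / (m : ℝ)) ∂q :=
    integral_nonneg fun x => (Real.exp_pos _).le
  have ha1 : ∫ x, Real.exp (-(φ x) / (m : ℝ)) ∂q ≤ 1 := by
    have := integral_mono hexpint (integrable_const (1 : ℝ))
      (fun x => pee_exp_le_one m _ (hφ0 x))
    simpa using this
  have hb1 := pee_exp_le_one m _ hI
  have hb0 := (Real.exp_pos (-(∫ x, φ x ∂q) / (m : ℝ))).le
  have hb : Real.exp (-∫ x, φ x ∂q) = Real.exp (-(∫ x, φ x ∂q) / (m : ℝ)) ^ m := by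
    rw [← Real.exp_nat_mul]
    congr 1
    field_simp
  rw [hb]
  have hgI : gPee m (∫ x, φ x ∂q)
      = m * (Real.exp (-(∫ x, φ x ∂q) / (m : ℝ)) - 1 + (∫ x, φ x ∂q) / m) := rfl
  generalize (∫ x, gPee m (φ x) ∂q) = G at *
  generalize gPee m (∫ x, φ x ∂q) = H at *
  generalize (∫ x, Real.exp (-(φ x) / (m : ℝ)) ∂q) = a at *
  generalize Real.exp (-(∫ x, φ x ∂q) / (m : ℝ)) = b at *
  have h1 := abs_pow_sub_pow_le a b m
  have h2 : max |a| |b| ^ (m - 1) ≤ 1 := by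
    apply pow_le_one₀ (by positivity)
    rw [abs_of_nonneg ha0, abs_of_nonneg hb0]
    exact max_le ha1 hb1
  have h3 : |a - b| * m * max |a| |b| ^ (m - 1) ≤ |a - b| * m :=
    mul_le_of_le_one_right (by positivity) h2
  have h4 : |a - b| * m = |G - H| := by
    rw [hg, hgI, ← mul_sub, abs_mul, abs_of_pos hm', mul_comm]
    congr 2
    ring
  have h5 : |G - H| ≤ G + H := by
    rw [abs_le]
    constructor <;> linarith
  linarith

lemma pee_tendsto_div (c : ℝ) : Tendsto (fun m : ℕ => c / (m : ℝ)) atTop (𝓝 0) :=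
  tendsto_const_div_atTop_nhds_zero_nat c

lemma gPee_tendsto (t : ℝ) (ht : 0 ≤ t) : Tendsto (fun m : ℕ => gPee m t) atTop (𝓝 0) := by
  refine squeeze_zero' (Eventually.of_forall fun m => gPee_nonneg m t) ?_ (pee_tendsto_div (t ^ 2))
  filter_upwards [eventually_ge_atTop 1] with m hm
  exact gPee_le_sq m hm t ht

lemma gPee_measurable (m : ℕ) : Measurable (gPee m) := by
  unfold gPee
  fun_prop

/-- **Proposition `Pee`.**
For a probability measure `q` and a nonnegative `q`-integrable measurable `φ`,
`(∫ e^{−φ/m} dq)^m → e^{−∫ φ dq}` as `m → ∞`; moreover, if `φ` is bounded, the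
convergence is uniform over all probability measures `q`. -/
theorem stmt_5
    {X : Type*} [MeasurableSpace X] [TopologicalSpace X] [PolishSpace X] [BorelSpace X]
    (φ : X → ℝ) (hφmeas : Measurable φ) (hφ0 : ∀ x, 0 ≤ φ x)
    (q : Measure X) [IsProbabilityMeasure q] (hint : Integrable φ q) :
    Tendsto (fun m : ℕ => (∫ x, Real.exp (-(φ x) / (m : ℝ)) ∂q) ^ m) atTop
      (𝓝 (Real.exp (-∫ x, φ x ∂q)))
    ∧ ((∃ M : ℝ, ∀ x, φ x ≤ M) →
        Tendsto (fun m : ℕ => ⨆ q' : ProbabilityMeasure X,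
            |(∫ x, Real.exp (-(φ x) / (m : ℝ)) ∂(q' : Measure X)) ^ m
              - Real.exp (-∫ x, φ x ∂(q' : Measure X))|)
          atTop (𝓝 0)) := by
  constructor
  · rw [tendsto_iff_dist_tendsto_zero]
    have h1 : Tendsto (fun m : ℕ => ∫ x, gPee m (φ x) ∂q) atTop (𝓝 (∫ _, (0 : ℝ) ∂q)) := by
      refine tendsto_integral_filter_of_dominated_convergence φ ?_ ?_ hint ?_
      · exact Eventually.of_forall fun m =>
          ((gPee_measurable m).comp hφmeas).aestronglyMeasurable
      · filter_upwards [eventually_ge_atTop 1] with m hm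
        refine Eventually.of_forall fun x => ?_
        rw [Real.norm_eq_abs, abs_of_nonneg (gPee_nonneg m _)]
        exact gPee_le_self m hm _ (hφ0 x)
      · exact Eventually.of_forall fun x => gPee_tendsto _ (hφ0 x)
    have h2 := h1.add (gPee_tendsto _ (integral_nonneg hφ0 : 0 ≤ ∫ x, φ x ∂q))
    simp only [integral_zero, add_zero] at h2
    refine squeeze_zero' (Eventually.of_forall fun m => dist_nonneg) ?_ h2
    filter_upwards [eventually_ge_atTop 1] with m hm
    rw [Real.dist_eq]
    exact pee_bound φ hφmeas hφ0 q hint m hm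
  · rintro ⟨M, hM⟩
    refine squeeze_zero' (Eventually.of_forall fun m => Real.iSup_nonneg fun _ => abs_nonneg _) ?_
      (pee_tendsto_div (M ^ 2 + M ^ 2))
    filter_upwards [eventually_ge_atTop 1] with m hm
    refine Real.iSup_le (fun p => ?_) (by positivity)
    have hm' : (0 : ℝ) < m := by exact_mod_cast hm
    have hi : Integrable φ (p : Measure X) := by
      refine Integrable.of_bound (C := M) hφmeas.aestronglyMeasurable ?_
      refine Eventually.of_forall fun x => ?_
      rw [Real.norm_eq_abs, abs_of_nonneg (hφ0 x)]
      exact hM x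
    refine (pee_bound φ hφmeas hφ0 p hi m hm).trans ?_
    have hI0 : 0 ≤ ∫ x, φ x ∂(p : Measure X) := integral_nonneg hφ0
    have hIM : ∫ x, φ x ∂(p : Measure X) ≤ M := by
      have := integral_mono hi (integrable_const M) hM
      simpa using this
    have key : ∀ t, 0 ≤ t → t ≤ M → gPee m t ≤ M ^ 2 / m := fun t h0 h1 =>
      (gPee_le_sq m hm t h0).trans (by gcongr)
    have hgi : Integrable (fun x => gPee m (φ x)) (p : Measure X) := by
      refine hi.mono' ((gPee_measurable m).comp hφmeas).aestronglyMeasurable ?_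
      refine Eventually.of_forall fun x => ?_
      rw [Real.norm_eq_abs, abs_of_nonneg (gPee_nonneg m _)]
      exact gPee_le_self m hm _ (hφ0 x)
    have hG : ∫ x, gPee m (φ x) ∂(p : Measure X) ≤ M ^ 2 / m := by
      have := integral_mono hgi (integrable_const (M ^ 2 / (m : ℝ)))
        (fun x => key _ (hφ0 x) (hM x))
      simpa using this
    rw [add_div]
    exact add_le_add hG (key _ hI0 hIM)
end

section
/- Let φ: X → [0,∞) be nonnegative, measurable and bounded, let w_n(x) := exp(−φ(x)/n), and define π̄_n(E) := Z_n^{-1} ∫_E (∫_X w_n dq)^n π(dq) for Borel E ⊆ 𝒫(X), where Z_n := ∫_{𝒫(X)} (∫_X w_n dq)^n π(dq). Then π̄_n converges weakly to the probability measure π̄ on 𝒫(X) defined by π̄(E) := Z^{-1} ∫_E exp(−∫_X φ dq) π(dq), where Z := ∫_{𝒫(X)} exp(−∫_X φ dq) π(dq). -/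
open MeasureTheory Filter Topology

theorem pow_integral_exp_tendsto {X : Type*} [MeasurableSpace X] (φ : X → ℝ)
    (hφmeas : Measurable φ) (hφ0 : ∀ x, 0 ≤ φ x) (M : ℝ) (hM : ∀ x, φ x ≤ M)
    (q : Measure X) [IsProbabilityMeasure q] :
    Tendsto (fun n : ℕ => (∫ x, Real.exp (-(φ x) / (n : ℝ)) ∂q) ^ n) atTop
      (𝓝 (Real.exp (-∫ x, φ x ∂q))) := by
  have hint : ∀ n : ℕ, Integrable (fun x => Real.exp (-(φ x) / (n : ℝ))) q := by
    intro n
    refine Integrable.of_bound (C := 1) (by fun_prop) (ae_of_all _ fun x => ?_)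
    rw [Real.norm_eq_abs, Real.abs_exp, Real.exp_le_one_iff]
    exact div_nonpos_of_nonpos_of_nonneg (by linarith [hφ0 x]) (by positivity)
  have key : Tendsto (fun n : ℕ => (n : ℝ) * ∫ x, (Real.exp (-(φ x) / (n : ℝ)) - 1) ∂q) atTop
      (𝓝 (-∫ x, φ x ∂q)) := by
    simp_rw [← integral_const_mul]
    rw [← integral_neg]
    refine tendsto_integral_of_dominated_convergence (fun _ => M) (fun n => ?_)
      (integrable_const _) (fun n => ae_of_all _ fun x => ?_) (ae_of_all _ fun x => ?_)
    · exact Measurable.aestronglyMeasurable (by fun_prop)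
    · rcases Nat.eq_zero_or_pos n with h | h
      · subst h
        simpa using (hφ0 x).trans (hM x)
      · have hn : (0 : ℝ) < n := by exact_mod_cast h
        have h1 : -(φ x) / n ≤ 0 :=
          div_nonpos_of_nonpos_of_nonneg (by linarith [hφ0 x]) hn.le
        have h2 : Real.exp (-(φ x) / n) ≤ 1 := Real.exp_le_one_iff.2 h1
        have h3 := Real.add_one_le_exp (-(φ x) / n)
        rw [norm_mul, Real.norm_eq_abs, Real.norm_eq_abs, abs_of_pos hn,
          abs_of_nonpos (by linarith)]
        have h4 : (n : ℝ) * (-(Real.exp (-(φ x) / n) - 1)) ≤ n * (-(-(φ x) / n)) := by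
          gcongr
          linarith
        have h5 : (n : ℝ) * (-(-(φ x) / n)) = φ x := by field_simp
        linarith [hM x]
    · have hd : HasDerivAt (fun t : ℝ => Real.exp (-(φ x) * t)) (-(φ x)) 0 := by
        have := ((hasDerivAt_id (0 : ℝ)).const_mul (-(φ x))).exp
        simpa using this
      have ht := hd.tendsto_slope_zero_right
      have hinv : Tendsto (fun n : ℕ => ((n : ℝ))⁻¹) atTop (𝓝[>] 0) :=
        tendsto_inv_atTop_nhdsGT_zero.comp tendsto_natCast_atTop_atTop
      have := ht.comp hinv
      simpa [Function.comp_def, div_eq_mul_inv] using this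
  have := Real.tendsto_one_add_pow_exp_of_tendsto key
  refine this.congr fun n => ?_
  rw [integral_sub (hint n) (integrable_const _)]
  simp

/-- **Theorem `thm1`, case `λ = 1`.**
With fitness `wₙ(x) = exp(−φ(x)/n)` (`φ` nonnegative, measurable, bounded) and a fixed
prior `π` on `𝒫(X)`, the re-weighted priors
`π̄ₙ(E) = Zₙ⁻¹ ∫_E (∫ wₙ dq)ⁿ π(dq)` converge weakly to the measure
`π̄(E) = Z⁻¹ ∫_E exp(−∫ φ dq) π(dq)`. -/
theorem stmt_6
    {X : Type*} [MeasurableSpace X] [TopologicalSpace X] [PolishSpace X] [BorelSpace X]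
    [MeasurableSpace (ProbabilityMeasure X)] [BorelSpace (ProbabilityMeasure X)]
    (φ : X → ℝ) (hφmeas : Measurable φ) (hφ0 : ∀ x, 0 ≤ φ x) (hφbdd : ∃ M : ℝ, ∀ x, φ x ≤ M)
    (π : ProbabilityMeasure (ProbabilityMeasure X))
    (Zn : ℕ → ℝ)
    (hZn : ∀ n : ℕ, Zn n
      = ∫ q, (∫ x, Real.exp (-(φ x) / (n : ℝ)) ∂(q : Measure X)) ^ n
          ∂(π : Measure (ProbabilityMeasure X)))
    (πbarn : ℕ → ProbabilityMeasure (ProbabilityMeasure X))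
    (hπbarn : ∀ (n : ℕ) (E : Set (ProbabilityMeasure X)), MeasurableSet E →
      ((πbarn n : Measure (ProbabilityMeasure X)) E).toReal
        = (Zn n)⁻¹ * ∫ q in E, (∫ x, Real.exp (-(φ x) / (n : ℝ)) ∂(q : Measure X)) ^ n
            ∂(π : Measure (ProbabilityMeasure X)))
    (Z : ℝ)
    (hZ : Z = ∫ q, Real.exp (-∫ x, φ x ∂(q : Measure X)) ∂(π : Measure (ProbabilityMeasure X)))
    (πbar : ProbabilityMeasure (ProbabilityMeasure X))
    (hπbar : ∀ E : Set (ProbabilityMeasure X), MeasurableSet E →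
      ((πbar : Measure (ProbabilityMeasure X)) E).toReal
        = Z⁻¹ * ∫ q in E, Real.exp (-∫ x, φ x ∂(q : Measure X))
            ∂(π : Measure (ProbabilityMeasure X))) :
    Tendsto πbarn atTop (𝓝 πbar) := by
  obtain ⟨M, hM⟩ := hφbdd
  have hZne : Z ≠ 0 := by
    intro h
    have := hπbar Set.univ MeasurableSet.univ
    simp [h] at this
  have hZnne : ∀ n, Zn n ≠ 0 := by
    intro n h
    have := hπbarn n Set.univ MeasurableSet.univ
    simp [h] at this
  have hI : ∀ n : ℕ, Integrable (fun q : ProbabilityMeasure X =>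
      (∫ x, Real.exp (-(φ x) / (n : ℝ)) ∂(q : Measure X)) ^ n)
      (π : Measure (ProbabilityMeasure X)) := by
    intro n
    by_contra h
    exact hZnne n ((hZn n).trans (integral_undef h))
  have hlim : ∀ E : Set (ProbabilityMeasure X), Tendsto (fun n : ℕ =>
      ∫ q in E, (∫ x, Real.exp (-(φ x) / (n : ℝ)) ∂(q : Measure X)) ^ n
            ∂(π : Measure (ProbabilityMeasure X))) atTop
      (𝓝 (∫ q in E, Real.exp (-∫ x, φ x ∂(q : Measure X))
            ∂(π : Measure (ProbabilityMeasure X)))) := by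
    intro E
    refine tendsto_integral_of_dominated_convergence (fun _ => 1)
      (fun n => (hI n).aestronglyMeasurable.restrict)
      (integrable_const _) (fun n => ae_of_all _ fun q => ?_) (ae_of_all _ fun q => ?_)
    · rw [norm_pow]
      refine pow_le_one₀ (norm_nonneg _) ?_
      refine (norm_integral_le_of_norm_le_const (C := 1) (ae_of_all _ fun x => ?_)).trans
        (by simp)
      rw [Real.norm_eq_abs, Real.abs_exp, Real.exp_le_one_iff]
      exact div_nonpos_of_nonpos_of_nonneg (by linarith [hφ0 x]) (by positivity)
    · exact pow_integral_exp_tendsto φ hφmeas hφ0 M hM q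
  have hZlim : Tendsto Zn atTop (𝓝 Z) := by
    have := hlim Set.univ
    simp only [Measure.restrict_univ] at this
    rw [← hZ] at this
    exact this.congr fun n => (hZn n).symm
  have hset : ∀ E : Set (ProbabilityMeasure X), MeasurableSet E →
      Tendsto (fun n => (πbarn n : Measure (ProbabilityMeasure X)) E) atTop
        (𝓝 ((πbar : Measure (ProbabilityMeasure X)) E)) := by
    intro E hE
    rw [← ENNReal.tendsto_toReal_iff (fun n => measure_ne_top _ _) (measure_ne_top _ _)]
    rw [hπbar E hE]
    simp_rw [hπbarn _ E hE]
    exact (hZlim.inv₀ hZne).mul (hlim E)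
  refine tendsto_of_forall_isOpen_le_liminf' fun G hG => ?_
  exact (hset G hG.measurableSet).liminf_eq.ge
end

section
/- Let φ: X → [0,∞) be nonnegative, measurable and bounded, let λ > 1, let w_n(x) := exp(−φ(x)/n^λ), and define π̄_n(E) := Z_n^{-1} ∫_E (∫_X w_n dq)^n π(dq) for Borel E ⊆ 𝒫(X), where Z_n := ∫_{𝒫(X)} (∫_X w_n dq)^n π(dq). Then π̄_n converges weakly to π; that is, when λ > 1 the selection has no influence in the limit. -/
open MeasureTheory Filter Topology

/-- **Theorem `thm1`, case `λ > 1`.**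
With fitness `wₙ(x) = exp(−φ(x)/n^λ)`, `λ > 1` (`φ` nonnegative, measurable, bounded)
and a fixed prior `π` on `𝒫(X)`, the re-weighted priors
`π̄ₙ(E) = Zₙ⁻¹ ∫_E (∫ wₙ dq)ⁿ π(dq)` converge weakly to `π` itself:
the selection has no influence in the limit. -/
theorem stmt_7
    {X : Type*} [MeasurableSpace X] [TopologicalSpace X] [PolishSpace X] [BorelSpace X]
    [MeasurableSpace (ProbabilityMeasure X)] [BorelSpace (ProbabilityMeasure X)]
    (φ : X → ℝ) (hφmeas : Measurable φ) (hφ0 : ∀ x, 0 ≤ φ x) (hφbdd : ∃ M : ℝ, ∀ x, φ x ≤ M)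
    (lam : ℝ) (hlam : 1 < lam)
    (π : ProbabilityMeasure (ProbabilityMeasure X))
    (Zn : ℕ → ℝ)
    (hZn : ∀ n : ℕ, Zn n
      = ∫ q, (∫ x, Real.exp (-(φ x) / (n : ℝ) ^ lam) ∂(q : Measure X)) ^ n
          ∂(π : Measure (ProbabilityMeasure X)))
    (πbarn : ℕ → ProbabilityMeasure (ProbabilityMeasure X))
    (hπbarn : ∀ (n : ℕ) (E : Set (ProbabilityMeasure X)), MeasurableSet E →
      ((πbarn n : Measure (ProbabilityMeasure X)) E).toReal
        = (Zn n)⁻¹ * ∫ q in E, (∫ x, Real.exp (-(φ x) / (n : ℝ) ^ lam) ∂(q : Measure X)) ^ n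
            ∂(π : Measure (ProbabilityMeasure X))) :
    Tendsto πbarn atTop (𝓝 π) := by
  obtain ⟨M, hM⟩ := hφbdd
  set g : ℕ → ProbabilityMeasure X → ℝ := fun n q =>
    (∫ x, Real.exp (-(φ x) / (n : ℝ) ^ lam) ∂(q : Measure X)) ^ n with hg
  have hint : ∀ (n : ℕ) (q : ProbabilityMeasure X),
      Integrable (fun x => Real.exp (-(φ x) / (n : ℝ) ^ lam)) (q : Measure X) := by
    intro n q
    refine Integrable.of_bound (C := 1) ?_ (Eventually.of_forall fun x => ?_)
    · exact (Real.measurable_exp.comp (hφmeas.neg.div_const _)).aestronglyMeasurable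
    · rw [Real.norm_eq_abs, Real.abs_exp, Real.exp_le_one_iff]
      exact div_nonpos_of_nonpos_of_nonneg (neg_nonpos.2 (hφ0 x)) (by positivity)
  have hup : ∀ (n : ℕ) (q : ProbabilityMeasure X), g n q ≤ 1 := by
    intro n q
    refine pow_le_one₀ (integral_nonneg fun x => (Real.exp_pos _).le) ?_
    calc _ ≤ ∫ x, (1 : ℝ) ∂(q : Measure X) := by
          refine integral_mono (hint n q) (integrable_const _) fun x => ?_
          rw [Real.exp_le_one_iff]
          exact div_nonpos_of_nonpos_of_nonneg (neg_nonpos.2 (hφ0 x)) (by positivity)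
      _ = 1 := by simp
  have hlow : ∀ (n : ℕ) (q : ProbabilityMeasure X), Real.exp (-M / (n : ℝ) ^ lam) ^ n ≤ g n q := by
    intro n q
    refine pow_le_pow_left₀ (Real.exp_pos _).le ?_ n
    calc Real.exp (-M / (n : ℝ) ^ lam)
          = ∫ x, Real.exp (-M / (n : ℝ) ^ lam) ∂(q : Measure X) := by simp
      _ ≤ _ := by
          refine integral_mono (integrable_const _) (hint n q) fun x => ?_
          have := hM x
          dsimp only
          gcongr
  have hZ0 : ∀ n, Zn n ≠ 0 := by
    intro n h
    have := hπbarn n Set.univ MeasurableSet.univ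
    simp [h] at this
  have hgi : ∀ n, Integrable (g n) (π : Measure (ProbabilityMeasure X)) := by
    intro n
    by_contra h
    exact hZ0 n ((hZn n).trans (integral_undef h))
  have hZ1 : ∀ n, Zn n ≤ 1 := by
    intro n
    rw [hZn n]
    calc _ ≤ ∫ q, (1 : ℝ) ∂(π : Measure (ProbabilityMeasure X)) :=
          integral_mono (hgi n) (integrable_const _) fun q => hup n q
      _ = 1 := by simp
  have hZpos : ∀ n, 0 < Zn n := by
    intro n
    refine lt_of_le_of_ne ?_ (hZ0 n).symm
    rw [hZn n]
    exact integral_nonneg fun q => (pow_pos (Real.exp_pos _) n).le.trans (hlow n q)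
  have key : ∀ (n : ℕ) (E : Set (ProbabilityMeasure X)), MeasurableSet E →
      Real.exp (-M / (n : ℝ) ^ lam) ^ n * ((π : Measure (ProbabilityMeasure X)) E).toReal
        ≤ ((πbarn n : Measure (ProbabilityMeasure X)) E).toReal := by
    intro n E hE
    rw [hπbarn n E hE]
    have h1 : Real.exp (-M / (n : ℝ) ^ lam) ^ n * ((π : Measure (ProbabilityMeasure X)) E).toReal
        ≤ ∫ q in E, g n q ∂(π : Measure (ProbabilityMeasure X)) := by
      calc _ = ∫ q in E, Real.exp (-M / (n : ℝ) ^ lam) ^ n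
              ∂(π : Measure (ProbabilityMeasure X)) := by
            simp [Measure.real, mul_comm]
        _ ≤ _ := integral_mono (integrable_const _) (hgi n).integrableOn fun q => hlow n q
    have h0 : 0 ≤ ∫ q in E, g n q ∂(π : Measure (ProbabilityMeasure X)) :=
      le_trans (by positivity) h1
    exact h1.trans (le_mul_of_one_le_left h0 ((one_le_inv₀ (hZpos n)).2 (hZ1 n)))
  have hc : Tendsto (fun n : ℕ => Real.exp (-M / (n : ℝ) ^ lam) ^ n) atTop (𝓝 1) := by
    have h1 : Tendsto (fun n : ℕ => Real.exp (-M * (n : ℝ) ^ (-(lam - 1)))) atTop (𝓝 1) := by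
      have := ((tendsto_rpow_neg_atTop (sub_pos.2 hlam)).comp
        tendsto_natCast_atTop_atTop).const_mul (-M)
      rw [mul_zero] at this
      have h2 := (Real.continuous_exp.tendsto 0).comp this
      rw [Real.exp_zero] at h2
      exact h2
    refine h1.congr' ?_
    filter_upwards [eventually_gt_atTop 0] with n hn
    have hn' : (0 : ℝ) < n := by exact_mod_cast hn
    rw [← Real.exp_nat_mul, neg_sub, Real.rpow_sub hn', Real.rpow_one]
    congr 1
    ring
  refine tendsto_of_forall_isOpen_le_liminf' fun G hG => ?_
  have hlim : Tendsto (fun n : ℕ => ENNReal.ofReal (Real.exp (-M / (n : ℝ) ^ lam) ^ n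
      * ((π : Measure (ProbabilityMeasure X)) G).toReal)) atTop
      (𝓝 ((π : Measure (ProbabilityMeasure X)) G)) := by
    have := ENNReal.tendsto_ofReal (hc.mul_const ((π : Measure (ProbabilityMeasure X)) G).toReal)
    rwa [one_mul, ENNReal.ofReal_toReal (measure_ne_top _ _)] at this
  rw [← hlim.liminf_eq]
  refine liminf_le_liminf (Eventually.of_forall fun n => ?_)
  exact ENNReal.ofReal_le_of_le_toReal (key n G hG.measurableSet)
end

section
/- Let φ: X → [0,∞) be nonnegative, continuous and bounded, attaining its infimum φ_o at a point x_o, and suppose that for every ε > 0 there exists δ > 0 such that {x ∈ X : φ(x) − φ_o ≤ δ} ⊆ B(x_o, ε) (in particular x_o is the unique minimizer). Let λ ∈ [0,1), let w_n(x) := exp(−φ(x)/n^λ), let π be a Borel probability measure on 𝒫(X) whose support contains the measure δ_{x_o}, and define π̄_n(E) := Z_n^{-1} ∫_E (∫_X w_n dq)^n π(dq) with Z_n := ∫_{𝒫(X)} (∫_X w_n dq)^n π(dq). Then π̄_n converges weakly to δ_{q*}, the Dirac measure on 𝒫(X) concentrated at q* := δ_{x_o}; that is, in the limit only the fittest type x_o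 survives. -/
open MeasureTheory Filter Topology

/-- Neighbourhood base. -/
lemma nhds_base {X : Type*} [MeasurableSpace X] [MetricSpace X] [BorelSpace X]
    (ψ : X → ℝ) (h0 : ∀ x, 0 ≤ ψ x) (hc : Continuous ψ) (M : ℝ) (hM : ∀ x, ψ x ≤ M) (xo : X)
    (hA : ∀ ε : ℝ, 0 < ε → ∃ δ : ℝ, 0 < δ ∧ ∀ x : X, ψ x ≤ δ → x ∈ Metric.ball xo ε)
    (qstar : ProbabilityMeasure X) (hqstar : (qstar : Measure X) = Measure.dirac xo)
    (U : Set (ProbabilityMeasure X)) (hU : IsOpen U) (hq : qstar ∈ U) :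
    ∃ η : ℝ, 0 < η ∧ ∀ q : ProbabilityMeasure X, ∫ x, ψ x ∂(q : Measure X) < η → q ∈ U := by
  set F : ProbabilityMeasure X → ℝ := fun q => ∫ x, ψ x ∂(q : Measure X) with hF
  have hint : ∀ q : ProbabilityMeasure X, Integrable ψ (q : Measure X) := fun q =>
    Integrable.of_bound hc.aestronglyMeasurable M
      (Eventually.of_forall fun x => by rw [Real.norm_eq_abs, abs_of_nonneg (h0 x)]; exact hM x)
  have hF0 : ∀ q, 0 ≤ F q := fun q => integral_nonneg h0
  have key : Tendsto (fun q : ProbabilityMeasure X => q) (comap F (𝓝 0)) (𝓝 qstar) := by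
    rw [ProbabilityMeasure.tendsto_iff_forall_integral_tendsto]
    intro f
    rw [hqstar, integral_dirac, Metric.tendsto_nhds]
    intro ε hε
    obtain ⟨r, hr, hfr⟩ := Metric.continuous_iff.1 f.continuous xo (ε/2) (by positivity)
    obtain ⟨δ, hδ, hδA⟩ := hA r hr
    set K : ℝ := 2 * ‖f‖ / δ with hK
    have hK0 : 0 ≤ K := by positivity
    have hpt : ∀ x, |f x - f xo| ≤ ε/2 + K * ψ x := by
      intro x
      by_cases hx : ψ x ≤ δ
      · have := hfr x (hδA x hx)
        rw [Real.dist_eq] at this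
        have := mul_nonneg hK0 (h0 x)
        linarith
      · push Not at hx
        have h1 : |f x - f xo| ≤ 2 * ‖f‖ := by
          rw [← Real.dist_eq]; exact f.dist_le_two_norm x xo
        have h2 : 2 * ‖f‖ = K * δ := by rw [hK]; field_simp
        have := mul_le_mul_of_nonneg_left hx.le hK0
        linarith
    have hev : ∀ᶠ q in comap F (𝓝 0), F q < ε / (2 * (K + 1)) := by
      apply tendsto_comap.eventually (p := fun t => t < ε / (2 * (K + 1)))
      exact eventually_lt_nhds (by positivity)
    filter_upwards [hev] with q hq
    have hfi : Integrable (fun x => f x - f xo) (q : Measure X) :=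
      (f.integrable _).sub (integrable_const _)
    have e1 : ∫ x, f x ∂(q : Measure X) - f xo = ∫ x, (f x - f xo) ∂(q : Measure X) := by
      rw [integral_sub (f.integrable _) (integrable_const _)]; simp
    rw [Real.dist_eq, e1]
    calc |∫ x, (f x - f xo) ∂(q : Measure X)| ≤ ∫ x, |f x - f xo| ∂(q : Measure X) :=
          abs_integral_le_integral_abs
      _ ≤ ∫ x, (ε/2 + K * ψ x) ∂(q : Measure X) :=
          integral_mono hfi.abs ((integrable_const _).add ((hint q).const_mul K)) hpt
      _ = ε/2 + K * F q := by
          rw [integral_add (integrable_const _) ((hint q).const_mul K), integral_const_mul]; simp [hF]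
      _ < ε := by
          rw [lt_div_iff₀ (by positivity)] at hq
          have := hF0 q
          nlinarith
  have := key (hU.mem_nhds hq)
  rw [mem_map, mem_comap] at this
  obtain ⟨t, ht, htU⟩ := this
  obtain ⟨η, hη, hηt⟩ := Metric.mem_nhds_iff.1 ht
  refine ⟨η, hη, fun q hq => htU (hηt ?_)⟩
  simp only [Metric.mem_ball, Real.dist_eq, sub_zero]
  rw [abs_of_nonneg (hF0 q)]; exact hq

/-- Two-sided bounds. -/
lemma two_bounds {X : Type*} [MeasurableSpace X] [TopologicalSpace X] [BorelSpace X]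
    (φ : X → ℝ) (h0 : ∀ x, 0 ≤ φ x) (hc : Continuous φ) (M : ℝ) (hM : ∀ x, φ x ≤ M) (xo : X)
    (hmin : ∀ x, φ xo ≤ φ x) (a : ℝ) (ha : 1 ≤ a) (q : Measure X) [IsProbabilityMeasure q] :
    Real.exp (-(φ xo) / a) * Real.exp (-(∫ x, (φ x - φ xo) ∂q) / a) ≤
        ∫ x, Real.exp (-(φ x) / a) ∂q ∧
    ∫ x, Real.exp (-(φ x) / a) ∂q ≤
      Real.exp (-(φ xo) / a) * Real.exp (-((1 + M)⁻¹ * ∫ x, (φ x - φ xo) ∂q) / a) := by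
  have ha0 : 0 < a := by linarith
  have hM0 : 0 ≤ M := (h0 xo).trans (hM xo)
  have hint : Integrable (fun x => φ x - φ xo) q :=
    Integrable.of_bound (by fun_prop) M
      (Eventually.of_forall fun x => by
        rw [Real.norm_eq_abs, abs_of_nonneg (by linarith [hmin x])]; linarith [hM x, h0 xo])
  have hinte : Integrable (fun x => Real.exp (-(φ x - φ xo) / a)) q :=
    Integrable.of_bound (by fun_prop) 1
      (Eventually.of_forall fun x => by
        rw [Real.norm_eq_abs, abs_of_nonneg (Real.exp_pos _).le, Real.exp_le_one_iff]
        exact div_nonpos_of_nonpos_of_nonneg (by linarith [hmin x]) ha0.le)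
  have e : ∫ x, Real.exp (-(φ x) / a) ∂q =
      Real.exp (-(φ xo) / a) * ∫ x, Real.exp (-(φ x - φ xo) / a) ∂q := by
    rw [← integral_const_mul]
    congr 1; ext x; rw [← Real.exp_add]; congr 1; ring
  rw [e]
  set S := ∫ x, (φ x - φ xo) ∂q with hS
  constructor
  · refine mul_le_mul_of_nonneg_left ?_ (Real.exp_pos _).le
    have hpt : ∀ x, Real.exp (-S / a) * (1 + S / a) - Real.exp (-S / a) / a * (φ x - φ xo)
        ≤ Real.exp (-(φ x - φ xo) / a) := by
      intro x
      have h1 := Real.add_one_le_exp (-(φ x - φ xo) / a - (-S / a))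
      have h2 : Real.exp (-(φ x - φ xo) / a) =
        Real.exp (-S / a) * Real.exp (-(φ x - φ xo) / a - (-S / a)) := by
        rw [← Real.exp_add]; congr 1; ring
      rw [h2]
      refine le_trans (le_of_eq ?_) (mul_le_mul_of_nonneg_left h1 (Real.exp_pos _).le)
      ring
    have := integral_mono ((integrable_const _).sub (hint.const_mul _)) hinte hpt
    simp only [Pi.sub_apply] at this
    rw [integral_sub (integrable_const _) (hint.const_mul _), integral_const_mul, integral_const_mul, ← hS] at this
    simp only [integral_const, probReal_univ, one_smul] at this
    refine le_trans (le_of_eq ?_) this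
    ring
  · refine mul_le_mul_of_nonneg_left ?_ (Real.exp_pos _).le
    have hpt : ∀ x, Real.exp (-(φ x - φ xo) / a) ≤ 1 - (1 + M)⁻¹ / a * (φ x - φ xo) := by
      intro x
      set t := (φ x - φ xo) / a with ht
      have ht0 : 0 ≤ t := div_nonneg (by linarith [hmin x]) ha0.le
      have htM : t ≤ M := by
        rw [ht, div_le_iff₀ ha0]; nlinarith [hM x, h0 xo]
      have e1 : -(φ x - φ xo) / a = -t := by rw [ht]; ring
      have e2 : (1 + M)⁻¹ / a * (φ x - φ xo) = t / (1 + M) := by rw [ht]; field_simp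
      rw [e1, e2, Real.exp_neg]
      calc (Real.exp t)⁻¹ ≤ (1 + t)⁻¹ := by
            apply inv_anti₀ (by linarith); linarith [Real.add_one_le_exp t]
        _ ≤ 1 - t / (1 + M) := by
            have : 1 - t / (1 + M) - (1 + t)⁻¹ = t * (M - t) / ((1 + M) * (1 + t)) := by
              field_simp; ring
            have : 0 ≤ t * (M - t) / ((1 + M) * (1 + t)) :=
              div_nonneg (mul_nonneg ht0 (by linarith)) (by positivity)
            linarith
    have := integral_mono hinte ((integrable_const _).sub (hint.const_mul _)) hpt
    simp only [Pi.sub_apply] at this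
    rw [integral_sub (integrable_const _) (hint.const_mul _), integral_const_mul, ← hS] at this
    simp only [integral_const, probReal_univ, one_smul] at this
    refine this.trans ?_
    have := Real.add_one_le_exp (-((1 + M)⁻¹ * S) / a)
    refine le_trans (le_of_eq ?_) this
    ring

/-- **Theorem `thm12` (case `λ ∈ [0,1)`, convergence of the priors).**
`φ` is nonnegative, continuous, bounded, attains its infimum at `x₀` and satisfies
Assumption A (sublevel sets near the minimum shrink to `x₀`); `λ ∈ [0,1)`;
`π` is a prior on `𝒫(X)` whose support contains `δ_{x₀}`.  Then the re-weighted priors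
`π̄ₙ(E) = Zₙ⁻¹ ∫_E (∫ e^{−φ/n^λ} dq)ⁿ π(dq)` converge weakly to `δ_{q*}` with
`q* = δ_{x₀}`: only the fittest type survives in the limit. -/
theorem stmt_10
    {X : Type*} [MeasurableSpace X] [MetricSpace X] [PolishSpace X] [BorelSpace X]
    [MeasurableSpace (ProbabilityMeasure X)] [BorelSpace (ProbabilityMeasure X)]
    (φ : X → ℝ) (hφ0 : ∀ x, 0 ≤ φ x) (hφcont : Continuous φ) (hφbdd : ∃ M : ℝ, ∀ x, φ x ≤ M)
    (xo : X) (hxo_min : ∀ x, φ xo ≤ φ x)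
    (hA : ∀ ε : ℝ, 0 < ε → ∃ δ : ℝ, 0 < δ ∧
      ∀ x : X, φ x - φ xo ≤ δ → x ∈ Metric.ball xo ε)
    (lam : ℝ) (hlam0 : 0 ≤ lam) (hlam1 : lam < 1)
    (π : ProbabilityMeasure (ProbabilityMeasure X))
    (qstar : ProbabilityMeasure X) (hqstar : (qstar : Measure X) = Measure.dirac xo)
    (hsupp : ∀ U : Set (ProbabilityMeasure X), IsOpen U → qstar ∈ U →
      0 < (π : Measure (ProbabilityMeasure X)) U)
    (Zn : ℕ → ℝ)
    (hZn : ∀ n : ℕ, Zn n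
      = ∫ q, (∫ x, Real.exp (-(φ x) / (n : ℝ) ^ lam) ∂(q : Measure X)) ^ n
          ∂(π : Measure (ProbabilityMeasure X)))
    (πbarn : ℕ → ProbabilityMeasure (ProbabilityMeasure X))
    (hπbarn : ∀ (n : ℕ) (E : Set (ProbabilityMeasure X)), MeasurableSet E →
      ((πbarn n : Measure (ProbabilityMeasure X)) E).toReal
        = (Zn n)⁻¹ * ∫ q in E, (∫ x, Real.exp (-(φ x) / (n : ℝ) ^ lam) ∂(q : Measure X)) ^ n
            ∂(π : Measure (ProbabilityMeasure X))) :
    Tendsto πbarn atTop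
      (𝓝 (⟨Measure.dirac qstar, inferInstance⟩ : ProbabilityMeasure (ProbabilityMeasure X))) := by
  obtain ⟨M, hM⟩ := hφbdd
  have hM0 : 0 ≤ M := (hφ0 xo).trans (hM xo)
  set S : ProbabilityMeasure X → ℝ := fun q => ∫ x, (φ x - φ xo) ∂(q : Measure X) with hS
  have hScont : Continuous S := by
    let f : BoundedContinuousFunction X ℝ :=
      BoundedContinuousFunction.ofNormedAddCommGroup (fun x => φ x - φ xo) (by fun_prop) M
        (fun x => by
          rw [Real.norm_eq_abs, abs_of_nonneg (by linarith [hxo_min x])]; linarith [hM x, hφ0 xo])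
    exact ProbabilityMeasure.continuous_integral_boundedContinuousFunction f
  have hSq : S qstar = 0 := by simp [hS, hqstar]
  set I : ℕ → ProbabilityMeasure X → ℝ :=
    fun n q => ∫ x, Real.exp (-(φ x) / (n : ℝ) ^ lam) ∂(q : Measure X) with hI
  have hexp1 : ∀ (n : ℕ) (x : X), ‖Real.exp (-(φ x) / (n : ℝ) ^ lam)‖ ≤ 1 := by
    intro n x
    rw [Real.norm_eq_abs, abs_of_nonneg (Real.exp_pos _).le, Real.exp_le_one_iff]
    exact div_nonpos_of_nonpos_of_nonneg (by linarith [hφ0 x]) (by positivity)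
  have hIcont : ∀ n, Continuous (I n) := by
    intro n
    let f : BoundedContinuousFunction X ℝ :=
      BoundedContinuousFunction.ofNormedAddCommGroup
        (fun x => Real.exp (-(φ x) / (n : ℝ) ^ lam)) (by fun_prop) 1 (hexp1 n)
    exact ProbabilityMeasure.continuous_integral_boundedContinuousFunction f
  have hI0 : ∀ n q, 0 ≤ I n q := fun n q => integral_nonneg fun x => (Real.exp_pos _).le
  have hI1 : ∀ n q, I n q ≤ 1 := by
    intro n q
    have := norm_integral_le_of_norm_le_const (μ := (q : Measure X))
      (Eventually.of_forall (hexp1 n))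
    simp only [probReal_univ, mul_one] at this
    exact (le_abs_self _).trans this
  have hWint : ∀ n, Integrable (fun q => I n q ^ n) (π : Measure (ProbabilityMeasure X)) := by
    intro n
    refine Integrable.of_bound ((hIcont n).pow n).measurable.aestronglyMeasurable 1
      (Eventually.of_forall fun q => ?_)
    rw [Real.norm_eq_abs, abs_of_nonneg (pow_nonneg (hI0 n q) n)]
    exact pow_le_one₀ (hI0 n q) (hI1 n q)
  -- the complement of a neighbourhood has vanishing mass
  have main : ∀ G : Set (ProbabilityMeasure X), IsOpen G → qstar ∈ G →
      Tendsto (fun n => (πbarn n : Measure (ProbabilityMeasure X)).real Gᶜ) atTop (𝓝 0) := by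
    intro G hG hqG
    obtain ⟨η, hη, hηG⟩ := nhds_base (fun x => φ x - φ xo) (fun x => by linarith [hxo_min x])
      (by fun_prop) M (fun x => by linarith [hM x, hφ0 xo]) xo hA qstar hqstar G hG hqG
    set c : ℝ := (1 + M)⁻¹ * η / 2 with hc
    have hc0 : 0 < c := by positivity
    set V : Set (ProbabilityMeasure X) := {q | S q < c} with hV
    have hVo : IsOpen V := isOpen_lt hScont continuous_const
    have hVpos := hsupp V hVo (by simp [hV, hSq, hc0])
    set p : ℝ := (π : Measure (ProbabilityMeasure X)).real V with hp
    have hp0 : 0 < p := ENNReal.toReal_pos hVpos.ne' (measure_ne_top _ _)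
    have hbound : ∀ n : ℕ, 1 ≤ n → (πbarn n : Measure (ProbabilityMeasure X)).real Gᶜ
        ≤ Real.exp (-c * (n : ℝ) ^ (1 - lam)) / p := by
      intro n hn
      have hn1 : (1 : ℝ) ≤ n := by exact_mod_cast hn
      have ha : 1 ≤ (n : ℝ) ^ lam := Real.one_le_rpow hn1 hlam0
      set a : ℝ := (n : ℝ) ^ lam with haa
      have ha0 : 0 < a := by linarith
      set e : ℝ := Real.exp (-(φ xo) / a) ^ n with he
      have he0 : 0 < e := by positivity
      set r : ℝ := Real.exp (-c / a) ^ n with hr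
      have hr0 : 0 < r := by positivity
      have hrr : r = Real.exp (-c * (n : ℝ) ^ (1 - lam)) := by
        rw [hr, ← Real.exp_nat_mul, Real.rpow_sub (by linarith), Real.rpow_one, ← haa]
        congr 1; ring
      rw [← hrr]
      have hup : ∀ q ∈ Gᶜ, ‖I n q ^ n‖ ≤ e * r ^ 2 := by
        intro q hq
        have hSη : η ≤ S q := by
          by_contra h
          exact hq (hηG q (not_le.1 h))
        have h2 := (two_bounds φ hφ0 hφcont M hM xo hxo_min a ha (q : Measure X)).2
        rw [Real.norm_eq_abs, abs_of_nonneg (pow_nonneg (hI0 n q) n)]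
        have h3 : I n q ≤ Real.exp (-(φ xo) / a) * Real.exp (-c / a) ^ 2 := by
          refine h2.trans (mul_le_mul_of_nonneg_left ?_ (Real.exp_pos _).le)
          rw [← Real.exp_nat_mul, Real.exp_le_exp]
          have h4 : (1 + M)⁻¹ * η ≤ (1 + M)⁻¹ * S q :=
            mul_le_mul_of_nonneg_left hSη (by positivity)
          have h5 : ((2 : ℕ) : ℝ) * (-c / a) = -((1 + M)⁻¹ * η) / a := by
            rw [hc]; push_cast; ring
          rw [h5]
          exact div_le_div_of_nonneg_right (neg_le_neg h4) ha0.le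
        calc I n q ^ n ≤ (Real.exp (-(φ xo) / a) * Real.exp (-c / a) ^ 2) ^ n :=
              pow_le_pow_left₀ (hI0 n q) h3 n
          _ = e * r ^ 2 := by rw [he, hr, mul_pow, ← pow_mul, ← pow_mul, mul_comm 2 n]
      have hlow : ∀ q ∈ V, e * r ≤ I n q ^ n := by
        intro q hq
        have h2 := (two_bounds φ hφ0 hφcont M hM xo hxo_min a ha (q : Measure X)).1
        have h3 : Real.exp (-(φ xo) / a) * Real.exp (-c / a) ≤ I n q := by
          refine le_trans (mul_le_mul_of_nonneg_left ?_ (Real.exp_pos _).le) h2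
          rw [Real.exp_le_exp]
          exact div_le_div_of_nonneg_right (neg_le_neg (le_of_lt hq)) ha0.le
        rw [he, hr, ← mul_pow]
        exact pow_le_pow_left₀ (by positivity) h3 n
      have hZ : e * r * p ≤ Zn n := by
        rw [hZn n]
        calc e * r * p = ∫ q in V, e * r ∂(π : Measure (ProbabilityMeasure X)) := by
              rw [setIntegral_const, smul_eq_mul, mul_comm]
          _ ≤ ∫ q in V, I n q ^ n ∂(π : Measure (ProbabilityMeasure X)) :=
              setIntegral_mono_on (integrable_const _).integrableOn (hWint n).integrableOn
                hVo.measurableSet hlow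
          _ ≤ ∫ q, I n q ^ n ∂(π : Measure (ProbabilityMeasure X)) :=
              setIntegral_le_integral (hWint n)
                (Eventually.of_forall fun q => pow_nonneg (hI0 n q) n)
      have hE : ∫ q in Gᶜ, I n q ^ n ∂(π : Measure (ProbabilityMeasure X)) ≤ e * r ^ 2 := by
        have h1 := norm_setIntegral_le_of_norm_le_const
          (measure_lt_top (π : Measure (ProbabilityMeasure X)) Gᶜ) hup
        refine (le_abs_self _).trans (h1.trans ?_)
        exact mul_le_of_le_one_right (by positivity) measureReal_le_one
      have hZ0 : 0 < Zn n := lt_of_lt_of_le (by positivity) hZ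
      have hEq : (πbarn n : Measure (ProbabilityMeasure X)).real Gᶜ
          = (Zn n)⁻¹ * ∫ q in Gᶜ, I n q ^ n ∂(π : Measure (ProbabilityMeasure X)) :=
        hπbarn n Gᶜ hG.measurableSet.compl
      rw [hEq, inv_mul_le_iff₀ hZ0]
      calc _ ≤ e * r ^ 2 := hE
        _ = e * r * p * (r / p) := by field_simp
        _ ≤ Zn n * (r / p) := mul_le_mul_of_nonneg_right hZ (by positivity)
    have hlim : Tendsto (fun n : ℕ => Real.exp (-c * (n : ℝ) ^ (1 - lam)) / p) atTop (𝓝 0) := by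
      have h1 : Tendsto (fun n : ℕ => (n : ℝ) ^ (1 - lam)) atTop atTop :=
        (tendsto_rpow_atTop (by linarith)).comp tendsto_natCast_atTop_atTop
      have h2 := Real.tendsto_exp_atBot.comp (h1.const_mul_atTop_of_neg (neg_lt_zero.2 hc0))
      simpa using h2.div_const p
    refine squeeze_zero' (Eventually.of_forall fun n => measureReal_nonneg) ?_ hlim
    filter_upwards [eventually_ge_atTop 1] with n hn using hbound n hn
  refine tendsto_of_forall_isOpen_le_liminf_nat' fun G hG => ?_
  change (Measure.dirac qstar) G ≤ _
  rw [Measure.dirac_apply' _ hG.measurableSet]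
  by_cases hq : qstar ∈ G
  · have h1 : Tendsto (fun n => (πbarn n : Measure (ProbabilityMeasure X)) G) atTop (𝓝 1) := by
      have h2 : Tendsto (fun n => ENNReal.ofReal
          (1 - (πbarn n : Measure (ProbabilityMeasure X)).real Gᶜ)) atTop (𝓝 1) := by
        have := ENNReal.tendsto_ofReal ((main G hG hq).const_sub 1)
        simpa using this
      refine h2.congr fun n => ?_
      rw [probReal_compl_eq_one_sub hG.measurableSet, sub_sub_cancel, ofReal_measureReal]
    rw [h1.liminf_eq]
    simp [hq]
  · simp [hq]
end

section
/- Suppose ∫_X w̄/(w̄ − w(x)) ᾱ(dx) ≥ (1+c)/c, where the integrand is taken to be +∞ on {x : w(x) = w̄}. Then there exists exactly one θ ≥ w̄/(c+1) such that the function f(x) := c/(1 + c − w(x)/θ) is a probability density with respect to ᾱ (i.e. ∫_X f dᾱ = 1), and this unique θ satisfies θ = ∫_X w f dᾱ. -/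
open MeasureTheory Filter Topology

/-- **Lemma `lemma1b`.**
If `∫ w̄/(w̄ − w) dᾱ ≥ (1+c)/c` (the integrand being `+∞` where `w = w̄`, which is
captured by `ℝ≥0∞`-division), then there is exactly one `θ ≥ w̄/(c+1)` such that
`f(x) = c/(1 + c − w(x)/θ)` is a probability density w.r.t. `ᾱ`, and this unique `θ`
satisfies `θ = ∫ w f dᾱ`. -/
theorem stmt_11
    {X : Type*} [MeasurableSpace X] [TopologicalSpace X] [PolishSpace X] [BorelSpace X]
    (α : Measure X) [IsProbabilityMeasure α]
    (w : X → ℝ) (hw_pos : ∀ x, 0 < w x) (hw_cont : Continuous w)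
    (xo : X) (hxo : ∀ x, w x ≤ w xo)
    (c : ℝ) (hc : 0 < c)
    (hmarta : ENNReal.ofReal ((1 + c) / c)
      ≤ ∫⁻ x, ENNReal.ofReal (w xo) / ENNReal.ofReal (w xo - w x) ∂α) :
    (∃! θ : ℝ, w xo / (c + 1) ≤ θ ∧
      ∫⁻ x, ENNReal.ofReal c / ENNReal.ofReal (1 + c - w x / θ) ∂α = 1)
    ∧ (∀ θ : ℝ, w xo / (c + 1) ≤ θ →
        (∫⁻ x, ENNReal.ofReal c / ENNReal.ofReal (1 + c - w x / θ) ∂α = 1) →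
        θ = ∫ x, w x * (c / (1 + c - w x / θ)) ∂α) := by
  have hM : 0 < w xo := hw_pos xo
  have h0 : 0 < w xo / (c + 1) := by positivity
  have hmeas : ∀ θ : ℝ, Measurable
      (fun x => ENNReal.ofReal c / ENNReal.ofReal (1 + c - w x / θ)) := by
    intro θ
    have := hw_cont.measurable
    fun_prop
  have hD : ∀ θ : ℝ, w xo / (c + 1) ≤ θ → ∀ x, 0 ≤ 1 + c - w x / θ := by
    intro θ hθ x
    have hp : 0 < θ := h0.trans_le hθ
    rw [div_le_iff₀ (by positivity)] at hθ
    have : w x / θ ≤ 1 + c := by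
      rw [div_le_iff₀ hp]
      linarith [hxo x]
    linarith
  have hc0 : ENNReal.ofReal c ≠ 0 := by simpa using hc
  have hlt : ∀ θ₁ θ₂ : ℝ, w xo / (c + 1) ≤ θ₁ → θ₁ < θ₂ → ∀ x,
      ENNReal.ofReal (1 + c - w x / θ₁) < ENNReal.ofReal (1 + c - w x / θ₂) := by
    intro a b ha hab x
    have hp : 0 < a := h0.trans_le ha
    have h1 : w x / b < w x / a := div_lt_div_of_pos_left (hw_pos x) hp hab
    have h2 := hD a ha x
    rw [ENNReal.ofReal_lt_ofReal_iff (by linarith)]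
    linarith
  have hcont : ∀ x, ∀ θ : ℝ, 0 < θ → ContinuousAt
      (fun θ => ENNReal.ofReal c / ENNReal.ofReal (1 + c - w x / θ)) θ := by
    intro x θ hθ
    have h1 : ContinuousAt (fun θ : ℝ => 1 + c - w x / θ) θ :=
      continuousAt_const.sub (continuousAt_const.div continuousAt_id hθ.ne')
    exact ENNReal.Tendsto.const_div
      ((ENNReal.continuous_ofReal.continuousAt).comp h1) (Or.inr ENNReal.ofReal_ne_top)
  have huniq : ∀ θ₁ θ₂ : ℝ, w xo / (c + 1) ≤ θ₁ → θ₁ < θ₂ →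
      ∫⁻ x, ENNReal.ofReal c / ENNReal.ofReal (1 + c - w x / θ₁) ∂α = 1 →
      ∫⁻ x, ENNReal.ofReal c / ENNReal.ofReal (1 + c - w x / θ₂) ∂α = 1 → False := by
    intro a b ha hab h1 h2
    have : ∫⁻ x, ENNReal.ofReal c / ENNReal.ofReal (1 + c - w x / b) ∂α
        < ∫⁻ x, ENNReal.ofReal c / ENNReal.ofReal (1 + c - w x / a) ∂α := by
      apply lintegral_strict_mono (IsProbabilityMeasure.ne_zero α) (hmeas a).aemeasurable
      · rw [h2]; simp
      · refine Eventually.of_forall fun x => ?_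
        have := hlt a b ha hab x
        rw [ENNReal.div_eq_inv_mul, ENNReal.div_eq_inv_mul]
        exact ENNReal.mul_lt_mul_left hc0 ENNReal.ofReal_ne_top
          (ENNReal.inv_lt_inv.2 this)
    rw [h1, h2] at this
    exact lt_irrefl _ this
  have hG0 : 1 ≤ ∫⁻ x, ENNReal.ofReal c / ENNReal.ofReal (1 + c - w x / (w xo / (c + 1))) ∂α := by
    have e : ∀ x, ENNReal.ofReal c / ENNReal.ofReal (1 + c - w x / (w xo / (c + 1)))
        = ENNReal.ofReal (c / (1 + c)) *
          (ENNReal.ofReal (w xo) / ENNReal.ofReal (w xo - w x)) := by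
      intro x
      have e1 : 1 + c - w x / (w xo / (c + 1)) = (w xo - w x) * ((1 + c) / w xo) := by
        field_simp
        ring
      rw [e1]
      rcases (hxo x).eq_or_lt with h | h
      · rw [h]
        simp only [sub_self, zero_mul, ENNReal.ofReal_zero]
        rw [ENNReal.div_zero hc0, ENNReal.div_zero (by simpa using hM), ENNReal.mul_top]
        simp only [ne_eq, ENNReal.ofReal_eq_zero, not_le]
        positivity
      · have h' : 0 < w xo - w x := sub_pos.2 h
        rw [← ENNReal.ofReal_div_of_pos (by positivity), ← ENNReal.ofReal_div_of_pos h',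
          ← ENNReal.ofReal_mul (by positivity)]
        congr 1
        field_simp
    simp_rw [e]
    rw [lintegral_const_mul' _ _ ENNReal.ofReal_ne_top]
    calc (1 : ENNReal) = ENNReal.ofReal (c / (1 + c)) * ENNReal.ofReal ((1 + c) / c) := by
          rw [← ENNReal.ofReal_mul (by positivity)]
          have : c / (1 + c) * ((1 + c) / c) = 1 := by field_simp
          rw [this]; simp
      _ ≤ _ := by gcongr
  have hGM : ∫⁻ x, ENNReal.ofReal c / ENNReal.ofReal (1 + c - w x / w xo) ∂α ≤ 1 := by
    calc _ ≤ ∫⁻ x, 1 ∂α := by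
          apply lintegral_mono
          intro x
          apply ENNReal.div_le_of_le_mul
          rw [one_mul]
          apply ENNReal.ofReal_le_ofReal
          have : w x / w xo ≤ 1 := (div_le_one hM).2 (hxo x)
          linarith
      _ = 1 := by simp
  have h0M : w xo / (c + 1) ≤ w xo := div_le_self hM.le (by linarith)
  refine ⟨?_, ?_⟩
  · apply existsUnique_of_exists_of_unique
    · rcases hG0.eq_or_lt with h | h
      · exact ⟨_, le_rfl, h.symm⟩
      -- find a point to the right with integral > 1
      obtain ⟨a, ha0, haM, ha⟩ : ∃ a, w xo / (c + 1) < a ∧ a ≤ w xo ∧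
          1 ≤ ∫⁻ x, ENNReal.ofReal c / ENNReal.ofReal (1 + c - w x / a) ∂α := by
        by_contra! hcon
        have hlt0 : w xo / (c + 1) < w xo := div_lt_self hM (by linarith)
        obtain ⟨u, -, hu, hu'⟩ := exists_seq_strictAnti_tendsto' hlt0
        have hf := lintegral_liminf_le (μ := α) (u := atTop) (fun n => hmeas (u n))
        have hl : ∀ x, liminf (fun n => ENNReal.ofReal c / ENNReal.ofReal (1 + c - w x / u n)) atTop
            = ENNReal.ofReal c / ENNReal.ofReal (1 + c - w x / (w xo / (c + 1))) := fun x =>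
          ((hcont x _ h0).tendsto.comp hu').liminf_eq
        simp_rw [hl] at hf
        have h2 : liminf (fun n => ∫⁻ x, ENNReal.ofReal c /
            ENNReal.ofReal (1 + c - w x / u n) ∂α) atTop ≤ liminf (fun _ : ℕ => (1 : ENNReal)) atTop :=
          liminf_le_liminf (Eventually.of_forall fun n =>
            (hcon (u n) (hu n).1 (hu n).2.le).le)
        rw [liminf_const] at h2
        exact absurd (hf.trans h2) (not_le.2 h)
      have hap : 0 < a := h0.trans ha0
      have hda : 0 < 1 + c - w xo / a := by
        have : w xo / a < 1 + c := by
          rw [div_lt_iff₀ hap]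
          rw [div_lt_iff₀ (by positivity)] at ha0
          linarith
        linarith
      have hco : ContinuousOn (fun θ : ℝ =>
          ∫⁻ x, ENNReal.ofReal c / ENNReal.ofReal (1 + c - w x / θ) ∂α) (Set.Icc a (w xo)) := by
        intro t ht
        refine tendsto_lintegral_filter_of_dominated_convergence
          (fun _ => ENNReal.ofReal c / ENNReal.ofReal (1 + c - w xo / a))
          (Eventually.of_forall fun θ => hmeas θ) ?_ ?_ ?_
        · filter_upwards [self_mem_nhdsWithin] with θ hθ
          refine Eventually.of_forall fun x => ?_
          apply ENNReal.div_le_div_left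
          apply ENNReal.ofReal_le_ofReal
          have : w x / θ ≤ w xo / a := div_le_div₀ hM.le (hxo x) hap hθ.1
          linarith
        · simp only [lintegral_const, measure_univ, mul_one]
          exact ENNReal.div_ne_top ENNReal.ofReal_ne_top (by simpa using hda)
        · exact Eventually.of_forall fun x =>
            (hcont x t (hap.trans_le ht.1)).continuousWithinAt
      obtain ⟨t, ht, ht'⟩ := intermediate_value_Icc' haM hco ⟨hGM, ha⟩
      exact ⟨t, ha0.le.trans ht.1, ht'⟩
    · rintro a b ⟨ha, ha'⟩ ⟨hb, hb'⟩
      rcases lt_trichotomy a b with h | h | h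
      · exact (huniq a b ha h ha' hb').elim
      · exact h
      · exact (huniq b a hb h hb' ha').elim
  · intro θ hθ h1
    have hp : 0 < θ := h0.trans_le hθ
    have hfin : ∀ᵐ x ∂α, ENNReal.ofReal c / ENNReal.ofReal (1 + c - w x / θ) < ⊤ :=
      ae_lt_top (hmeas θ) (by rw [h1]; simp)
    have hint := integrable_toReal_of_lintegral_ne_top (hmeas θ).aemeasurable
      (show ∫⁻ x, ENNReal.ofReal c / ENNReal.ofReal (1 + c - w x / θ) ∂α ≠ ⊤ by rw [h1]; simp)
    have hI := integral_toReal (hmeas θ).aemeasurable hfin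
    rw [h1] at hI
    have hr : ∀ x, (ENNReal.ofReal c / ENNReal.ofReal (1 + c - w x / θ)).toReal
        = c / (1 + c - w x / θ) := fun x => by
      rw [ENNReal.toReal_div, ENNReal.toReal_ofReal hc.le, ENNReal.toReal_ofReal (hD θ hθ x)]
    simp_rw [hr] at hI hint
    have hae : ∀ᵐ x ∂α, w x * (c / (1 + c - w x / θ))
        = θ * (1 + c) * (c / (1 + c - w x / θ)) - θ * c := by
      filter_upwards [hfin] with x hx
      have hne : 1 + c - w x / θ ≠ 0 := by
        intro h
        rw [h, ENNReal.ofReal_zero, ENNReal.div_zero hc0] at hx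
        exact lt_irrefl _ hx
      have e : w x = θ * ((1 + c) - (1 + c - w x / θ)) := by field_simp; ring
      generalize 1 + c - w x / θ = d at *
      rw [e]
      field_simp
    rw [integral_congr_ae hae, integral_sub (hint.const_mul _) (integrable_const _),
      integral_const_mul, hI]
    simp
    ring
end

section
/- Suppose ∫_X 1/(φ(x) − φ_o) ᾱ(dx) ≥ 1/c, where the integrand is taken to be +∞ on {x : φ(x) = φ_o}. Then there exists exactly one θ ∈ [φ_o, φ_o + c] such that the function f(x) := c/(φ(x) + c − θ) is a probability density with respect to ᾱ (i.e. ∫_X f dᾱ = 1), and this θ satisfies θ = ∫_X φ f dᾱ. -/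
open MeasureTheory Filter Topology

/-- **Lemma `lemma1bb`.**
If `∫ 1/(φ − φ₀) dᾱ ≥ 1/c` (the integrand being `+∞` where `φ = φ₀`, captured by
`ℝ≥0∞`-division), then there is exactly one `θ ∈ [φ₀, φ₀ + c]` such that
`f(x) = c/(φ(x) + c − θ)` is a probability density w.r.t. `ᾱ`, and this `θ`
satisfies `θ = ∫ φ f dᾱ`. -/
theorem stmt_12
    {X : Type*} [MeasurableSpace X] [TopologicalSpace X] [PolishSpace X] [BorelSpace X]
    [Nonempty X]
    (α : Measure X) [IsProbabilityMeasure α]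
    (φ : X → ℝ) (hφmeas : Measurable φ) (hφ0 : ∀ x, 0 ≤ φ x) (hφbdd : ∃ M : ℝ, ∀ x, φ x ≤ M)
    (φo : ℝ) (hφo : φo = ⨅ x, φ x)
    (c : ℝ) (hc : 0 < c)
    (hmarta2 : ENNReal.ofReal (1 / c)
      ≤ ∫⁻ x, 1 / ENNReal.ofReal (φ x - φo) ∂α) :
    (∃! θ : ℝ, θ ∈ Set.Icc φo (φo + c) ∧
      ∫⁻ x, ENNReal.ofReal c / ENNReal.ofReal (φ x + c - θ) ∂α = 1)
    ∧ (∀ θ : ℝ, θ ∈ Set.Icc φo (φo + c) →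
        (∫⁻ x, ENNReal.ofReal c / ENNReal.ofReal (φ x + c - θ) ∂α = 1) →
        θ = ∫ x, φ x * (c / (φ x + c - θ)) ∂α) := by
  have hbb : BddBelow (Set.range φ) := ⟨0, by rintro _ ⟨x, rfl⟩; exact hφ0 x⟩
  have hle : ∀ x, φo ≤ φ x := fun x => by rw [hφo]; exact ciInf_le hbb x
  clear hφo hbb
  have hc0 : ENNReal.ofReal c ≠ 0 := by simpa using hc
  have hct : ENNReal.ofReal c ≠ ⊤ := ENNReal.ofReal_ne_top
  have hmeas : ∀ θ : ℝ, Measurable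
      (fun x => ENNReal.ofReal c / ENNReal.ofReal (φ x + c - θ)) := fun θ => by fun_prop
  have hmono : ∀ θ₁ θ₂ : ℝ, θ₁ ≤ θ₂ → ∀ x,
      ENNReal.ofReal c / ENNReal.ofReal (φ x + c - θ₁)
        ≤ ENNReal.ofReal c / ENNReal.ofReal (φ x + c - θ₂) := by
    intro θ₁ θ₂ h x
    apply ENNReal.div_le_div_left
    apply ENNReal.ofReal_le_ofReal
    linarith
  have hcont : ∀ x, Continuous
      (fun θ : ℝ => ENNReal.ofReal c / ENNReal.ofReal (φ x + c - θ)) := by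
    intro x
    simp only [div_eq_mul_inv]
    apply (ENNReal.continuous_const_mul hct).comp
    exact continuous_inv.comp (ENNReal.continuous_ofReal.comp (by fun_prop))
  have huniq : ∀ θ₁ θ₂ : ℝ, θ₁ < θ₂ → θ₂ ≤ φo + c →
      ∫⁻ x, ENNReal.ofReal c / ENNReal.ofReal (φ x + c - θ₁) ∂α = 1 →
      ∫⁻ x, ENNReal.ofReal c / ENNReal.ofReal (φ x + c - θ₂) ∂α = 1 → False := by
    intro θ₁ θ₂ hlt h2 e1 e2
    have hae := ae_eq_of_ae_le_of_lintegral_le (μ := α)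
      (Eventually.of_forall (hmono θ₁ θ₂ hlt.le)) (by rw [e1]; simp)
      (hmeas θ₂).aemeasurable (by rw [e1, e2])
    obtain ⟨x, hx⟩ := hae.exists
    have hx0 := hle x
    have hpos : 0 < φ x + c - θ₁ := by linarith
    have h3 : ENNReal.ofReal (φ x + c - θ₂) < ENNReal.ofReal (φ x + c - θ₁) :=
      (ENNReal.ofReal_lt_ofReal_iff hpos).2 (by linarith)
    have h4 : ENNReal.ofReal c / ENNReal.ofReal (φ x + c - θ₁)
        < ENNReal.ofReal c / ENNReal.ofReal (φ x + c - θ₂) := by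
      rw [div_eq_mul_inv, div_eq_mul_inv]
      exact (ENNReal.mul_lt_mul_iff_right hc0 hct).2 (ENNReal.inv_lt_inv.2 h3)
    exact h4.ne hx
  have hstart : ∫⁻ x, ENNReal.ofReal c / ENNReal.ofReal (φ x + c - φo) ∂α ≤ 1 := by
    calc _ ≤ ∫⁻ x, 1 ∂α := by
          apply lintegral_mono
          intro x
          apply ENNReal.div_le_of_le_mul
          rw [one_mul]
          apply ENNReal.ofReal_le_ofReal
          have := hle x
          linarith
      _ = 1 := by simp
  have hend : 1 ≤ ∫⁻ x, ENNReal.ofReal c / ENNReal.ofReal (φ x + c - (φo + c)) ∂α := by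
    have h1 : ∀ x, ENNReal.ofReal c / ENNReal.ofReal (φ x + c - (φo + c))
        = ENNReal.ofReal c * (1 / ENNReal.ofReal (φ x - φo)) := by
      intro x
      rw [show φ x + c - (φo + c) = φ x - φo by ring, div_eq_mul_inv, one_div]
    simp_rw [h1]
    rw [lintegral_const_mul _ (by fun_prop)]
    calc (1 : ENNReal) = ENNReal.ofReal c * ENNReal.ofReal (1 / c) := by
          rw [← ENNReal.ofReal_mul hc.le, mul_one_div_cancel hc.ne', ENNReal.ofReal_one]
      _ ≤ _ := by gcongr
  have hIVT : ∀ θ₁ : ℝ, φo ≤ θ₁ → θ₁ < φo + c →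
      1 ≤ ∫⁻ x, ENNReal.ofReal c / ENNReal.ofReal (φ x + c - θ₁) ∂α →
      ∃ θ ∈ Set.Icc φo θ₁,
        ∫⁻ x, ENNReal.ofReal c / ENNReal.ofReal (φ x + c - θ) ∂α = 1 := by
    intro θ₁ h0 h1 h2
    have hF : ContinuousOn
        (fun θ : ℝ => ∫⁻ x, ENNReal.ofReal c / ENNReal.ofReal (φ x + c - θ) ∂α)
        (Set.Icc φo θ₁) := by
      intro θ hθ
      refine tendsto_lintegral_filter_of_dominated_convergence
        (fun _ => ENNReal.ofReal c / ENNReal.ofReal (φo + c - θ₁)) ?_ ?_ ?_ ?_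
      · exact Eventually.of_forall hmeas
      · filter_upwards [self_mem_nhdsWithin] with t ht
        refine Eventually.of_forall fun x => ?_
        apply ENNReal.div_le_div_left
        apply ENNReal.ofReal_le_ofReal
        have := hle x
        have := ht.2
        linarith
      · rw [lintegral_const, measure_univ, mul_one]
        apply ENNReal.div_ne_top hct
        simpa using h1
      · exact Eventually.of_forall fun x => (hcont x).continuousWithinAt
    obtain ⟨θ, hθ, e⟩ := intermediate_value_Icc h0 hF ⟨hstart, h2⟩
    exact ⟨θ, hθ, e⟩
  have hex : ∃ θ ∈ Set.Icc φo (φo + c),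
      ∫⁻ x, ENNReal.ofReal c / ENNReal.ofReal (φ x + c - θ) ∂α = 1 := by
    rcases hend.eq_or_lt with h | h
    · exact ⟨φo + c, ⟨by linarith, le_rfl⟩, h.symm⟩
    · have ht0 : Tendsto (fun n : ℕ => φo + c - c * (1 / ((n : ℝ) + 1))) atTop
          (𝓝 (φo + c)) := by
        have := (tendsto_one_div_add_atTop_nhds_zero_nat (𝕜 := ℝ)).const_mul c
        simpa using this.const_sub (φo + c)
      have ht := lintegral_tendsto_of_tendsto_of_monotone (μ := α)
        (f := fun (n : ℕ) x => ENNReal.ofReal c /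
          ENNReal.ofReal (φ x + c - (φo + c - c * (1 / ((n : ℝ) + 1)))))
        (F := fun x => ENNReal.ofReal c / ENNReal.ofReal (φ x + c - (φo + c)))
        (fun n => (hmeas _).aemeasurable)
        (Eventually.of_forall fun x n m hnm => hmono _ _ (by gcongr) x)
        (Eventually.of_forall fun x => ((hcont x).tendsto _).comp ht0)
      obtain ⟨n, hn⟩ := (ht.eventually (lt_mem_nhds h)).exists
      have hn0 : (0 : ℝ) < 1 / ((n : ℝ) + 1) := by positivity
      have hn1 : 1 / ((n : ℝ) + 1) ≤ 1 := by
        rw [div_le_one (by positivity)]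
        have : (0 : ℝ) ≤ n := by positivity
        linarith
      obtain ⟨θ, hθ, e⟩ := hIVT (φo + c - c * (1 / ((n : ℝ) + 1)))
        (by nlinarith) (by nlinarith) hn.le
      exact ⟨θ, ⟨hθ.1, hθ.2.trans (by nlinarith)⟩, e⟩
  refine ⟨?_, ?_⟩
  · obtain ⟨θ, hθ, e⟩ := hex
    refine ⟨θ, ⟨hθ, e⟩, ?_⟩
    rintro t ⟨ht, et⟩
    rcases lt_trichotomy t θ with h | h | h
    · exact (huniq t θ h hθ.2 et e).elim
    · exact h
    · exact (huniq θ t h ht.2 e et).elim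
  · intro θ hθ e
    have hpos : ∀ᵐ x ∂α, 0 < φ x + c - θ := by
      filter_upwards [ae_lt_top (hmeas θ) (by rw [e]; simp)] with x hx
      by_contra hneg
      rw [ENNReal.ofReal_of_nonpos (not_lt.1 hneg), ENNReal.div_zero hc0] at hx
      exact lt_irrefl _ hx
    have hfm : Measurable (fun x => c / (φ x + c - θ)) := by fun_prop
    have hnn : 0 ≤ᵐ[α] fun x => c / (φ x + c - θ) := by
      filter_upwards [hpos] with x hx
      exact (div_pos hc hx).le
    have hl : ∫⁻ x, ENNReal.ofReal (c / (φ x + c - θ)) ∂α = 1 := by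
      rw [← e]
      apply lintegral_congr_ae
      filter_upwards [hpos] with x hx
      exact ENNReal.ofReal_div_of_pos hx
    have hint : Integrable (fun x => c / (φ x + c - θ)) α := by
      refine ⟨hfm.aestronglyMeasurable, ?_⟩
      rw [hasFiniteIntegral_iff_ofReal hnn, hl]
      simp
    have hI : ∫ x, c / (φ x + c - θ) ∂α = 1 := by
      rw [integral_eq_lintegral_of_nonneg_ae hnn hfm.aestronglyMeasurable, hl]
      simp
    have hcg : ∫ x, φ x * (c / (φ x + c - θ)) ∂α
        = ∫ x, (c - (c - θ) * (c / (φ x + c - θ))) ∂α := by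
      apply integral_congr_ae
      filter_upwards [hpos] with x hx
      have := hx.ne'
      field_simp
      ring
    rw [hcg, integral_sub (integrable_const c) (hint.const_mul _), integral_const_mul, hI]
    simp
end

section
/- For every real x > 0 and every α ∈ [0,1] it holds that (1+x)·(1+1/x)^x·α^x·(1−α) ≤ 1; moreover, for each α ∈ (0,1), equality is attained at x = α/(1−α), so that the maximum of (1+x)(1+1/x)^x α^x (1−α) over x ≥ 0 and α ∈ [0,1] equals 1. -/
/-- **Proposition `append`.**
For every real `x > 0` and `α ∈ [0,1]`, `(1+x)(1+1/x)^x α^x (1−α) ≤ 1`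
(real powers), and for each `α ∈ (0,1)` equality is attained at `x = α/(1−α)`;
hence the maximum over `x ≥ 0`, `α ∈ [0,1]` equals `1`. -/
theorem stmt_13 :
    (∀ x : ℝ, 0 < x → ∀ α : ℝ, 0 ≤ α → α ≤ 1 →
      (1 + x) * (1 + 1 / x) ^ x * α ^ x * (1 - α) ≤ 1)
    ∧ (∀ α : ℝ, 0 < α → α < 1 →
      (1 + α / (1 - α)) * (1 + 1 / (α / (1 - α))) ^ (α / (1 - α))
          * α ^ (α / (1 - α)) * (1 - α) = 1) := by
  constructor
  · intro x hx α h0 h1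
    have hu : 0 ≤ (1 + 1 / x) * α := by positivity
    have hv : 0 ≤ (1 + x) * (1 - α) := mul_nonneg (by positivity) (by linarith)
    have e1 : (1 + 1 / x) * α ≤ Real.exp ((1 + 1 / x) * α - 1) := by
      have := Real.add_one_le_exp ((1 + 1 / x) * α - 1)
      linarith
    have e2 : (1 + x) * (1 - α) ≤ Real.exp ((1 + x) * (1 - α) - 1) := by
      have := Real.add_one_le_exp ((1 + x) * (1 - α) - 1)
      linarith
    have e3 : ((1 + 1 / x) * α) ^ x ≤ Real.exp (((1 + 1 / x) * α - 1) * x) := by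
      rw [Real.exp_mul]
      exact Real.rpow_le_rpow hu e1 hx.le
    calc (1 + x) * (1 + 1 / x) ^ x * α ^ x * (1 - α)
        = ((1 + 1 / x) * α) ^ x * ((1 + x) * (1 - α)) := by
          rw [Real.mul_rpow (by positivity) h0]; ring
      _ ≤ Real.exp (((1 + 1 / x) * α - 1) * x) * Real.exp ((1 + x) * (1 - α) - 1) :=
          mul_le_mul e3 e2 hv (Real.exp_pos _).le
      _ = 1 := by
          rw [← Real.exp_add, Real.exp_eq_one_iff]
          field_simp
          ring
  · intro α h0 h1
    have hb : 0 < 1 - α := by linarith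
    have e1 : 1 + 1 / (α / (1 - α)) = α⁻¹ := by
      field_simp
      ring
    have e2 : (1 + α / (1 - α)) * (1 - α) = 1 := by
      field_simp
      ring
    have e3 : (α⁻¹) ^ (α / (1 - α)) * α ^ (α / (1 - α)) = 1 := by
      rw [← Real.mul_rpow (by positivity) h0.le, inv_mul_cancel₀ h0.ne', Real.one_rpow]
    rw [e1]
    calc _ = ((1 + α / (1 - α)) * (1 - α)) * ((α⁻¹) ^ (α / (1 - α)) * α ^ (α / (1 - α))) := by ring
      _ = 1 := by rw [e2, e3, one_mul]
end

section
/- Assume ∫_X w̄/(w̄ − w(x)) ᾱ(dx) ≥ (1+c)/c (with the integrand +∞ where w = w̄), and let θ ≥ w̄/(c+1) be such that f(x) := c/(1 + c − w(x)/θ) is a probability density with respect to ᾱ. Then for every Borel probability measure q on X with ᾱ ≪ q but q not absolutely continuous with respect to ᾱ (i.e. q ∈ 𝒫_1 \ 𝒫_0), it holds that ln(∫_X w dq) − c·D(ᾱ‖q) < ln θ + c ∫_X ln f dᾱ. -/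
open MeasureTheory Filter Topology
open scoped ENNReal Classical

/-- The (possibly `−∞`-valued) integral `∫ log g dμ`, as an extended real number:
the positive part minus the negative part (each computed as a lower integral). -/
noncomputable def intLog {X : Type*} [MeasurableSpace X] (μ : Measure X) (g : X → ℝ) : EReal :=
  ((∫⁻ x, ENNReal.ofReal (Real.log (g x)) ∂μ : ℝ≥0∞) : EReal)
    - ((∫⁻ x, ENNReal.ofReal (-Real.log (g x)) ∂μ : ℝ≥0∞) : EReal)

/-- The relative entropy `D(p‖q) = ∫ ln(dp/dq) dp` if `p ≪ q`, and `+∞` otherwise,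
as an extended real number. -/
noncomputable def relEnt {X : Type*} [MeasurableSpace X] (p q : Measure X) : EReal :=
  if p ≪ q then intLog p (fun x => (p.rnDeriv q x).toReal) else ⊤

/-- **Lemma `lemma3` (inequality \eqref{marta} holds, `q ∈ 𝒫₁ \ 𝒫₀`).**
Under `∫ w̄/(w̄ − w) dᾱ ≥ (1+c)/c`, with `θ ≥ w̄/(c+1)` such that
`f = c/(1 + c − w/θ)` is a probability density w.r.t. `ᾱ`, every Borel probability
measure `q` with `ᾱ ≪ q` but `¬(q ≪ ᾱ)` satisfies
`ln(∫ w dq) − c·D(ᾱ‖q) < ln θ + c ∫ ln f dᾱ`. -/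
theorem stmt_16
    {X : Type*} [MeasurableSpace X] [TopologicalSpace X] [PolishSpace X] [BorelSpace X]
    (α : Measure X) [IsProbabilityMeasure α]
    (w : X → ℝ) (hw_pos : ∀ x, 0 < w x) (hw_cont : Continuous w)
    (xo : X) (hxo : ∀ x, w x ≤ w xo)
    (c : ℝ) (hc : 0 < c)
    (hmarta : ENNReal.ofReal ((1 + c) / c)
      ≤ ∫⁻ x, ENNReal.ofReal (w xo) / ENNReal.ofReal (w xo - w x) ∂α)
    (θ : ℝ) (hθ : w xo / (c + 1) ≤ θ)
    (f : X → ℝ) (hf : f = fun x => c / (1 + c - w x / θ))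
    (hfdens : ∫⁻ x, ENNReal.ofReal c / ENNReal.ofReal (1 + c - w x / θ) ∂α = 1)
    (hθeq : θ = ∫ x, w x * f x ∂α)
    (q : Measure X) [IsProbabilityMeasure q]
    (hα_ac_q : α ≪ q) (hq_not_ac : ¬ q ≪ α) :
    ((Real.log (∫ x, w x ∂q) : ℝ) : EReal) - (c : EReal) * relEnt α q
      < (((Real.log θ + c * ∫ x, Real.log (f x) ∂α : ℝ)) : EReal) := by
  have hwo := hw_pos xo
  have hθ0 : 0 < θ := lt_of_lt_of_le (by positivity) hθ
  set h : X → ℝ := fun x => 1 + c - w x / θ with hh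
  have hh0 : ∀ x, 0 ≤ h x := by
    intro x
    have h1 : w xo ≤ θ * (c + 1) := (div_le_iff₀ (by positivity)).1 hθ
    have h2 : w x / θ ≤ c + 1 := (div_le_iff₀ hθ0).2 (by linarith [hxo x])
    simp only [hh]; linarith
  have hwm : Measurable w := hw_cont.measurable
  have hhm : Measurable h := by simp only [hh]; fun_prop
  have hhle : ∀ x, h x ≤ 1 + c := by
    intro x
    have := div_pos (hw_pos x) hθ0
    simp only [hh]; linarith
  have hfx : ∀ x, f x = c / h x := by intro x; rw [hf]
  have hfm : Measurable f := by
    have : f = fun x => c / h x := funext hfx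
    rw [this]; fun_prop
  have hpos : ∀ᵐ x ∂α, 0 < h x := by
    have h1 : ∀ᵐ x ∂α, ENNReal.ofReal c / ENNReal.ofReal (h x) < ⊤ := by
      apply ae_lt_top
      · fun_prop
      · rw [hfdens]; simp
    filter_upwards [h1] with x hx
    by_contra hcon
    have h2 : ENNReal.ofReal (h x) = 0 := ENNReal.ofReal_of_nonpos (not_lt.1 hcon)
    rw [h2, ENNReal.div_zero (by simpa using hc)] at hx
    exact lt_irrefl _ hx
  have hflin : ∫⁻ x, ENNReal.ofReal (f x) ∂α = 1 := by
    rw [← hfdens]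
    apply lintegral_congr_ae
    filter_upwards [hpos] with x hx
    rw [hfx, ENNReal.ofReal_div_of_pos hx]
  have hfnn : ∀ x, 0 ≤ f x := fun x => by rw [hfx]; exact div_nonneg hc.le (hh0 x)
  have hfint : Integrable f α := by
    refine ⟨hfm.aestronglyMeasurable, ?_⟩
    rw [hasFiniteIntegral_iff_ofReal (Eventually.of_forall hfnn), hflin]; simp
  have hf1 : ∫ x, f x ∂α = 1 := by
    rw [integral_eq_lintegral_of_nonneg_ae (Eventually.of_forall hfnn)
      hfm.aestronglyMeasurable, hflin]; simp
  have hlogf : Integrable (fun x => Real.log (f x)) α := by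
    refine Integrable.mono' (hfint.add (integrable_const |Real.log (c / (1 + c))|))
      (Real.measurable_log.comp hfm).aestronglyMeasurable ?_
    filter_upwards [hpos] with x hx
    have hfp : 0 < f x := by rw [hfx]; positivity
    have h1 : c / (1 + c) ≤ f x := by
      rw [hfx]; exact div_le_div_of_nonneg_left hc.le hx (hhle x)
    have h2 := Real.log_le_log (by positivity) h1
    have h3 := Real.log_le_sub_one_of_pos hfp
    have h4 := neg_abs_le (Real.log (c / (1 + c)))
    have h5 := abs_nonneg (Real.log (c / (1 + c)))
    simp only [Pi.add_apply, Real.norm_eq_abs]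
    rw [abs_le]; constructor <;> linarith
  set r : X → ℝ := fun x => (α.rnDeriv q x).toReal with hr
  have hrm : Measurable r := (Measure.measurable_rnDeriv α q).ennreal_toReal
  have hrnn : ∀ x, 0 ≤ r x := fun x => ENNReal.toReal_nonneg
  have hrpos : ∀ᵐ x ∂α, 0 < r x := by
    filter_upwards [Measure.rnDeriv_pos hα_ac_q,
      hα_ac_q.ae_le (Measure.rnDeriv_lt_top α q)] with x h1 h2
    exact ENNReal.toReal_pos h1.ne' h2.ne
  set A : Set X := {x | r x ≠ 0} with hA
  have hAm : MeasurableSet A := (measurableSet_singleton (0:ℝ)).compl.preimage hrm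
  have hrg : ∀ k : X → ℝ, (fun x => (α.rnDeriv q x).toReal • ((r x)⁻¹ * k x))
      = A.indicator k := by
    intro k
    ext x
    by_cases hx : r x = 0
    · have : x ∉ A := by simpa [hA] using hx
      rw [Set.indicator_of_notMem this]
      show r x • ((r x)⁻¹ * k x) = 0
      simp [hx]
    · rw [Set.indicator_of_mem (show x ∈ A from hx)]
      show r x * ((r x)⁻¹ * k x) = k x
      field_simp
  have hgint : ∀ k : X → ℝ, Integrable k q → Integrable (fun x => (r x)⁻¹ * k x) α := by
    intro k hk
    rw [← integrable_rnDeriv_smul_iff hα_ac_q, hrg]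
    exact hk.indicator hAm
  have hgeq : ∀ k : X → ℝ, ∫ x, (r x)⁻¹ * k x ∂α = ∫ x in A, k x ∂q := by
    intro k
    rw [← integral_rnDeriv_smul hα_ac_q, hrg, integral_indicator hAm]
  have hqA : q.real A ≠ 1 := by
    intro hcon
    apply hq_not_ac
    have h1 : ∀ᵐ x ∂q, x ∈ A := by
      have h3 : q A = 1 := by
        rw [measureReal_def, ENNReal.toReal_eq_one_iff] at hcon
        exact hcon
      exact (mem_ae_iff_prob_eq_one hAm).2 h3
    have h2 : q ≪ q.withDensity (α.rnDeriv q) := by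
      apply withDensity_absolutelyContinuous' (Measure.measurable_rnDeriv α q).aemeasurable
      filter_upwards [h1] with x hx h0
      exact hx (by simp [hr, h0])
    rwa [Measure.withDensity_rnDeriv_eq _ _ hα_ac_q] at h2
  have hwint : Integrable w q := by
    refine Integrable.mono' (integrable_const (w xo)) hwm.aestronglyMeasurable ?_
    filter_upwards with x
    rw [Real.norm_eq_abs, abs_of_pos (hw_pos x)]; exact hxo x
  have hhint : Integrable h q := (integrable_const (1 + c)).sub (hwint.div_const θ)
  have hhq : ∫ x, h x ∂q = 1 + c - (∫ x, w x ∂q) / θ := by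
    simp only [hh]
    rw [integral_sub (integrable_const _) (hwint.div_const θ), integral_div]; simp
  have hm0 : 0 < ∫ x, w x ∂q := by
    rw [integral_pos_iff_support_of_nonneg (fun x => (hw_pos x).le) hwint]
    have : Function.support w = Set.univ := by
      ext x; simp [(hw_pos x).ne']
    rw [this]; simp
  have hginv : Integrable (fun x => (r x)⁻¹) α := by
    simpa using hgint (fun _ => 1) (integrable_const 1)
  have hlogrm : Measurable (fun x => Real.log (r x)) := Real.measurable_log.comp hrm
  have hneg : ∫⁻ x, ENNReal.ofReal (-Real.log (r x)) ∂α ≠ ⊤ := by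
    have h1 := hginv.lintegral_lt_top
    refine ne_top_of_le_ne_top h1.ne (lintegral_mono_ae ?_)
    filter_upwards [hrpos] with x hx
    apply ENNReal.ofReal_le_ofReal
    rw [← Real.log_inv]
    have := Real.log_le_sub_one_of_pos (inv_pos.2 hx)
    linarith
  rw [relEnt, if_pos hα_ac_q]
  change _ - (c : EReal) * intLog α r < _
  by_cases htop : ∫⁻ x, ENNReal.ofReal (Real.log (r x)) ∂α = ⊤
  · have h1 : intLog α r = ⊤ := by
      rw [intLog, htop]
      lift (∫⁻ x, ENNReal.ofReal (-Real.log (r x)) ∂α) to NNReal using hneg with b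
      exact EReal.top_sub_coe (b : ℝ)
    rw [h1, EReal.coe_mul_top_of_pos hc, EReal.sub_top]
    exact EReal.bot_lt_coe _
  have hlogr : Integrable (fun x => Real.log (r x)) α := by
    refine ⟨hlogrm.aestronglyMeasurable, ?_⟩
    rw [hasFiniteIntegral_iff_norm]
    have h1 : ∀ x, ENNReal.ofReal ‖Real.log (r x)‖
        ≤ ENNReal.ofReal (Real.log (r x)) + ENNReal.ofReal (-Real.log (r x)) := by
      intro x
      rw [Real.norm_eq_abs]
      rcases abs_cases (Real.log (r x)) with ⟨h, _⟩ | ⟨h, _⟩ <;> rw [h]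
      · exact le_self_add
      · exact le_add_self
    refine lt_of_le_of_lt (lintegral_mono h1) ?_
    rw [lintegral_add_left (by fun_prop)]
    exact ENNReal.add_lt_top.2 ⟨lt_top_iff_ne_top.2 htop, lt_top_iff_ne_top.2 hneg⟩
  have hrel : intLog α r = ((∫ x, Real.log (r x) ∂α : ℝ) : EReal) := by
    rw [intLog, integral_eq_lintegral_pos_part_sub_lintegral_neg_part hlogr, EReal.coe_sub,
      EReal.coe_ennreal_toReal htop, EReal.coe_ennreal_toReal hneg]
  rw [hrel]
  norm_cast
  -- the real inequality
  set u : X → ℝ := fun x => (r x)⁻¹ * h x / c with hu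
  have huint : Integrable u α := (hgint h hhint).div_const c
  have huI : c * ∫ x, u x ∂α ≤ 1 + c - (∫ x, w x ∂q) / θ := by
    simp only [hu]
    rw [integral_div, hgeq, mul_div_cancel₀ _ hc.ne', ← hhq]
    exact setIntegral_le_integral hhint (Eventually.of_forall hh0)
  have hlogu : (fun x => Real.log (u x)) =ᵐ[α] fun x => -Real.log (r x) - Real.log (f x) := by
    filter_upwards [hpos, hrpos] with x hx hx2
    simp only [hu, hfx]
    rw [Real.log_div (by positivity) hc.ne', Real.log_mul (by positivity) hx.ne',
      Real.log_inv, Real.log_div hc.ne' hx.ne']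
    ring
  have hloguint : Integrable (fun x => Real.log (u x)) α :=
    (hlogr.neg.sub hlogf).congr hlogu.symm
  have hloguI : ∫ x, Real.log (u x) ∂α
      = -(∫ x, Real.log (r x) ∂α) - ∫ x, Real.log (f x) ∂α := by
    have hlogrn : Integrable (fun x => -Real.log (r x)) α := hlogr.neg
    rw [integral_congr_ae hlogu, integral_sub hlogrn hlogf, integral_neg]
  have hupos : ∀ᵐ x ∂α, 0 < u x := by
    filter_upwards [hpos, hrpos] with x hx hx2
    simp only [hu]; positivity
  set v : X → ℝ := fun x => u x - 1 - Real.log (u x) with hv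
  have hvint : Integrable v α := (huint.sub (integrable_const 1)).sub hloguint
  have hvnn : 0 ≤ᵐ[α] v := by
    filter_upwards [hupos] with x hx
    have := Real.log_le_sub_one_of_pos hx
    simp only [hv, Pi.zero_apply]; linarith
  have hvI : ∫ x, v x ∂α = (∫ x, u x ∂α) - 1 - ∫ x, Real.log (u x) ∂α := by
    simp only [hv]
    have hu1 : Integrable (fun x => u x - 1) α := huint.sub (integrable_const 1)
    rw [integral_sub hu1 hloguint,
      integral_sub huint (integrable_const 1)]
    simp
  have hvpos : 0 < ∫ x, v x ∂α := by
    refine lt_of_le_of_ne (integral_nonneg_of_ae hvnn) ?_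
    intro hcon
    have h0 := (integral_eq_zero_iff_of_nonneg_ae hvnn hvint).1 hcon.symm
    apply hqA
    have h1 : ∫ x, (r x)⁻¹ ∂α = ∫ x, f x ∂α := by
      apply integral_congr_ae
      filter_upwards [h0, hupos, hpos, hrpos] with x hx hx1 hx2 hx3
      have hu1 : u x = 1 := by
        by_contra hne
        have := Real.log_lt_sub_one_of_pos hx1 hne
        simp only [hv, Pi.zero_apply] at hx
        linarith
      rw [hfx, eq_div_iff hx2.ne']
      simp only [hu] at hu1
      rwa [div_eq_one_iff_eq hc.ne'] at hu1
    have h2 := hgeq (fun _ => 1)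
    simp only [mul_one] at h2
    rw [h1, hf1] at h2
    simpa using h2.symm
  have hlogm : Real.log (∫ x, w x ∂q) - Real.log θ ≤ (∫ x, w x ∂q) / θ - 1 := by
    rw [← Real.log_div hm0.ne' hθ0.ne']
    exact Real.log_le_sub_one_of_pos (div_pos hm0 hθ0)
  rw [hvI, hloguI] at hvpos
  have hfin := mul_pos hc hvpos
  nlinarith
end

section
/- Assume ∫_X w̄/(w̄ − w(x)) ᾱ(dx) < (1+c)/c (with the integrand +∞ where w = w̄) and that x_o is the unique point with w(x_o) = w̄. Let f(x) := c·w̄/((1+c)(w̄ − w(x))), β := ∫_X f dᾱ (so β < 1), and let q* be the probability measure q*(A) := ∫_A f dᾱ + (1−β)·δ_{x_o}(A). Then for every Borel probability measure q on X with ᾱ ≪ q, q not absolutely continuous with respect to ᾱ (i.e. q ∈ 𝒫_1 \ 𝒫_0), and q ≠ q*, it holds that ln(∫_X w dq) − c·D(ᾱ‖q) < ln(∫_X w dq*) − c·D(ᾱ‖q*), the right-hand side being equal to ln(w̄/(1+c)) + c ∫_X ln f dᾱ. -/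
open MeasureTheory Filter Topology
open scoped ENNReal Classical

lemma relEnt_eq_aux {X : Type*} [MeasurableSpace X] (α q : Measure X)
    [IsProbabilityMeasure α] [IsFiniteMeasure q] (hac : α ≪ q) (h : X → ℝ)
    (hh : ∀ᵐ x ∂α, (q.rnDeriv α x).toReal = h x) :
    relEnt α q = ((∫⁻ x, ENNReal.ofReal (-Real.log (h x)) ∂α : ℝ≥0∞) : EReal)
    - ((∫⁻ x, ENNReal.ofReal (Real.log (h x)) ∂α : ℝ≥0∞) : EReal) := by
  have key : ∀ᵐ x ∂α, Real.log ((α.rnDeriv q x).toReal) = - Real.log (h x) := by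
    filter_upwards [Measure.inv_rnDeriv hac, hh] with x h1 h2
    rw [← h2, ← h1, Pi.inv_apply, ENNReal.toReal_inv, Real.log_inv, neg_neg]
  unfold relEnt intLog
  rw [if_pos hac]
  congr 1
  · congr 1
    apply lintegral_congr_ae
    filter_upwards [key] with x hx
    rw [hx]
  · congr 1
    apply lintegral_congr_ae
    filter_upwards [key] with x hx
    rw [hx, neg_neg]

lemma relEnt_of_int {X : Type*} [MeasurableSpace X] (α q : Measure X)
    [IsProbabilityMeasure α] [IsFiniteMeasure q] (hac : α ≪ q) (h : X → ℝ)
    (hh : ∀ᵐ x ∂α, (q.rnDeriv α x).toReal = h x)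
    (hint : Integrable (fun x => Real.log (h x)) α) :
    relEnt α q = ((-∫ x, Real.log (h x) ∂α : ℝ) : EReal) := by
  rw [relEnt_eq_aux α q hac h hh, ← integral_neg,
    integral_eq_lintegral_pos_part_sub_lintegral_neg_part (f := fun x => -Real.log (h x)) hint.neg]
  simp only [neg_neg]
  have h1 : (∫⁻ x, ENNReal.ofReal (-Real.log (h x)) ∂α) ≠ ⊤ := hint.neg.lintegral_lt_top.ne
  have h2 : (∫⁻ x, ENNReal.ofReal (Real.log (h x)) ∂α) ≠ ⊤ := hint.lintegral_lt_top.ne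
  rw [EReal.coe_sub, EReal.coe_ennreal_toReal h1, EReal.coe_ennreal_toReal h2]

lemma relEnt_of_not_int {X : Type*} [MeasurableSpace X] (α q : Measure X)
    [IsProbabilityMeasure α] [IsFiniteMeasure q] (hac : α ≪ q)
    (hint : ¬ Integrable (fun x => Real.log ((q.rnDeriv α x).toReal)) α) :
    relEnt α q = ⊤ := by
  rw [relEnt_eq_aux α q hac (fun x => (q.rnDeriv α x).toReal) (by simp)]
  have hm : Measurable (fun x => Real.log ((q.rnDeriv α x).toReal)) := by fun_prop
  have h2 : (∫⁻ x, ENNReal.ofReal (Real.log ((q.rnDeriv α x).toReal)) ∂α) ≠ ⊤ := by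
    refine ne_top_of_le_ne_top (Measure.integrable_toReal_rnDeriv
      (μ := q) (ν := α)).lintegral_lt_top.ne (lintegral_mono fun x => ?_)
    exact ENNReal.ofReal_le_ofReal (Real.log_le_self ENNReal.toReal_nonneg)
  have h1 : (∫⁻ x, ENNReal.ofReal (-Real.log ((q.rnDeriv α x).toReal)) ∂α) = ⊤ := by
    by_contra h1
    apply hint
    refine ⟨hm.aestronglyMeasurable, ?_⟩
    rw [hasFiniteIntegral_iff_norm]
    have : ∀ r : ℝ, ENNReal.ofReal ‖r‖ ≤ ENNReal.ofReal r + ENNReal.ofReal (-r) := by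
      intro r
      rcases le_total 0 r with h | h
      · rw [Real.norm_of_nonneg h]; exact le_self_add
      · rw [Real.norm_of_nonpos h]; exact le_add_self
    refine lt_of_le_of_lt (lintegral_mono fun x => this _) ?_
    rw [lintegral_add_left hm.ennreal_ofReal]
    exact ENNReal.add_lt_top.2 ⟨h2.lt_top, (Ne.lt_top h1)⟩
  rw [h1]
  lift (∫⁻ x, ENNReal.ofReal (Real.log ((q.rnDeriv α x).toReal)) ∂α) to NNReal using h2 with r
  exact EReal.top_sub_coe (r : ℝ)

/-- **Lemma `lemma4` (inequality \eqref{marta} fails, `q ∈ 𝒫₁ \ 𝒫₀`).**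
Under `∫ w̄/(w̄ − w) dᾱ < (1+c)/c`, `x₀` the unique maximizer of `w`,
`f = c w̄/((1+c)(w̄ − w))`, `β = ∫ f dᾱ < 1` and
`q* = f dᾱ + (1−β) δ_{x₀}`: every Borel probability measure `q` with `ᾱ ≪ q`,
`¬(q ≪ ᾱ)` and `q ≠ q*` satisfies
`ln(∫ w dq) − c·D(ᾱ‖q) < ln(∫ w dq*) − c·D(ᾱ‖q*)`, and the right-hand side
equals `ln(w̄/(1+c)) + c ∫ ln f dᾱ`. -/
theorem stmt_17
    {X : Type*} [MeasurableSpace X] [TopologicalSpace X] [PolishSpace X] [BorelSpace X]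
    (α : Measure X) [IsProbabilityMeasure α]
    (w : X → ℝ) (hw_pos : ∀ x, 0 < w x) (hw_cont : Continuous w)
    (xo : X) (hxo : ∀ x, w x ≤ w xo) (hxo_unique : ∀ x, x ≠ xo → w x < w xo)
    (c : ℝ) (hc : 0 < c)
    (hmarta_fails : (∫⁻ x, ENNReal.ofReal (w xo) / ENNReal.ofReal (w xo - w x) ∂α)
      < ENNReal.ofReal ((1 + c) / c))
    (f : X → ℝ) (hf : f = fun x => c * w xo / ((1 + c) * (w xo - w x)))
    (β : ℝ) (hβ : β = ∫ x, f x ∂α) (hβlt : β < 1)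
    (qstar : Measure X)
    (hqstar : qstar = α.withDensity (fun x => ENNReal.ofReal (f x))
      + (ENNReal.ofReal (1 - β)) • Measure.dirac xo)
    (q : Measure X) [IsProbabilityMeasure q]
    (hα_ac_q : α ≪ q) (hq_not_ac : ¬ q ≪ α) (hq_ne : q ≠ qstar) :
    ((Real.log (∫ x, w x ∂q) : ℝ) : EReal) - (c : EReal) * relEnt α q
      < ((Real.log (∫ x, w x ∂qstar) : ℝ) : EReal) - (c : EReal) * relEnt α qstar
    ∧ ((Real.log (∫ x, w x ∂qstar) : ℝ) : EReal) - (c : EReal) * relEnt α qstar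
      = (((Real.log (w xo / (1 + c)) + c * ∫ x, Real.log (f x) ∂α : ℝ)) : EReal) := by
  
  have hW := hw_pos xo
  set W := w xo with hWdef
  have hwm : Measurable w := hw_cont.measurable
  have hfm : Measurable f := by rw [hf]; fun_prop
  -- `α` does not charge `xo`
  have hne : ∀ᵐ x ∂α, x ≠ xo := by
    have hlt := ae_lt_top (μ := α)
      (f := fun x => ENNReal.ofReal W / ENNReal.ofReal (W - w x)) (by fun_prop)
      (ne_top_of_lt hmarta_fails)
    filter_upwards [hlt] with x hx hxx
    subst hxx
    simp [hWdef, ENNReal.div_zero, hw_pos] at hx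
  set k : X → ℝ := fun x => (1 + c) * (W - w x) / (c * W) with hk
  have hkm : Measurable k := by fun_prop
  have hk0 : ∀ x, 0 ≤ k x := fun x => by
    have := hxo x
    have : 0 ≤ W - w x := by linarith
    simp only [hk]; positivity
  have hkb : ∀ x, k x ≤ (1 + c) / c := fun x => by
    have := (hw_pos x).le
    simp only [hk]
    rw [div_le_div_iff₀ (by positivity) hc]
    nlinarith [mul_nonneg (mul_nonneg (by positivity : 0 ≤ 1 + c) this) hc.le]
  have hkpos : ∀ x, x ≠ xo → 0 < k x := fun x hx => by
    have : 0 < W - w x := by linarith [hxo_unique x hx]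
    simp only [hk]; positivity
  have hkf : ∀ x, x ≠ xo → f x = (k x)⁻¹ := fun x hx => by
    rw [hf]; simp only [hk]; rw [inv_div]
  have hf0 : ∀ x, 0 ≤ f x := fun x => by
    by_cases hx : x = xo
    · rw [hf, hx]; simp [hWdef]
    · rw [hkf x hx]; exact inv_nonneg.2 (hk0 x)
  have hfpos : ∀ᵐ x ∂α, 0 < f x := by
    filter_upwards [hne] with x hx
    rw [hkf x hx]; exact inv_pos.2 (hkpos x hx)
  -- integrability of `f`
  have hfint : Integrable f α := by
    refine ⟨hfm.aestronglyMeasurable, ?_⟩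
    rw [hasFiniteIntegral_iff_ofReal (ae_of_all _ hf0)]
    refine lt_of_le_of_lt (b := ∫⁻ x, ENNReal.ofReal (c / (1 + c)) *
      (ENNReal.ofReal W / ENNReal.ofReal (W - w x)) ∂α) (lintegral_mono_ae ?_) ?_
    · filter_upwards [hne] with x hx
      have h1 : 0 < W - w x := by linarith [hxo_unique x hx]
      rw [← ENNReal.ofReal_div_of_pos h1, ← ENNReal.ofReal_mul (by positivity)]
      apply ENNReal.ofReal_le_ofReal
      rw [hf]
      apply le_of_eq
      field_simp
    · rw [lintegral_const_mul _ (by fun_prop)]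
      exact ENNReal.mul_lt_top ENNReal.ofReal_lt_top (hmarta_fails.trans ENNReal.ofReal_lt_top)
  have hlogf : Integrable (fun x => Real.log (f x)) α := by
    have hb : Integrable (fun x => f x + |Real.log (c / (1 + c))|) α :=
      hfint.add (integrable_const _)
    refine hb.mono' hfm.log.aestronglyMeasurable ?_
    filter_upwards [hne] with x hx
    have h1 : Real.log (f x) ≤ f x := Real.log_le_self (hf0 x)
    have h2 : Real.log (c / (1 + c)) ≤ Real.log (f x) := by
      apply Real.log_le_log (by positivity)
      rw [hkf x hx, ← inv_div]
      exact inv_anti₀ (hkpos x hx) (hkb x)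
    rw [Real.norm_eq_abs, abs_le]
    constructor
    · linarith [neg_abs_le (Real.log (c / (1 + c))), hf0 x]
    · linarith [abs_nonneg (Real.log (c / (1 + c)))]
  -- `qstar`
  have hfl : ∫⁻ x, ENNReal.ofReal (f x) ∂α = ENNReal.ofReal β := by
    rw [hβ, ofReal_integral_eq_lintegral_ofReal hfint (ae_of_all _ hf0)]
  have hfin1 : IsFiniteMeasure (α.withDensity (fun x => ENNReal.ofReal (f x))) :=
    isFiniteMeasure_withDensity (by rw [hfl]; exact ENNReal.ofReal_ne_top)
  have hfin2 : IsFiniteMeasure ((ENNReal.ofReal (1 - β)) • Measure.dirac xo) :=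
    Measure.smul_finite _ ENNReal.ofReal_ne_top
  have hfin : IsFiniteMeasure qstar := by rw [hqstar]; infer_instance
  have hacs : α ≪ qstar := by
    rw [hqstar]
    refine Measure.AbsolutelyContinuous.add_right ?_ _
    refine withDensity_absolutelyContinuous' (by fun_prop) ?_
    filter_upwards [hfpos] with x hx
    simpa using hx
  have hrns : ∀ᵐ x ∂α, (qstar.rnDeriv α x).toReal = f x := by
    have hsing : ((ENNReal.ofReal (1 - β)) • Measure.dirac xo) ⟂ₘ α := by
      refine ⟨{xo}ᶜ, (measurableSet_singleton xo).compl, ?_, ?_⟩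
      · simp
      · rw [compl_compl]
        simpa [ae_iff] using hne
    have := Measure.eq_rnDeriv (μ := qstar) (ν := α) (f := fun x => ENNReal.ofReal (f x))
      (s := (ENNReal.ofReal (1 - β)) • Measure.dirac xo) (by fun_prop) hsing
      (by rw [hqstar, add_comm])
    filter_upwards [this] with x hx
    rw [← hx, ENNReal.toReal_ofReal (hf0 x)]
  have hwb : ∀ (μ : Measure X) [IsFiniteMeasure μ], Integrable w μ := fun μ _ =>
    Integrable.of_bound hwm.aestronglyMeasurable W (ae_of_all _ fun x => by
      rw [Real.norm_of_nonneg (hw_pos x).le]; exact hxo x)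
  have hws : ∫ x, w x ∂qstar = W / (1 + c) := by
    rw [hqstar, integral_add_measure (hwb _) (hwb _), integral_smul_measure, integral_dirac,
      integral_withDensity_eq_integral_toReal_smul (by fun_prop) (by simp)]
    have e : ∫ x, (ENNReal.ofReal (f x)).toReal • w x ∂α = ∫ x, (W * f x - c * W / (1 + c)) ∂α := by
      apply integral_congr_ae
      filter_upwards [hne] with x hx
      have h1 : W - w x ≠ 0 := by linarith [hxo_unique x hx] |> fun (h : 0 < W - w x) => h.ne'
      rw [ENNReal.toReal_ofReal (hf0 x), smul_eq_mul, hf]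
      field_simp
      ring
    rw [e, integral_sub (hfint.const_mul _) (integrable_const _), integral_const_mul, ← hβ,
      ENNReal.toReal_ofReal (by linarith)]
    simp only [integral_const, probReal_univ, smul_eq_mul, ← hWdef]
    field_simp
    ring
  have hR : ((Real.log (∫ x, w x ∂qstar) : ℝ) : EReal) - (c : EReal) * relEnt α qstar
      = (((Real.log (W / (1 + c)) + c * ∫ x, Real.log (f x) ∂α : ℝ)) : EReal) := by
    rw [relEnt_of_int α qstar hacs f hrns hlogf, hws, ← EReal.coe_mul, ← EReal.coe_sub]
    congr 1
    ring
  refine ⟨?_, hR⟩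
  rw [hR]
  set h : X → ℝ := fun x => (q.rnDeriv α x).toReal with hh
  by_cases hint : Integrable (fun x => Real.log (h x)) α
  swap
  · rw [relEnt_of_not_int α q hα_ac_q hint, EReal.coe_mul_top_of_pos hc]
    exact EReal.bot_lt_coe _
  rw [relEnt_of_int α q hα_ac_q h (by simp [hh]) hint, ← EReal.coe_mul, ← EReal.coe_sub,
    EReal.coe_lt_coe_iff]
  by_contra hcon
  rw [not_lt] at hcon
  apply hq_ne
  have hhm : Measurable h := by fun_prop
  have hhpos : ∀ᵐ x ∂α, 0 < h x := by
    filter_upwards [Measure.rnDeriv_pos' hα_ac_q, Measure.rnDeriv_ne_top q α] with x h1 h2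
    exact ENNReal.toReal_pos h1.ne' h2
  have hhint : Integrable h α := Measure.integrable_toReal_rnDeriv
  have hdec : q = q.singularPart α + α.withDensity (q.rnDeriv α) :=
    Measure.haveLebesgueDecomposition_add q α
  have hkb' : ∀ (μ : Measure X) [IsFiniteMeasure μ], Integrable k μ := fun μ _ =>
    Integrable.of_bound hkm.aestronglyMeasurable ((1 + c) / c) (ae_of_all _ fun x => by
      rw [Real.norm_of_nonneg (hk0 x)]; exact hkb x)
  have hhk : Integrable (fun x => h x * k x) α :=
    hhint.mul_bdd (c := (1 + c) / c) hkm.aestronglyMeasurable (ae_of_all _ fun x => by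
      rw [Real.norm_of_nonneg (hk0 x)]; exact hkb x)
  set m := ∫ x, w x ∂q with hm
  have hkq1 : ∫ x, k x ∂q = (1 + c) * (W - m) / (c * W) := by
    simp only [hk]
    rw [integral_div, integral_const_mul, integral_sub (integrable_const _) (hwb q)]
    simp [hm]
  have hkq2 : ∫ x, k x ∂q = ∫ x, k x ∂(q.singularPart α) + ∫ x, h x * k x ∂α := by
    conv_lhs => rw [hdec]
    rw [integral_add_measure (hkb' _) (hkb' _),
      integral_withDensity_eq_integral_toReal_smul (by fun_prop) (Measure.rnDeriv_lt_top q α)]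
    simp [hh]
  have hmpos : 0 < m := by
    rw [hm, integral_pos_iff_support_of_nonneg (fun x => (hw_pos x).le) (hwb q)]
    have : Function.support w = Set.univ := by
      ext x; simpa using (hw_pos x).ne'
    rw [this]; simp
  have hD2 : 0 ≤ ∫ x, k x ∂(q.singularPart α) := integral_nonneg hk0
  have hlogk : ∀ᵐ x ∂α, 0 ≤ h x * k x - 1 - (Real.log (h x) - Real.log (f x)) ∧
      (h x * k x - 1 - (Real.log (h x) - Real.log (f x)) = 0 → h x = f x) := by
    filter_upwards [hne, hhpos] with x hx h1
    have h2 := hkpos x hx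
    have h3 : Real.log (h x) - Real.log (f x) = Real.log (h x * k x) := by
      rw [hkf x hx, Real.log_inv, Real.log_mul h1.ne' h2.ne']; ring
    rw [h3]
    refine ⟨by linarith [Real.log_le_sub_one_of_pos (mul_pos h1 h2)], fun h4 => ?_⟩
    have h5 : h x * k x = 1 := by
      by_contra h6
      linarith [Real.log_lt_sub_one_of_pos (mul_pos h1 h2) h6]
    rw [hkf x hx]
    exact eq_inv_of_mul_eq_one_left h5
  have hDint : Integrable (fun x => h x * k x - 1 - (Real.log (h x) - Real.log (f x))) α :=
    (hhk.sub (integrable_const _)).sub (hint.sub hlogf)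
  have hD1 : 0 ≤ ∫ x, (h x * k x - 1 - (Real.log (h x) - Real.log (f x))) ∂α :=
    integral_nonneg_of_ae (hlogk.mono fun x hx => hx.1)
  have hD1e : ∫ x, (h x * k x - 1 - (Real.log (h x) - Real.log (f x))) ∂α
      = ∫ x, h x * k x ∂α - 1 - (∫ x, Real.log (h x) ∂α - ∫ x, Real.log (f x) ∂α) := by
    have e1 : Integrable (fun x => h x * k x - 1) α := hhk.sub (integrable_const _)
    have e2 : Integrable (fun x => Real.log (h x) - Real.log (f x)) α := hint.sub hlogf
    rw [integral_sub e1 e2,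
      integral_sub hhk (integrable_const _), integral_sub hint hlogf]
    simp
  have hD3 : Real.log m - Real.log (W / (1 + c)) ≤ m * (1 + c) / W - 1 := by
    rw [← Real.log_div hmpos.ne' (by positivity)]
    have := Real.log_le_sub_one_of_pos (x := m / (W / (1 + c))) (by positivity)
    rwa [div_div_eq_mul_div] at this ⊢
  have hce : c * ((1 + c) * (W - m) / (c * W)) = (1 + c) - m * (1 + c) / W := by
    field_simp
  have hsum : c * (∫ x, (h x * k x - 1 - (Real.log (h x) - Real.log (f x))) ∂α)
      + c * ∫ x, k x ∂(q.singularPart α) ≤ 0 := by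
    rw [hD1e]
    rw [← hkq1, hkq2] at hce
    nlinarith
  have hD1z : ∫ x, (h x * k x - 1 - (Real.log (h x) - Real.log (f x))) ∂α = 0 := by
    nlinarith [mul_nonneg hc.le hD1, mul_nonneg hc.le hD2]
  have hD2z : ∫ x, k x ∂(q.singularPart α) = 0 := by
    nlinarith [mul_nonneg hc.le hD1, mul_nonneg hc.le hD2]
  have hhf : ∀ᵐ x ∂α, q.rnDeriv α x = ENNReal.ofReal (f x) := by
    rw [integral_eq_zero_iff_of_nonneg_ae (hlogk.mono fun x hx => hx.1) hDint] at hD1z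
    filter_upwards [hD1z, hlogk, Measure.rnDeriv_ne_top q α] with x h1 h2 h3
    rw [← h2.2 h1, hh, ENNReal.ofReal_toReal h3]
  have hsx : ∀ᵐ x ∂(q.singularPart α), x ∈ ({xo} : Set X) := by
    rw [integral_eq_zero_iff_of_nonneg hk0 (hkb' _)] at hD2z
    filter_upwards [hD2z] with x hx
    by_contra h1
    exact (hkpos x h1).ne' hx
  have hs : q.singularPart α = (q.singularPart α {xo}) • Measure.dirac xo := by
    rw [← Measure.restrict_singleton, Measure.restrict_eq_self_of_ae_mem hsx]
  rw [withDensity_congr_ae hhf, hs] at hdec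
  have hmass : q.singularPart α {xo} = ENNReal.ofReal (1 - β) := by
    have h1 := congrArg (fun μ : Measure X => μ Set.univ) hdec
    simp only [Measure.add_apply, Measure.smul_apply, measure_univ, smul_eq_mul, mul_one,
      withDensity_apply _ MeasurableSet.univ, Measure.restrict_univ, hfl] at h1
    have hβ0 : 0 ≤ β := by rw [hβ]; exact integral_nonneg hf0
    rw [ENNReal.ofReal_sub _ hβ0, ENNReal.ofReal_one]
    exact ENNReal.eq_sub_of_add_eq ENNReal.ofReal_ne_top h1.symm
  rw [hdec, hqstar, hmass, add_comm]
end

section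
/- Assume ∫_X 1/(φ(x) − φ_o) ᾱ(dx) ≥ 1/c (with the integrand +∞ where φ = φ_o), and let θ ∈ [φ_o, φ_o + c] be such that f(x) := c/(φ(x) + c − θ) is a probability density with respect to ᾱ (so θ = ∫_X φ f dᾱ). Then the measure with density f with respect to ᾱ is the unique maximizer of F(q) := −∫_X φ dq − c·D(ᾱ‖q) over 𝒫_1; that is, for every q ∈ 𝒫_1 with q ≠ f dᾱ it holds that −∫_X φ dq − c·D(ᾱ‖q) < −θ + c ∫_X ln f dᾱ. -/
open MeasureTheory Filter Topology
open scoped ENNReal Classical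

/-- **Lemma `lemma1a` (inequality \eqref{marta2} holds).**
Under `∫ 1/(φ − φ₀) dᾱ ≥ 1/c`, with `θ ∈ [φ₀, φ₀ + c]` such that
`f = c/(φ + c − θ)` is a probability density w.r.t. `ᾱ` (so `θ = ∫ φ f dᾱ`), the
measure `f dᾱ` is the unique maximizer of `F(q) = −∫ φ dq − c·D(ᾱ‖q)` over
`𝒫₁ = {q : ᾱ ≪ q}`: every Borel probability measure `q` with `ᾱ ≪ q` and
`q ≠ f dᾱ` satisfies `−∫ φ dq − c·D(ᾱ‖q) < −θ + c ∫ ln f dᾱ`. -/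
theorem stmt_18
    {X : Type*} [MeasurableSpace X] [TopologicalSpace X] [PolishSpace X] [BorelSpace X]
    (α : Measure X) [IsProbabilityMeasure α]
    (φ : X → ℝ) (hφmeas : Measurable φ) (hφ0 : ∀ x, 0 ≤ φ x) (hφbdd : ∃ M : ℝ, ∀ x, φ x ≤ M)
    [Nonempty X] (φo : ℝ) (hφo : φo = ⨅ x, φ x)
    (c : ℝ) (hc : 0 < c)
    (hmarta2 : ENNReal.ofReal (1 / c)
      ≤ ∫⁻ x, 1 / ENNReal.ofReal (φ x - φo) ∂α)
    (θ : ℝ) (hθ : θ ∈ Set.Icc φo (φo + c))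
    (f : X → ℝ) (hf : f = fun x => c / (φ x + c - θ))
    (hfdens : ∫⁻ x, ENNReal.ofReal c / ENNReal.ofReal (φ x + c - θ) ∂α = 1)
    (hθeq : θ = ∫ x, φ x * f x ∂α)
    (q : Measure X) [IsProbabilityMeasure q]
    (hα_ac_q : α ≪ q)
    (hq_ne : q ≠ α.withDensity (fun x => ENNReal.ofReal (f x))) :
    (((-∫ x, φ x ∂q : ℝ)) : EReal) - (c : EReal) * relEnt α q
      < (((-θ + c * ∫ x, Real.log (f x) ∂α : ℝ)) : EReal) := by
  obtain ⟨M, hM⟩ := hφbdd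
  have hlow : ∀ x, φo ≤ φ x := fun x => by
    rw [hφo]; exact ciInf_le ⟨0, by rintro _ ⟨y, rfl⟩; exact hφ0 y⟩ x
  have hu0 : ∀ x, 0 ≤ φ x + c - θ := fun x => by linarith [hlow x, hθ.2]
  have hum : Measurable fun x => φ x + c - θ := by fun_prop
  have hfm : Measurable f := by rw [hf]; fun_prop
  -- u > 0 a.e.
  have hupos : ∀ᵐ x ∂α, 0 < φ x + c - θ := by
    have h1 : Measurable fun x => ENNReal.ofReal c / ENNReal.ofReal (φ x + c - θ) := by fun_prop
    filter_upwards [ae_lt_top h1 (by rw [hfdens]; simp)] with x hx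
    by_contra hcon
    rw [ENNReal.ofReal_of_nonpos (not_lt.mp hcon), ENNReal.div_zero] at hx
    · simp at hx
    · simpa using hc
  have hfd : ∫⁻ x, ENNReal.ofReal (f x) ∂α = 1 := by
    rw [← hfdens]
    refine lintegral_congr_ae ?_
    filter_upwards [hupos] with x hx
    rw [hf]; exact ENNReal.ofReal_div_of_pos hx
  have hf0 : ∀ x, 0 ≤ f x := fun x => by rw [hf]; exact div_nonneg hc.le (hu0 x)
  have hfi : Integrable f α := by
    refine ⟨hfm.aestronglyMeasurable, ?_⟩
    rw [hasFiniteIntegral_iff_ofReal (ae_of_all _ hf0), hfd]; simp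
  have hlogf : Integrable (fun x => Real.log (f x)) α := by
    refine Integrable.mono' (g := fun x => f x + (φ x + c - θ) / c) ?_
      (Real.measurable_log.comp hfm).aestronglyMeasurable ?_
    · refine hfi.add (Integrable.div_const ?_ c)
      refine Integrable.of_bound hum.aestronglyMeasurable (M + c - θ) (ae_of_all _ fun x => ?_)
      rw [Real.norm_of_nonneg (hu0 x)]; linarith [hM x]
    · filter_upwards [hupos] with x hx
      have hfp : 0 < f x := by rw [hf]; exact div_pos hc hx
      have h1 := Real.log_le_sub_one_of_pos hfp
      have h2 := Real.log_le_sub_one_of_pos (inv_pos.mpr hfp)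
      rw [Real.log_inv] at h2
      have h3 : (f x)⁻¹ = (φ x + c - θ) / c := by rw [hf]; simp
      have h4 : 0 < (f x)⁻¹ := inv_pos.mpr hfp
      rw [h3] at h2 h4
      rw [Real.norm_eq_abs, abs_le]; constructor <;> linarith
  -- R
  set R : X → ℝ := fun x => (q.rnDeriv α x).toReal with hR
  have hRm : Measurable R := (Measure.measurable_rnDeriv q α).ennreal_toReal
  have hRi : Integrable R α := Measure.integrable_toReal_rnDeriv
  have hRpos : ∀ᵐ x ∂α, 0 < R x := by
    filter_upwards [Measure.rnDeriv_pos' hα_ac_q, Measure.rnDeriv_lt_top q α] with x h1 h2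
    exact ENNReal.toReal_pos h1.ne' h2.ne
  have hgR : ∀ᵐ x ∂α, Real.log (α.rnDeriv q x).toReal = - Real.log (R x) := by
    filter_upwards [Measure.inv_rnDeriv hα_ac_q] with x hx
    rw [hR]; simp only [← hx, Pi.inv_apply, ENNReal.toReal_inv, Real.log_inv, neg_neg]
  have hle : α.withDensity (q.rnDeriv α) ≤ q := Measure.withDensity_rnDeriv_le q α
  set P := ∫⁻ x, ENNReal.ofReal (Real.log (α.rnDeriv q x).toReal) ∂α with hP
  set N := ∫⁻ x, ENNReal.ofReal (-Real.log (α.rnDeriv q x).toReal) ∂α with hN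
  have hNfin : N ≠ ⊤ := by
    refine ne_top_of_le_ne_top (b := ∫⁻ x, ENNReal.ofReal (R x) ∂α) ?_ ?_
    · exact ((hasFiniteIntegral_iff_ofReal (ae_of_all _ fun x => ENNReal.toReal_nonneg)).1 hRi.2).ne
    · refine lintegral_mono_ae ?_
      filter_upwards [hgR, hRpos] with x h1 h2
      refine ENNReal.ofReal_le_ofReal ?_
      rw [h1]; linarith [Real.log_le_sub_one_of_pos h2]
  have hrel : relEnt α q = (P : EReal) - (N : EReal) := by
    rw [relEnt, if_pos hα_ac_q]; rfl
  by_cases hPfin : P = ⊤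
  · have : relEnt α q = ⊤ := by
      rw [hrel, hPfin]; clear_value N; lift N to NNReal using hNfin; rfl
    rw [this, EReal.coe_mul_top_of_pos hc, EReal.sub_top]
    exact EReal.bot_lt_coe _
  have hgm : Measurable fun x => Real.log (α.rnDeriv q x).toReal :=
    Real.measurable_log.comp (Measure.measurable_rnDeriv α q).ennreal_toReal
  have hgi : Integrable (fun x => Real.log (α.rnDeriv q x).toReal) α := by
    refine ⟨hgm.aestronglyMeasurable, ?_⟩
    rw [hasFiniteIntegral_iff_norm]
    have : ∫⁻ x, ENNReal.ofReal ‖Real.log (α.rnDeriv q x).toReal‖ ∂α ≤ P + N := by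
      rw [hP, hN, ← lintegral_add_left hgm.ennreal_ofReal]
      refine lintegral_mono fun x => ?_
      rw [Real.norm_eq_abs]
      rcases abs_cases (Real.log (α.rnDeriv q x).toReal) with h | h
      · rw [h.1]; exact le_self_add
      · rw [h.1]; exact le_add_self
    exact this.trans_lt (ENNReal.add_lt_top.2 ⟨lt_top_iff_ne_top.2 hPfin, lt_top_iff_ne_top.2 hNfin⟩)
  set A := ∫ x, Real.log (α.rnDeriv q x).toReal ∂α with hA
  have hrelA : relEnt α q = (A : EReal) := by
    rw [hrel, hA, integral_eq_lintegral_pos_part_sub_lintegral_neg_part hgi, ← hP, ← hN,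
      EReal.coe_sub]
    clear_value P N
    lift P to NNReal using hPfin
    lift N to NNReal using hNfin
    rfl
  rw [hrelA, ← EReal.coe_mul, ← EReal.coe_sub, EReal.coe_lt_coe_iff]
  -- the real inequality
  have huq : Integrable (fun x => φ x + c - θ) q := by
    refine Integrable.of_bound hum.aestronglyMeasurable (M + c - θ) (ae_of_all _ fun x => ?_)
    rw [Real.norm_of_nonneg (hu0 x)]; linarith [hM x]
  have hφq : Integrable φ q := by
    refine Integrable.of_bound hφmeas.aestronglyMeasurable M (ae_of_all _ fun x => ?_)
    rw [Real.norm_of_nonneg (hφ0 x)]; exact hM x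
  have huqval : ∫ x, (φ x + c - θ) ∂q = ∫ x, φ x ∂q + c - θ := by
    have h1 : Integrable (fun x => φ x + c) q := hφq.add (integrable_const _)
    rw [integral_sub h1 (integrable_const _), integral_add hφq (integrable_const _)]
    simp
  have hTle : ∫ x, R x * (φ x + c - θ) ∂α ≤ ∫ x, (φ x + c - θ) ∂q := by
    have h := integral_mono_measure hle (ae_of_all _ hu0) huq
    rw [integral_withDensity_eq_integral_toReal_smul (Measure.measurable_rnDeriv q α)
      (Measure.rnDeriv_lt_top q α)] at h
    simpa [hR] using h
  have hTi : Integrable (fun x => R x * (φ x + c - θ)) α := by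
    refine hRi.mul_bdd (c := M + c - θ) hum.aestronglyMeasurable (ae_of_all _ fun x => ?_)
    rw [Real.norm_of_nonneg (hu0 x)]; linarith [hM x]
  set w : X → ℝ := fun x => R x * (φ x + c - θ) / c - 1 + Real.log (f x)
    + Real.log (α.rnDeriv q x).toReal with hw
  have hwi : Integrable w α :=
    (((hTi.div_const c).sub (integrable_const _)).add hlogf).add hgi
  have hwval : ∫ x, w x ∂α = (∫ x, R x * (φ x + c - θ) ∂α) / c - 1 + ∫ x, Real.log (f x) ∂α + A := by
    have h1 : Integrable (fun x => R x * (φ x + c - θ) / c - 1) α :=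
      (hTi.div_const c).sub (integrable_const _)
    have h2 : Integrable (fun x => R x * (φ x + c - θ) / c - 1 + Real.log (f x)) α := h1.add hlogf
    rw [hw, integral_add h2 hgi, integral_add h1 hlogf,
      integral_sub (hTi.div_const c) (integrable_const _), integral_div]
    simp [hA]
  have hwt : ∀ᵐ x ∂α, 0 < R x * (φ x + c - θ) / c ∧ w x = R x * (φ x + c - θ) / c - 1
      - Real.log (R x * (φ x + c - θ) / c) := by
    filter_upwards [hupos, hRpos, hgR] with x h1 h2 h3
    refine ⟨by positivity, ?_⟩
    simp only [hw]
    rw [h3, hf, Real.log_div hc.ne' h1.ne', Real.log_div (mul_pos h2 h1).ne' hc.ne',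
      Real.log_mul h2.ne' h1.ne']
    ring
  have hw0 : 0 ≤ᵐ[α] w := by
    filter_upwards [hwt] with x hx
    rw [hx.2]
    simpa using (sub_nonneg.2 (Real.log_le_sub_one_of_pos hx.1))
  have hwpos : 0 < ∫ x, w x ∂α := by
    refine lt_of_le_of_ne (integral_nonneg_of_ae hw0) fun h => hq_ne ?_
    have hz := (integral_eq_zero_iff_of_nonneg_ae hw0 hwi).1 h.symm
    have hrf : q.rnDeriv α =ᵐ[α] fun x => ENNReal.ofReal (f x) := by
      filter_upwards [hz, hwt, hupos, Measure.rnDeriv_lt_top q α] with x h1 h2 h3 h4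
      have h5 : R x * (φ x + c - θ) / c = 1 := by
        by_contra hne
        have := Real.log_lt_sub_one_of_pos h2.1 hne
        have h6 := h2.2
        rw [h1] at h6
        simp only [Pi.zero_apply] at h6
        linarith
      have h6 : R x = f x := by
        rw [hf]; field_simp at h5 ⊢; linarith
      rw [← h6, hR, ENNReal.ofReal_toReal h4.ne]
    rw [withDensity_congr_ae hrf] at hle
    have huniv : α.withDensity (fun x => ENNReal.ofReal (f x)) Set.univ = 1 := by
      rw [withDensity_apply _ MeasurableSet.univ, setLIntegral_univ, hfd]
    haveI : IsProbabilityMeasure (α.withDensity (fun x => ENNReal.ofReal (f x))) := ⟨huniv⟩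
    refine (Measure.eq_of_le_of_measure_univ_eq hle ?_).symm
    rw [huniv]; simp
  rw [hwval] at hwpos
  rw [huqval] at hTle
  have h7 : (∫ x, R x * (φ x + c - θ) ∂α) / c ≤ (∫ x, φ x ∂q + c - θ) / c := by gcongr
  have h8 : 0 < c * ((∫ x, φ x ∂q + c - θ) / c - 1 + ∫ x, Real.log (f x) ∂α + A) :=
    mul_pos hc (by linarith)
  have h9 : c * ((∫ x, φ x ∂q + c - θ) / c - 1 + ∫ x, Real.log (f x) ∂α + A)
    = (∫ x, φ x ∂q) - θ + c * ∫ x, Real.log (f x) ∂α + c * A := by field_simp; ring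
  linarith
end
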